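/- Let (u, w, b, Π) be a smooth solution of the stationary magneto-micropolar equations on ℝ³ satisfying the potential growth hypothesis: there exist smooth Φ, Ψ, Υ : ℝ³ → ℝ^{3×3} with div Φ = u, div Ψ = b, div Υ = w, an exponent s ∈ (3, 6], and a constant C₀ > 0 such that the sum of the s-mean oscillations of Φ, Ψ, Υ over B_r is at most C₀ r^{1/3 − 1/s} for all r > 1. Then sup_{ρ ≥ 1/2} ρ^{−1} ∫_{B_{2ρ}∖B_ρ} (|u|³ + |b|³ + |w|³) dx < ∞, and consequently ρ^{−2} ∫_{B_{2ρ}∖B_ρ} (|u|² + |b|² + |w|²) dx → 0 as ρ → ∞. -/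

import Mathlib

open MeasureTheory Real Filter Metric
open scoped Topology ENNReal

noncomputable section

/-- Three-dimensional Euclidean space. -/
abbrev E3 := EuclideanSpace ℝ (Fin 3)

/-- Partial derivative in the `i`-th coordinate direction. -/
def pd (i : Fin 3) (f : E3 → ℝ) (x : E3) : ℝ := fderiv ℝ f x (EuclideanSpace.single i 1)

/-- Laplacian of a scalar function. -/
def lap (f : E3 → ℝ) (x : E3) : ℝ := ∑ i, pd i (fun y => pd i f y) x

/-- Divergence of a vector field. -/
def vdiv (v : E3 → E3) (x : E3) : ℝ := ∑ i, pd i (fun y => v y i) x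

/-- Curl of a vector field on ℝ³. -/
def curl3 (v : E3 → E3) (x : E3) : Fin 3 → ℝ :=
  ![pd 1 (fun y => v y 2) x - pd 2 (fun y => v y 1) x,
    pd 2 (fun y => v y 0) x - pd 0 (fun y => v y 2) x,
    pd 0 (fun y => v y 1) x - pd 1 (fun y => v y 0) x]

/-- Squared norm of the full gradient of a vector field: |∇v|² = Σᵢⱼ (∂ᵢ vⱼ)². -/
def gradSq (v : E3 → E3) (x : E3) : ℝ := ∑ j, ∑ i, (pd i (fun y => v y j) x) ^ 2

/-- The open ball of radius `r` centered at the origin. -/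
def ball3 (r : ℝ) : Set E3 := Metric.ball (0 : E3) r

/-- `(u, w, b, Π)` is a smooth solution of the stationary magneto-micropolar equations on ℝ³
(with all physical constants set to 1):
−Δu + (u·∇)u + ∇Π = ∇×w + (b·∇)b; −Δw + (u·∇)w = ∇(div w) + ∇×u − 2w;
−Δb + (u·∇)b = (b·∇)u; div u = 0, div b = 0. -/
structure IsMMPSolution (u w b : E3 → E3) (P : E3 → ℝ) : Prop where
  smooth_u : ContDiff ℝ (⊤ : ℕ∞) u
  smooth_w : ContDiff ℝ (⊤ : ℕ∞) w
  smooth_b : ContDiff ℝ (⊤ : ℕ∞) b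
  smooth_P : ContDiff ℝ (⊤ : ℕ∞) P
  eq_u : ∀ x : E3, ∀ j : Fin 3,
    -(lap (fun y => u y j) x) + (∑ i, u x i * pd i (fun y => u y j) x) + pd j P x
      = curl3 w x j + ∑ i, b x i * pd i (fun y => b y j) x
  eq_w : ∀ x : E3, ∀ j : Fin 3,
    -(lap (fun y => w y j) x) + (∑ i, u x i * pd i (fun y => w y j) x)
      = pd j (fun y => vdiv w y) x + curl3 u x j - 2 * w x j
  eq_b : ∀ x : E3, ∀ j : Fin 3,
    -(lap (fun y => b y j) x) + (∑ i, u x i * pd i (fun y => b y j) x)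
      = ∑ i, b x i * pd i (fun y => u y j) x
  div_u : ∀ x : E3, vdiv u x = 0
  div_b : ∀ x : E3, vdiv b x = 0

/-- Divergence of a matrix-valued function: (div Φ)ⱼ = Σᵢ ∂ᵢ Φᵢⱼ. -/
def mdiv (Φ : E3 → Fin 3 → Fin 3 → ℝ) (x : E3) (j : Fin 3) : ℝ :=
  ∑ i, pd i (fun y => Φ y i j) x

/-- Mean value of a matrix-valued function over the ball of radius `r`. -/
def mavg (Φ : E3 → Fin 3 → Fin 3 → ℝ) (r : ℝ) (i j : Fin 3) : ℝ :=
  (volume (ball3 r)).toReal⁻¹ * ∫ x in ball3 r, Φ x i j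

/-- Frobenius norm of a 3×3 matrix. -/
def frob (A : Fin 3 → Fin 3 → ℝ) : ℝ := Real.sqrt (∑ i, ∑ j, (A i j) ^ 2)

/-- The `s`-mean oscillation of `Φ` over the ball of radius `r`:
`(|B_r|⁻¹ ∫_{B_r} |Φ − Φ_{B_r}|^s dx)^(1/s)`. -/
def meanOsc (Φ : E3 → Fin 3 → Fin 3 → ℝ) (s r : ℝ) : ℝ :=
  ((volume (ball3 r)).toReal⁻¹ *
      ∫ x in ball3 r, (frob fun i j => Φ x i j - mavg Φ r i j) ^ s) ^ (1 / s)

/-! ### Parametric integrals -/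

theorem hasFDerivAt_intervalIntegral_param {V : Type} [NormedAddCommGroup V] [NormedSpace ℝ V]
    [CompleteSpace V] {F : E3 → ℝ → V} (hF : ContDiff ℝ 1 (fun p : E3 × ℝ => F p.1 p.2))
    (a b : ℝ) (x : E3) :
    HasFDerivAt (fun y => ∫ t in a..b, F y t)
      (∫ t in a..b, fderiv ℝ (fun y => F y t) x) x := by
  have hd : ∀ y t, HasFDerivAt (fun y => F y t)
      ((fderiv ℝ (fun p : E3 × ℝ => F p.1 p.2) (y, t)).comp
        (ContinuousLinearMap.inl ℝ E3 ℝ)) y := by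
    intro y t
    have h1 : HasFDerivAt (fun p : E3 × ℝ => F p.1 p.2)
        (fderiv ℝ (fun p : E3 × ℝ => F p.1 p.2) (y, t)) (y, t) :=
      (hF.differentiable (by norm_num) _).hasFDerivAt
    exact HasFDerivAt.comp (g := fun p : E3 × ℝ => F p.1 p.2) (f := fun e => (e, t)) y h1
      (hasFDerivAt_prodMk_left y t)
  have hc : Continuous (fun p : E3 × ℝ =>
      (fderiv ℝ (fun p : E3 × ℝ => F p.1 p.2) p).comp (ContinuousLinearMap.inl ℝ E3 ℝ)) :=
    (hF.continuous_fderiv (by norm_num)).clm_comp continuous_const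
  have hK : IsCompact (closedBall x 1 ×ˢ Set.uIcc a b) :=
    (isCompact_closedBall x 1).prod isCompact_uIcc
  obtain ⟨C, hC⟩ := hK.exists_bound_of_continuousOn hc.continuousOn
  have hcont : ∀ y, Continuous (fun t => F y t) := fun y =>
    hF.continuous.comp (Continuous.prodMk continuous_const continuous_id)
  have := intervalIntegral.hasFDerivAt_integral_of_dominated_of_fderiv_le (𝕜 := ℝ) (μ := volume)
    (a := a) (b := b) (F := F) (x₀ := x) (s := closedBall x 1) (bound := fun _ => C)
    (F' := fun y t => (fderiv ℝ (fun p : E3 × ℝ => F p.1 p.2) (y, t)).comp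
        (ContinuousLinearMap.inl ℝ E3 ℝ)) (closedBall_mem_nhds x one_pos)
    (Eventually.of_forall fun y => (hcont y).aestronglyMeasurable)
    ((hcont x).intervalIntegrable _ _)
    (hc.comp (Continuous.prodMk continuous_const continuous_id)).aestronglyMeasurable
    (Eventually.of_forall fun t ht y hy => hC (y, t) ⟨hy, Set.uIoc_subset_uIcc ht⟩)
    intervalIntegrable_const (Eventually.of_forall fun t _ y _ => hd y t)
  simpa only [(hd _ _).fderiv] using this

theorem contDiff_intervalIntegral_param_nat (n : ℕ) (a b : ℝ) :
    ∀ {V : Type} [NormedAddCommGroup V] [NormedSpace ℝ V] [CompleteSpace V] {F : E3 → ℝ → V},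
      ContDiff ℝ (⊤ : ℕ∞) (fun p : E3 × ℝ => F p.1 p.2) →
      ContDiff ℝ n (fun y => ∫ t in a..b, F y t) := by
  induction n with
  | zero =>
    intro V _ _ _ F hF
    rw [Nat.cast_zero, contDiff_zero]
    exact intervalIntegral.continuous_parametric_intervalIntegral_of_continuous' hF.continuous a b
  | succ n ih =>
    intro V _ _ _ F hF
    have hF1 : ContDiff ℝ 1 (fun p : E3 × ℝ => F p.1 p.2) := hF.of_le (by exact_mod_cast le_top)
    rw [Nat.cast_add, Nat.cast_one, contDiff_succ_iff_hasFDerivAt]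
    refine ⟨fun x => ∫ t in a..b, fderiv ℝ (fun y => F y t) x, ?_,
      fun x => hasFDerivAt_intervalIntegral_param hF1 a b x⟩
    apply ih
    have h := hF.fderiv_right (m := (⊤ : ℕ∞)) (by simp)
    have h2 : (fun p : E3 × ℝ => fderiv ℝ (fun y => F y p.2) p.1) = fun p =>
        (fderiv ℝ (fun p : E3 × ℝ => F p.1 p.2) p).comp (ContinuousLinearMap.inl ℝ E3 ℝ) := by
      funext p
      have h1 : HasFDerivAt (fun p : E3 × ℝ => F p.1 p.2)
        (fderiv ℝ (fun p : E3 × ℝ => F p.1 p.2) (p.1, p.2)) (p.1, p.2) :=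
        (hF1.differentiable (by norm_num) _).hasFDerivAt
      exact (HasFDerivAt.comp (g := fun p : E3 × ℝ => F p.1 p.2) (f := fun e => (e, p.2)) p.1 h1
        (hasFDerivAt_prodMk_left p.1 p.2)).fderiv
    rw [h2]
    exact h.clm_comp contDiff_const

theorem contDiff_intervalIntegral_param {F : E3 → ℝ → ℝ}
    (hF : ContDiff ℝ (⊤ : ℕ∞) (fun p : E3 × ℝ => F p.1 p.2)) (a b : ℝ) :
    ContDiff ℝ (⊤ : ℕ∞) (fun y => ∫ t in a..b, F y t) :=
  contDiff_infty.2 fun n => contDiff_intervalIntegral_param_nat n a b hF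

/-! ### Partial derivatives -/

/-- Smooth scalar functions. -/
abbrev Sm (f : E3 → ℝ) : Prop := ContDiff ℝ (⊤ : ℕ∞) f

/-- Coordinate unit vectors. -/
abbrev bv (i : Fin 3) : E3 := EuclideanSpace.single i (1 : ℝ)

theorem Sm.diff {f : E3 → ℝ} (hf : Sm f) : Differentiable ℝ f := hf.differentiable (by simp)

theorem Sm.one {f : E3 → ℝ} (hf : Sm f) : ContDiff ℝ 1 f := hf.of_le (by exact_mod_cast le_top)

theorem Sm.pd {f : E3 → ℝ} (hf : Sm f) (i : Fin 3) : Sm (pd i f) :=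
  (hf.fderiv_right (m := (⊤ : ℕ∞)) (by simp)).clm_apply contDiff_const

theorem continuous_pd {f : E3 → ℝ} (hf : ContDiff ℝ 1 f) (i : Fin 3) : Continuous (pd i f) :=
  (hf.continuous_fderiv (by norm_num)).clm_apply continuous_const

theorem pd_add {f g : E3 → ℝ} {x : E3} (hf : DifferentiableAt ℝ f x)
    (hg : DifferentiableAt ℝ g x) (i : Fin 3) :
    pd i (fun y => f y + g y) x = pd i f x + pd i g x := by
  have := (hf.hasFDerivAt.add hg.hasFDerivAt).fderiv
  simp only [pd]
  erw [this]; rfl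

theorem pd_sub {f g : E3 → ℝ} {x : E3} (hf : DifferentiableAt ℝ f x)
    (hg : DifferentiableAt ℝ g x) (i : Fin 3) :
    pd i (fun y => f y - g y) x = pd i f x - pd i g x := by
  have := (hf.hasFDerivAt.sub hg.hasFDerivAt).fderiv
  simp only [pd]
  erw [this]; rfl

theorem pd_mul {f g : E3 → ℝ} {x : E3} (hf : DifferentiableAt ℝ f x)
    (hg : DifferentiableAt ℝ g x) (i : Fin 3) :
    pd i (fun y => f y * g y) x = pd i f x * g x + f x * pd i g x := by
  have := (hf.hasFDerivAt.mul hg.hasFDerivAt).fderiv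
  simp only [pd]
  erw [this]; simp; ring

theorem pd_const (c : ℝ) (x : E3) (i : Fin 3) : pd i (fun _ => c) x = 0 := by
  simp [pd]

theorem pd_const_mul {f : E3 → ℝ} {x : E3} (c : ℝ) (hf : DifferentiableAt ℝ f x) (i : Fin 3) :
    pd i (fun y => c * f y) x = c * pd i f x := by
  rw [pd_mul (by fun_prop) hf, pd_const]; ring

theorem pd_sum {ι : Type*} {f : ι → E3 → ℝ} {x : E3} {s : Finset ι}
    (hf : ∀ k ∈ s, DifferentiableAt ℝ (f k) x) (i : Fin 3) :
    pd i (fun y => ∑ k ∈ s, f k y) x = ∑ k ∈ s, pd i (f k) x := by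
  simp only [pd]
  rw [fderiv_fun_sum hf]
  simp

theorem pd_comm {f : E3 → ℝ} (hf : Sm f) (i j : Fin 3) (x : E3) :
    pd i (pd j f) x = pd j (pd i f) x := by
  have hs : IsSymmSndFDerivAt ℝ f x :=
    (hf.contDiffAt (x := x)).isSymmSndFDerivAt (by
      rw [minSmoothness_of_isRCLikeNormedField]; exact WithTop.coe_le_coe.2 (le_top : (2 : ℕ∞) ≤ ⊤))
  have hd : DifferentiableAt ℝ (fderiv ℝ f) x :=
    (hf.fderiv_right (m := (⊤ : ℕ∞)) (by simp)).differentiable (by simp) x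
  have key : ∀ i j : Fin 3, pd i (pd j f) x = fderiv ℝ (fderiv ℝ f) x (bv i) (bv j) := by
    intro i j
    unfold pd
    rw [fderiv_clm_apply hd (by fun_prop)]
    simp
  rw [key, key]
  exact hs.eq _ _

theorem hasDerivAt_line {f : E3 → ℝ} (hf : Differentiable ℝ f) (i : Fin 3) (x : E3) (t : ℝ) :
    HasDerivAt (fun t : ℝ => f (x + t • bv i)) (pd i f (x + t • bv i)) t := by
  have h1 : HasDerivAt (fun t : ℝ => x + t • bv i) (bv i) t := by
    simpa using ((hasDerivAt_id t).smul_const (bv i)).const_add x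
  exact (hf _).hasFDerivAt.comp_hasDerivAt t h1

theorem pd_eq_of_hasDerivAt {f : E3 → ℝ} (hf : Differentiable ℝ f) {i : Fin 3} {x : E3} {a : ℝ}
    (h : HasDerivAt (fun t : ℝ => f (x + t • bv i)) a 0) : pd i f x = a := by
  have := hasDerivAt_line hf i x 0
  simpa using this.unique h

theorem pd_comp {τ τ' : ℝ → ℝ} (hτ : ∀ y, HasDerivAt τ (τ' y) y) {f : E3 → ℝ} {x : E3}
    (hf : DifferentiableAt ℝ f x) (i : Fin 3) :
    pd i (fun y => τ (f y)) x = τ' (f x) * pd i f x := by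
  have := ((hτ (f x)).comp_hasFDerivAt x hf.hasFDerivAt).fderiv
  simp only [pd]
  erw [this]; simp

theorem pd_coord (i j : Fin 3) (x : E3) : pd i (fun y => y j) x = if j = i then 1 else 0 := by
  have : HasFDerivAt (fun y : E3 => y j) (EuclideanSpace.proj j : E3 →L[ℝ] ℝ) x :=
    (EuclideanSpace.proj j : E3 →L[ℝ] ℝ).hasFDerivAt
  unfold pd
  rw [this.fderiv]
  simp

theorem sm_coord (j : Fin 3) : Sm (fun y => y j) :=
  (EuclideanSpace.proj j : E3 →L[ℝ] ℝ).contDiff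

/-! ### Cubes and supports -/

/-- The closed cube of half side `R` centred at the origin. -/
def cube (R : ℝ) : Set E3 := {x | ∀ i, |x i| ≤ R}

theorem isClosed_cube (R : ℝ) : IsClosed (cube R) := by
  have : cube R = ⋂ i : Fin 3, {x : E3 | |x i| ≤ R} := by ext; simp [cube]
  rw [this]
  exact isClosed_iInter fun i => isClosed_le (by fun_prop) continuous_const

theorem measurableSet_cube (R : ℝ) : MeasurableSet (cube R) := (isClosed_cube R).measurableSet

theorem cube_mono {r R : ℝ} (h : r ≤ R) : cube r ⊆ cube R := fun _ hx i => (hx i).trans h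

theorem cube_subset_ball {R r : ℝ} (hR : 0 ≤ R) (hr : 2 * R < r) : cube R ⊆ ball3 r := by
  intro x hx
  rw [ball3, mem_ball_zero_iff, EuclideanSpace.norm_eq]
  refine lt_of_le_of_lt (b := 2 * R) ?_ hr
  rw [Real.sqrt_le_left (by linarith)]
  simp only [Fin.sum_univ_three, Real.norm_eq_abs, sq_abs]
  have h : ∀ i, x i ^ 2 ≤ R ^ 2 := fun i => sq_le_sq' (abs_le.1 (hx i)).1 (abs_le.1 (hx i)).2
  nlinarith [h 0, h 1, h 2, sq_nonneg R]

theorem ball_subset_cube (R : ℝ) : ball3 R ⊆ cube R := by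
  intro x hx i
  rw [ball3, mem_ball_zero_iff] at hx
  exact (PiLp.norm_apply_le x i).trans hx.le

theorem isCompact_cube (R : ℝ) : IsCompact (cube R) := by
  refine Metric.isCompact_of_isClosed_isBounded (isClosed_cube R) ?_
  refine (Metric.isBounded_ball (x := (0 : E3)) (r := 2 * |R| + 1)).subset ?_
  exact (cube_mono (le_abs_self R)).trans (cube_subset_ball (abs_nonneg R) (by linarith))

theorem integrableOn_cube {f : E3 → ℝ} (hf : Continuous f) (R : ℝ) :
    IntegrableOn f (cube R) := hf.continuousOn.integrableOn_compact (isCompact_cube R)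

/-- `f` vanishes outside the cube of half side `R`. -/
def Supp (R : ℝ) (f : E3 → ℝ) : Prop := ∀ x, x ∉ cube R → f x = 0

theorem Supp.mono {r R : ℝ} (h : r ≤ R) {f : E3 → ℝ} (hf : Supp r f) : Supp R f :=
  fun x hx => hf x fun hx' => hx (cube_mono h hx')

theorem Supp.compact {R : ℝ} {f : E3 → ℝ} (hf : Supp R f) : HasCompactSupport f :=
  HasCompactSupport.intro (isCompact_cube R) fun {x} hx => hf x hx

theorem Supp.pd {R : ℝ} {f : E3 → ℝ} (hf : Supp R f) (i : Fin 3) : Supp R (pd i f) := by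
  intro x hx
  have h : f =ᶠ[𝓝 x] fun _ => (0 : ℝ) := by
    filter_upwards [(isClosed_cube R).isOpen_compl.mem_nhds hx] with y hy using hf y hy
  unfold _root_.pd
  rw [h.fderiv_eq]
  simp

theorem Supp.mul_left {R : ℝ} {f : E3 → ℝ} (hf : Supp R f) (g : E3 → ℝ) :
    Supp R (fun x => f x * g x) := fun x hx => by simp [hf x hx]

theorem Supp.mul_right {R : ℝ} {f : E3 → ℝ} (hf : Supp R f) (g : E3 → ℝ) :
    Supp R (fun x => g x * f x) := fun x hx => by simp [hf x hx]

theorem Supp.add {R : ℝ} {f g : E3 → ℝ} (hf : Supp R f) (hg : Supp R g) :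
    Supp R (fun x => f x + g x) := fun x hx => by simp [hf x hx, hg x hx]

theorem Supp.sub {R : ℝ} {f g : E3 → ℝ} (hf : Supp R f) (hg : Supp R g) :
    Supp R (fun x => f x - g x) := fun x hx => by simp [hf x hx, hg x hx]

theorem Supp.sum {ι : Type*} {s : Finset ι} {R : ℝ} {f : ι → E3 → ℝ}
    (hf : ∀ k ∈ s, Supp R (f k)) : Supp R (fun x => ∑ k ∈ s, f k x) :=
  fun x hx => Finset.sum_eq_zero fun k hk => hf k hk x hx

theorem Supp.integral_eq {R : ℝ} {f : E3 → ℝ} (hf : Supp R f) :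
    ∫ x in cube R, f x = ∫ x, f x :=
  setIntegral_eq_integral_of_forall_compl_eq_zero fun x hx => hf x hx

theorem Supp.integrable {R : ℝ} {f : E3 → ℝ} (hf : Supp R f) (hc : Continuous f) :
    Integrable f := hc.integrable_of_hasCompactSupport hf.compact

theorem integral_pd_eq_zero {R : ℝ} {f : E3 → ℝ} (hf : ContDiff ℝ 1 f) (hs : Supp R f)
    (i : Fin 3) : ∫ x, pd i f x = 0 := by
  have h := integral_mul_fderiv_eq_neg_fderiv_mul_of_integrable (μ := (volume : Measure E3))
    (𝕜 := ℝ) (f := fun _ : E3 => (1 : ℝ)) (g := f) (v := bv i) (by simp)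
    (by simpa using! (hs.pd i).integrable (continuous_pd hf i))
    (by simpa using hs.integrable hf.continuous) (fun x _ => by fun_prop)
    (fun x _ => hf.differentiable (by norm_num) x)
  simpa [pd] using h

/-! ### Averages along segments -/

theorem rpow_intervalIntegral_le {a b p : ℝ} (hab : a < b) (hp : 1 ≤ p) {g : ℝ → ℝ}
    (hg : Continuous g) (h0 : ∀ t, 0 ≤ g t) :
    (∫ t in a..b, g t) ^ p ≤ (b - a) ^ (p - 1) * ∫ t in a..b, g t ^ p := by
  have hp0 : 0 ≤ p := by linarith
  have hba : 0 < b - a := by linarith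
  have hgp : Continuous fun t => g t ^ p := hg.rpow_const fun _ => Or.inr hp0
  have : NeZero (volume.restrict (Set.Ioc a b)) :=
    ⟨by simp [Measure.restrict_eq_zero, hab]⟩
  have h := (convexOn_rpow hp).map_average_le (μ := volume.restrict (Set.Ioc a b)) (f := g)
    (continuousOn_id.rpow_const fun _ _ => Or.inr hp0) isClosed_Ici
    (Eventually.of_forall h0) (hg.integrableOn_Ioc) (hgp.integrableOn_Ioc)
  rw [setAverage_eq, setAverage_eq, ← intervalIntegral.integral_of_le hab.le,
    ← intervalIntegral.integral_of_le hab.le] at h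
  have hv : volume.real (Set.Ioc a b) = b - a := by simp [hab.le]
  rw [hv, smul_eq_mul, smul_eq_mul] at h
  have hI : 0 ≤ ∫ t in a..b, g t := intervalIntegral.integral_nonneg hab.le fun t _ => h0 t
  rw [Real.mul_rpow (by positivity) hI, Real.inv_rpow hba.le] at h
  rw [Real.rpow_sub_one hba.ne']
  have h3 : 0 < (b - a) ^ p := by positivity
  rw [inv_mul_le_iff₀ h3] at h
  calc _ ≤ _ := h
    _ = _ := by ring

theorem integral_rpow_le_of_segment {R a b p c : ℝ} (hab : a < b) (hp : 1 ≤ p) (hc : 0 ≤ c)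
    {f K : E3 → ℝ} (hf : Continuous f) (hK : Continuous K) (hs : Supp R f) (v : E3)
    (h : ∀ x, |K x| ≤ c * ∫ t in a..b, |f (x + t • v)|) :
    ∫ x, |K x| ^ p ≤ (c * (b - a)) ^ p * ∫ x, |f x| ^ p := by
  have hp0 : 0 < p := by linarith
  have hba : 0 < b - a := by linarith
  have hfp : Continuous fun x => |f x| ^ p := hf.abs.rpow_const fun _ => Or.inr hp0.le
  have hKp : Continuous fun x => |K x| ^ p := hK.abs.rpow_const fun _ => Or.inr hp0.le
  have hsp : Supp R fun x => |f x| ^ p := fun x hx => by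
    simp [hs x hx, Real.zero_rpow hp0.ne']
  have hline : ∀ x, Continuous fun t : ℝ => |f (x + t • v)| := fun x =>
    (hf.comp (by fun_prop)).abs
  have h1 : ∀ x, |K x| ^ p ≤ (c ^ p * (b - a) ^ (p - 1)) * ∫ t in a..b, |f (x + t • v)| ^ p := by
    intro x
    have hI : 0 ≤ ∫ t in a..b, |f (x + t • v)| :=
      intervalIntegral.integral_nonneg hab.le fun t _ => abs_nonneg _
    calc |K x| ^ p ≤ (c * ∫ t in a..b, |f (x + t • v)|) ^ p :=
          Real.rpow_le_rpow (abs_nonneg _) (h x) hp0.le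
      _ = c ^ p * (∫ t in a..b, |f (x + t • v)|) ^ p := Real.mul_rpow hc hI
      _ ≤ c ^ p * ((b - a) ^ (p - 1) * ∫ t in a..b, |f (x + t • v)| ^ p) := by
          gcongr; exact rpow_intervalIntegral_le hab hp (hline x) fun _ => abs_nonneg _
      _ = _ := by ring
  set M : ℝ := c ^ p * (b - a) ^ (p - 1) with hM
  have hM0 : 0 ≤ M := by positivity
  have hfin : Integrable fun x => |f x| ^ p := hsp.integrable hfp
  have h2 : ∫⁻ x, ENNReal.ofReal (|K x| ^ p)
      ≤ ENNReal.ofReal (M * (b - a)) * ∫⁻ x, ENNReal.ofReal (|f x| ^ p) := by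
    calc ∫⁻ x, ENNReal.ofReal (|K x| ^ p)
        ≤ ∫⁻ x, ENNReal.ofReal M *
            ∫⁻ t in Set.Ioc a b, ENNReal.ofReal (|f (x + t • v)| ^ p) := by
          refine lintegral_mono fun x => ?_
          rw [← ofReal_integral_eq_lintegral_ofReal
            (((hline x).rpow_const fun _ => Or.inr hp0.le).integrableOn_Ioc)
            (Eventually.of_forall fun t => by positivity), ← ENNReal.ofReal_mul hM0,
            ← intervalIntegral.integral_of_le hab.le]
          exact ENNReal.ofReal_le_ofReal (h1 x)
      _ = ENNReal.ofReal M * ∫⁻ t in Set.Ioc a b, ∫⁻ x, ENNReal.ofReal (|f (x + t • v)| ^ p) := by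
          have hm : Measurable fun q : E3 × ℝ => ENNReal.ofReal (|f (q.1 + q.2 • v)| ^ p) :=
            ((hfp.comp (g := fun x => |f x| ^ p) (f := fun q : E3 × ℝ => q.1 + q.2 • v)
              (by fun_prop)).measurable).ennreal_ofReal
          rw [lintegral_const_mul' _ _ ENNReal.ofReal_ne_top, lintegral_lintegral_swap]
          exact hm.aemeasurable
      _ = ENNReal.ofReal M * ∫⁻ t in Set.Ioc a b, ∫⁻ x, ENNReal.ofReal (|f x| ^ p) := by
          congr 2; funext t
          exact lintegral_add_right_eq_self (fun x => ENNReal.ofReal (|f x| ^ p)) (t • v)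
      _ = _ := by
          rw [lintegral_const, Measure.restrict_apply_univ, Real.volume_Ioc,
            ENNReal.ofReal_mul hM0]
          ring
  rw [integral_eq_lintegral_of_nonneg_ae (Eventually.of_forall fun x => by positivity)
      hKp.aestronglyMeasurable,
    integral_eq_lintegral_of_nonneg_ae (Eventually.of_forall fun x => by positivity)
      hfp.aestronglyMeasurable]
  have h3 : (c * (b - a)) ^ p = M * (b - a) := by
    rw [Real.mul_rpow hc hba.le, hM, Real.rpow_sub_one hba.ne']
    field_simp
  rw [h3, ← ENNReal.toReal_ofReal (r := M * (b - a)) (by positivity), ← ENNReal.toReal_mul]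
  refine ENNReal.toReal_mono (ENNReal.mul_ne_top ENNReal.ofReal_ne_top ?_) h2
  have := hfin.lintegral_lt_top
  exact this.ne

/-! ### Weighted averages in a coordinate direction -/

theorem pd_intervalIntegral_param {F : E3 → ℝ → ℝ}
    (hF : ContDiff ℝ (⊤ : ℕ∞) (fun p : E3 × ℝ => F p.1 p.2)) (a b : ℝ) (i : Fin 3) (x : E3) :
    pd i (fun y => ∫ t in a..b, F y t) x = ∫ t in a..b, pd i (fun y => F y t) x := by
  have hF1 : ContDiff ℝ 1 (fun p : E3 × ℝ => F p.1 p.2) := hF.of_le (by exact_mod_cast le_top)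
  have hd : ∀ t, fderiv ℝ (fun y => F y t) x =
      (fderiv ℝ (fun p : E3 × ℝ => F p.1 p.2) (x, t)).comp (ContinuousLinearMap.inl ℝ E3 ℝ) := by
    intro t
    have h1 : HasFDerivAt (fun p : E3 × ℝ => F p.1 p.2)
        (fderiv ℝ (fun p : E3 × ℝ => F p.1 p.2) (x, t)) (x, t) :=
      (hF1.differentiable (by norm_num) _).hasFDerivAt
    exact (HasFDerivAt.comp (g := fun p : E3 × ℝ => F p.1 p.2) (f := fun e => (e, t)) x h1
      (hasFDerivAt_prodMk_left x t)).fderiv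
  have hc : Continuous fun t => fderiv ℝ (fun y => F y t) x := by
    simp only [hd]
    exact ((hF1.continuous_fderiv (by norm_num)).comp
      (Continuous.prodMk continuous_const continuous_id)).clm_comp continuous_const
  unfold pd
  rw [(hasFDerivAt_intervalIntegral_param hF1 a b x).fderiv]
  exact ContinuousLinearMap.intervalIntegral_apply (hc.intervalIntegrable _ _) _

/-- Weighted average of `f` over the segment from `x` to `x + δ eᵢ`. -/
def segAvg (ω : ℝ → ℝ) (δ : ℝ) (i : Fin 3) (f : E3 → ℝ) (x : E3) : ℝ :=
  ∫ t in (0 : ℝ)..1, ω t * f (x + t • (δ • bv i))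

section
variable {ω : ℝ → ℝ} {δ : ℝ} {f : E3 → ℝ}

theorem contDiff_segAvg_integrand (hω : ContDiff ℝ (⊤ : ℕ∞) ω) (hf : Sm f) (v : E3) :
    ContDiff ℝ (⊤ : ℕ∞) (fun p : E3 × ℝ => ω p.2 * f (p.1 + p.2 • v)) :=
  (hω.comp contDiff_snd).mul
    (hf.comp (contDiff_fst.add (contDiff_snd.smul contDiff_const)))

theorem segAvg_sm (hω : ContDiff ℝ (⊤ : ℕ∞) ω) (hf : Sm f) (i : Fin 3) : Sm (segAvg ω δ i f) :=
  contDiff_intervalIntegral_param (contDiff_segAvg_integrand hω hf _) 0 1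

theorem pd_translate {f : E3 → ℝ} (k : Fin 3) (v x : E3) :
    pd k (fun y => f (y + v)) x = pd k f (x + v) := by
  unfold pd
  rw [fderiv_comp_add_right]

theorem pd_segAvg (hω : ContDiff ℝ (⊤ : ℕ∞) ω) (hf : Sm f) (i k : Fin 3) :
    pd k (segAvg ω δ i f) = segAvg ω δ i (pd k f) := by
  funext x
  unfold segAvg
  rw [pd_intervalIntegral_param (contDiff_segAvg_integrand hω hf _)]
  congr 1; funext t
  have hd : DifferentiableAt ℝ (fun y => f (y + t • (δ • bv i))) x :=
    (hf.diff _).comp x (by fun_prop)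
  rw [pd_const_mul _ hd, pd_translate]

theorem Supp.segAvg {R : ℝ} (hδ : 0 ≤ δ) (hf : Supp R f) (i : Fin 3) :
    Supp (R + δ) (segAvg ω δ i f) := by
  intro x hx
  unfold _root_.segAvg
  rw [intervalIntegral.integral_congr (g := fun _ => (0 : ℝ))]
  · simp
  intro t ht
  rw [Set.uIcc_of_le zero_le_one] at ht
  have : f (x + t • (δ • bv i)) = 0 := by
    refine hf _ fun hmem => hx fun k => ?_
    have h1 := hmem k
    have h2 : (x + t • (δ • bv i)) k = x k + t * (δ * if k = i then 1 else 0) := by simp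
    rw [h2] at h1
    have h3 : |t * (δ * if k = i then 1 else 0)| ≤ δ := by
      split_ifs
      · rw [mul_one, abs_of_nonneg (mul_nonneg ht.1 hδ)]
        nlinarith [ht.2]
      · simpa using hδ
    have h4 := abs_sub_abs_le_abs_sub (x k) (-(t * (δ * if k = i then 1 else 0)))
    rw [sub_neg_eq_add, abs_neg] at h4
    linarith
  simp [this]

theorem abs_segAvg_le {W : ℝ} (hω : ContDiff ℝ (⊤ : ℕ∞) ω) (hf : Continuous f)
    (hW : ∀ t ∈ Set.Icc (0 : ℝ) 1, |ω t| ≤ W) (i : Fin 3) (x : E3) :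
    |segAvg ω δ i f x| ≤ W * ∫ t in (0 : ℝ)..1, |f (x + t • (δ • bv i))| := by
  have hc : Continuous fun t : ℝ => f (x + t • (δ • bv i)) := hf.comp (by fun_prop)
  unfold segAvg
  refine (intervalIntegral.abs_integral_le_integral_abs zero_le_one).trans ?_
  rw [← intervalIntegral.integral_const_mul]
  refine intervalIntegral.integral_mono_on zero_le_one
    ((hω.continuous.mul hc).abs.intervalIntegrable _ _)
    ((continuous_const.mul hc.abs).intervalIntegrable _ _) fun t ht => ?_
  rw [abs_mul]
  exact mul_le_mul_of_nonneg_right (hW t ht) (abs_nonneg _)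

theorem integral_segAvg_rpow_le {R W p : ℝ} (hω : ContDiff ℝ (⊤ : ℕ∞) ω) (hf : Sm f)
    (hs : Supp R f) (hp : 1 ≤ p) (hW : ∀ t ∈ Set.Icc (0 : ℝ) 1, |ω t| ≤ W) (i : Fin 3) :
    ∫ x, |segAvg ω δ i f x| ^ p ≤ W ^ p * ∫ x, |f x| ^ p := by
  have := integral_rpow_le_of_segment zero_lt_one hp
    ((abs_nonneg _).trans (hW 0 (by simp))) hf.continuous (segAvg_sm hω hf i).continuous hs
    (δ • bv i) (fun x => abs_segAvg_le hω hf.continuous hW i x)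
  simpa using this

theorem integral_segAvg_sq_le {R W : ℝ} (hω : ContDiff ℝ (⊤ : ℕ∞) ω) (hf : Sm f)
    (hs : Supp R f) (hW : ∀ t ∈ Set.Icc (0 : ℝ) 1, |ω t| ≤ W) (i : Fin 3) :
    ∫ x, segAvg ω δ i f x ^ 2 ≤ W ^ 2 * ∫ x, f x ^ 2 := by
  have := integral_segAvg_rpow_le (δ := δ) hω hf hs (p := 2) (by norm_num) hW i
  simpa only [Real.rpow_two, sq_abs] using this

theorem hasDerivAt_segment (hf : Sm f) (δ : ℝ) (i : Fin 3) (x : E3) (t : ℝ) :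
    HasDerivAt (fun t : ℝ => f (x + t • (δ • bv i))) (δ * pd i f (x + t • (δ • bv i))) t := by
  have h1 : HasDerivAt (fun t : ℝ => x + t • (δ • bv i)) (δ • bv i) t := by
    simpa using ((hasDerivAt_id t).smul_const (δ • bv i)).const_add x
  have h2 := (hf.diff _).hasFDerivAt.comp_hasDerivAt t h1
  rw [map_smul, smul_eq_mul] at h2
  exact h2

theorem pd_segAvg_one (hδ : δ ≠ 0) (hf : Sm f) (i : Fin 3) (x : E3) :
    pd i (segAvg (fun _ => 1) δ i f) x = δ⁻¹ * (f (x + δ • bv i) - f x) := by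
  rw [pd_segAvg contDiff_const hf]
  have hc : Continuous fun t : ℝ => pd i f (x + t • (δ • bv i)) :=
    (hf.pd i).continuous.comp (by fun_prop)
  have h := intervalIntegral.integral_eq_sub_of_hasDerivAt (a := 0) (b := 1)
    (fun t _ => hasDerivAt_segment hf δ i x t) ((continuous_const.mul hc).intervalIntegrable _ _)
  rw [intervalIntegral.integral_const_mul] at h
  simp only [one_smul, zero_smul, add_zero] at h
  rw [← h]
  simp [segAvg, hδ]

theorem pd_segAvg_weight (hf : Sm f) (i : Fin 3) (x : E3) :
    pd i (segAvg (fun t => -δ * (1 - t)) δ i f) x = f x - segAvg (fun _ => 1) δ i f x := by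
  rw [pd_segAvg (by fun_prop) hf]
  have hc : Continuous fun t : ℝ => pd i f (x + t • (δ • bv i)) :=
    (hf.pd i).continuous.comp (by fun_prop)
  have hc0 : Continuous fun t : ℝ => f (x + t • (δ • bv i)) :=
    hf.continuous.comp (by fun_prop)
  have hd : ∀ t : ℝ, HasDerivAt (fun t : ℝ => (t - 1) * f (x + t • (δ • bv i)))
      (1 * f (x + t • (δ • bv i)) + (t - 1) * (δ * pd i f (x + t • (δ • bv i)))) t :=
    fun t => ((hasDerivAt_id t).sub_const 1).mul (hasDerivAt_segment hf δ i x t)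
  have h := intervalIntegral.integral_eq_sub_of_hasDerivAt (a := 0) (b := 1)
    (fun t _ => hd t) (Continuous.intervalIntegrable (by fun_prop) _ _)
  rw [intervalIntegral.integral_add (Continuous.intervalIntegrable (by fun_prop) _ _)
    (Continuous.intervalIntegrable (by fun_prop) _ _)] at h
  simp only [sub_self, zero_mul, zero_smul, add_zero, zero_sub] at h
  have h2 : segAvg (fun t => -δ * (1 - t)) δ i (pd i f) x
      = ∫ t in (0 : ℝ)..1, (t - 1) * (δ * pd i f (x + t • (δ • bv i))) := by
    unfold segAvg; congr 1; funext t; ring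
  rw [h2]
  unfold segAvg
  linarith

theorem integral_pd_segAvg_one_sq_le {R : ℝ} (hδ : δ ≠ 0) (hf : Sm f) (hs : Supp R f)
    (i : Fin 3) : ∫ x, pd i (segAvg (fun _ => 1) δ i f) x ^ 2 ≤ 4 * (δ⁻¹) ^ 2 * ∫ x, f x ^ 2 := by
  have hi : Integrable fun x => f x ^ 2 := by
    simpa only [sq] using (hs.mul_left f).integrable (hf.continuous.mul hf.continuous)
  have hi2 : Integrable fun x => f (x + δ • bv i) ^ 2 := hi.comp_add_right (δ • bv i)
  calc ∫ x, pd i (segAvg (fun _ => 1) δ i f) x ^ 2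
      ≤ ∫ x, (2 * (δ⁻¹) ^ 2 * f (x + δ • bv i) ^ 2 + 2 * (δ⁻¹) ^ 2 * f x ^ 2) := by
        refine integral_mono_of_nonneg (Eventually.of_forall fun x => sq_nonneg _)
          ((hi2.const_mul _).add (hi.const_mul _)) (Eventually.of_forall fun x => ?_)
        simp only [pd_segAvg_one hδ hf]
        nlinarith [sq_nonneg (δ⁻¹ * (f (x + δ • bv i) + f x))]
    _ = _ := by
        rw [integral_add (hi2.const_mul _) (hi.const_mul _), integral_const_mul,
          integral_const_mul, integral_add_right_eq_self (fun x => f x ^ 2) (δ • bv i)]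
        ring

end

/-- Splitting of a compactly supported potential into a part regularized at scale `δ` and a
part controlled by the gradient of its divergence. -/
theorem exists_regularized_split {R δ : ℝ} (hδ : 0 < δ) {f : E3 → ℝ} {z : Fin 3 → E3 → ℝ}
    (hf : Sm f) (hfs : Supp R f) (hz : ∀ i, Sm (z i)) (hzs : ∀ i, Supp R (z i))
    (hdiv : ∀ x, ∑ i, pd i (z i) x = f x) :
    ∃ z₁ z₂ : Fin 3 → E3 → ℝ, (∀ i, Sm (z₁ i)) ∧ (∀ i, Sm (z₂ i)) ∧
      (∀ i, Supp (R + 3 * δ) (z₁ i)) ∧ (∀ i, Supp (R + 3 * δ) (z₂ i)) ∧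
      (∀ x, ∑ i, (pd i (z₁ i) x + pd i (z₂ i) x) = f x) ∧
      (∀ i, ∀ p : ℝ, 1 ≤ p → ∫ x, |z₁ i x| ^ p ≤ ∫ x, |z i x| ^ p) ∧
      (∀ i k, ∫ x, pd k (z₁ i) x ^ 2 ≤ 4 * (δ⁻¹) ^ 2 * ∫ x, z i x ^ 2) ∧
      (∀ i k, ∫ x, pd k (z₂ i) x ^ 2 ≤ δ ^ 2 * ∫ x, pd k f x ^ 2) := by
  have hω1 : ContDiff ℝ (⊤ : ℕ∞) (fun _ : ℝ => (1 : ℝ)) := contDiff_const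
  have hω2 : ContDiff ℝ (⊤ : ℕ∞) (fun t : ℝ => -δ * (1 - t)) := by fun_prop
  have hW1 : ∀ t ∈ Set.Icc (0 : ℝ) 1, |(fun _ : ℝ => (1 : ℝ)) t| ≤ 1 := by simp
  have hW2 : ∀ t ∈ Set.Icc (0 : ℝ) 1, |(fun t : ℝ => -δ * (1 - t)) t| ≤ δ := by
    intro t ht
    simp only [abs_mul, abs_neg, abs_of_pos hδ, abs_of_nonneg (sub_nonneg.2 ht.2)]
    nlinarith [ht.1]
  set S : Fin 3 → (E3 → ℝ) → E3 → ℝ := fun i g => segAvg (fun _ => 1) δ i g with hS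
  set H : Fin 3 → (E3 → ℝ) → E3 → ℝ := fun i g => segAvg (fun t => -δ * (1 - t)) δ i g with hH
  have Ssm : ∀ i g, Sm g → Sm (S i g) := fun i g hg => segAvg_sm hω1 hg i
  have Hsm : ∀ i g, Sm g → Sm (H i g) := fun i g hg => segAvg_sm hω2 hg i
  have Spd : ∀ i k g, Sm g → pd k (S i g) = S i (pd k g) := fun i k g hg => pd_segAvg hω1 hg i k
  have Hpd : ∀ i k g, Sm g → pd k (H i g) = H i (pd k g) := fun i k g hg => pd_segAvg hω2 hg i k
  have Ssu : ∀ i g r, Supp r g → Supp (r + δ) (S i g) := fun i g r hg => hg.segAvg hδ.le i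
  have Hsu : ∀ i g r, Supp r g → Supp (r + δ) (H i g) := fun i g r hg => hg.segAvg hδ.le i
  have Hdiv : ∀ i g, Sm g → ∀ x, pd i (H i g) x = g x - S i g x :=
    fun i g hg x => pd_segAvg_weight hg i x
  have Sp : ∀ i g r (p : ℝ), Sm g → Supp r g → 1 ≤ p → ∫ x, |S i g x| ^ p ≤ ∫ x, |g x| ^ p :=
    fun i g r p hg hgs hp => by
      simpa using integral_segAvg_rpow_le (δ := δ) hω1 hg hgs hp hW1 i
  have S2 : ∀ i g r, Sm g → Supp r g → ∫ x, S i g x ^ 2 ≤ ∫ x, g x ^ 2 :=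
    fun i g r hg hgs => by simpa using integral_segAvg_sq_le (δ := δ) hω1 hg hgs hW1 i
  have H2 : ∀ i g r, Sm g → Supp r g → ∫ x, H i g x ^ 2 ≤ δ ^ 2 * ∫ x, g x ^ 2 :=
    fun i g r hg hgs => integral_segAvg_sq_le (δ := δ) hω2 hg hgs hW2 i
  have SD : ∀ i g r, Sm g → Supp r g →
      ∫ x, pd i (S i g) x ^ 2 ≤ 4 * (δ⁻¹) ^ 2 * ∫ x, g x ^ 2 :=
    fun i g r hg hgs => integral_pd_segAvg_one_sq_le hδ.ne' hg hgs i
  have h4 : (0 : ℝ) ≤ 4 * (δ⁻¹) ^ 2 := by positivity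
  have mono : ∀ r g, r ≤ R + 3 * δ → Supp r g → Supp (R + 3 * δ) g := fun r g h hg => hg.mono h
  refine ⟨fun i => S 0 (S 1 (S 2 (z i))), ![H 0 f, S 0 (H 1 f), S 0 (S 1 (H 2 f))],
    fun i => Ssm _ _ (Ssm _ _ (Ssm _ _ (hz i))), ?_, ?_, ?_, ?_, ?_, ?_, ?_⟩
  · intro i
    fin_cases i
    · exact Hsm _ _ hf
    · exact Ssm _ _ (Hsm _ _ hf)
    · exact Ssm _ _ (Ssm _ _ (Hsm _ _ hf))
  · intro i
    exact mono _ _ (by linarith) (Ssu _ _ _ (Ssu _ _ _ (Ssu _ _ _ (hzs i))))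
  · intro i
    fin_cases i
    · exact mono _ _ (by linarith) (Hsu _ _ _ hfs)
    · exact mono _ _ (by linarith) (Ssu _ _ _ (Hsu _ _ _ hfs))
    · exact mono _ _ (by linarith) (Ssu _ _ _ (Ssu _ _ _ (Hsu _ _ _ hfs)))
  · intro x
    have Slin : ∀ i (g h : E3 → ℝ), Continuous g → Continuous h → ∀ x,
        S i (fun y => g y - h y) x = S i g x - S i h x := by
      intro i g h hg hh x
      have e1 : Continuous fun t : ℝ => g (x + t • (δ • bv i)) := hg.comp (by fun_prop)
      have e2 : Continuous fun t : ℝ => h (x + t • (δ • bv i)) := hh.comp (by fun_prop)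
      simp only [hS, segAvg, one_mul]
      exact intervalIntegral.integral_sub (e1.intervalIntegrable _ _) (e2.intervalIntegrable _ _)
    have a1 : pd 1 (S 0 (H 1 f)) x = S 0 f x - S 0 (S 1 f) x := by
      rw [Spd 0 1 _ (Hsm _ _ hf), show pd 1 (H 1 f) = fun y => f y - S 1 f y from
        funext (Hdiv 1 f hf), Slin 0 _ _ hf.continuous (Ssm 1 f hf).continuous]
    have a2 : pd 2 (S 0 (S 1 (H 2 f))) x = S 0 (S 1 f) x - S 0 (S 1 (S 2 f)) x := by
      rw [Spd 0 2 _ (Ssm _ _ (Hsm _ _ hf)), Spd 1 2 _ (Hsm _ _ hf),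
        show pd 2 (H 2 f) = fun y => f y - S 2 f y from funext (Hdiv 2 f hf),
        show S 1 (fun y => f y - S 2 f y) = fun y => S 1 f y - S 1 (S 2 f) y from
          funext (Slin 1 _ _ hf.continuous (Ssm 2 f hf).continuous),
        Slin 0 _ _ (Ssm 1 f hf).continuous (Ssm _ _ (Ssm 2 f hf)).continuous]
    have a3 : ∑ i, pd i (S 0 (S 1 (S 2 (z i)))) x = S 0 (S 1 (S 2 f)) x := by
      have e : ∀ i, pd i (S 0 (S 1 (S 2 (z i)))) = S 0 (S 1 (S 2 (pd i (z i)))) := fun i => by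
        rw [Spd 0 i _ (Ssm _ _ (Ssm _ _ (hz i))), Spd 1 i _ (Ssm _ _ (hz i)), Spd 2 i _ (hz i)]
      have Ssum : ∀ k (g : Fin 3 → E3 → ℝ), (∀ i, Continuous (g i)) →
          S k (fun y => ∑ i, g i y) = fun x => ∑ i, S k (g i) x := by
        intro k g hg
        funext x
        simp only [hS, segAvg, one_mul]
        rw [intervalIntegral.integral_finsetSum]
        intro i _
        exact ((hg i).comp (by fun_prop)).intervalIntegrable _ _
      have hz' : ∀ i, Sm (pd i (z i)) := fun i => (hz i).pd i
      simp only [e]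
      rw [show f = fun y => ∑ i, pd i (z i) y from funext fun y => (hdiv y).symm,
        Ssum 2 _ fun i => (hz' i).continuous, Ssum 1 _ fun i => (Ssm _ _ (hz' i)).continuous,
        Ssum 0 _ fun i => (Ssm _ _ (Ssm _ _ (hz' i))).continuous]
    rw [Finset.sum_add_distrib, a3, Fin.sum_univ_three]
    simp only [Matrix.cons_val_zero, Matrix.cons_val_one, Matrix.cons_val]
    rw [a1, a2, Hdiv 0 f hf]
    ring
  · intro i p hp
    exact (Sp 0 _ _ p (Ssm _ _ (Ssm _ _ (hz i))) (Ssu _ _ _ (Ssu _ _ _ (hzs i))) hp).trans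
      ((Sp 1 _ _ p (Ssm _ _ (hz i)) (Ssu _ _ _ (hzs i)) hp).trans (Sp 2 _ _ p (hz i) (hzs i) hp))
  · intro i k
    have s2 := Ssm 2 _ (hz i)
    have u2 := Ssu 2 _ _ (hzs i)
    have s1 := Ssm 1 _ s2
    have u1 := Ssu 1 _ _ u2
    fin_cases k
    · refine (SD 0 _ _ s1 u1).trans (mul_le_mul_of_nonneg_left ?_ h4)
      exact (S2 1 _ _ s2 u2).trans (S2 2 _ _ (hz i) (hzs i))
    · change ∫ x, pd 1 (S 0 (S 1 (S 2 (z i)))) x ^ 2 ≤ _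
      rw [Spd 0 1 _ s1]
      refine (S2 0 _ _ (s1.pd 1) (u1.pd 1)).trans ((SD 1 _ _ s2 u2).trans ?_)
      exact mul_le_mul_of_nonneg_left (S2 2 _ _ (hz i) (hzs i)) h4
    · change ∫ x, pd 2 (S 0 (S 1 (S 2 (z i)))) x ^ 2 ≤ _
      rw [Spd 0 2 _ s1]
      refine (S2 0 _ _ (s1.pd 2) (u1.pd 2)).trans ?_
      rw [Spd 1 2 _ s2]
      exact (S2 1 _ _ (s2.pd 2) (u2.pd 2)).trans (SD 2 _ _ (hz i) (hzs i))
  · intro i k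
    have fk := hf.pd k
    have fs := hfs.pd k
    fin_cases i
    · change ∫ x, pd k (H 0 f) x ^ 2 ≤ _
      rw [Hpd 0 k f hf]
      exact H2 0 _ _ fk fs
    · change ∫ x, pd k (S 0 (H 1 f)) x ^ 2 ≤ _
      rw [Spd 0 k _ (Hsm _ _ hf), Hpd 1 k f hf]
      exact (S2 0 _ _ (Hsm _ _ fk) (Hsu _ _ _ fs)).trans (H2 1 _ _ fk fs)
    · change ∫ x, pd k (S 0 (S 1 (H 2 f))) x ^ 2 ≤ _
      rw [Spd 0 k _ (Ssm _ _ (Hsm _ _ hf)), Spd 1 k _ (Hsm _ _ hf), Hpd 2 k f hf]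
      exact (S2 0 _ _ (Ssm _ _ (Hsm _ _ fk)) (Ssu _ _ _ (Hsu _ _ _ fs))).trans
        ((S2 1 _ _ (Hsm _ _ fk) (Hsu _ _ _ fs)).trans (H2 2 _ _ fk fs))

/-! ### A smooth step -/

theorem exists_bound_deriv_smoothTransition : ∃ c : ℝ, 1 ≤ c ∧
    (∀ t, |deriv Real.smoothTransition t| ≤ c) ∧
    ∀ t, |deriv (deriv Real.smoothTransition) t| ≤ c := by
  have hs : ContDiff ℝ (⊤ : ℕ∞) Real.smoothTransition := Real.smoothTransition.contDiff
  have hs1 : ContDiff ℝ (⊤ : ℕ∞) (deriv Real.smoothTransition) := (contDiff_infty_iff_deriv.1 hs).2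
  have hs2 : ContDiff ℝ (⊤ : ℕ∞) (deriv (deriv Real.smoothTransition)) :=
    (contDiff_infty_iff_deriv.1 hs1).2
  have key : ∀ {g : ℝ → ℝ} (a b : ℝ) (s : Set ℝ), IsOpen s → (∀ t ∈ s, g t = a) →
      ∀ t ∈ s, deriv g t = 0 := by
    intro g a b s ho hg t ht
    have : g =ᶠ[𝓝 t] fun _ => a := by
      filter_upwards [ho.mem_nhds ht] with y hy using hg y hy
    rw [this.deriv_eq, deriv_const]
  have z1 : ∀ t ∈ Set.Iio (0 : ℝ), deriv Real.smoothTransition t = 0 :=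
    key 0 0 _ isOpen_Iio fun t ht => Real.smoothTransition.zero_of_nonpos (le_of_lt ht)
  have z2 : ∀ t ∈ Set.Ioi (1 : ℝ), deriv Real.smoothTransition t = 0 :=
    key 1 0 _ isOpen_Ioi fun t ht => Real.smoothTransition.one_of_one_le (le_of_lt ht)
  obtain ⟨c1, h1⟩ := (isCompact_Icc (a := (0 : ℝ)) (b := 1)).exists_bound_of_continuousOn
    hs1.continuous.continuousOn
  obtain ⟨c2, h2⟩ := (isCompact_Icc (a := (0 : ℝ)) (b := 1)).exists_bound_of_continuousOn
    hs2.continuous.continuousOn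
  refine ⟨max 1 (max c1 c2), le_max_left _ _, fun t => ?_, fun t => ?_⟩
  · rcases lt_or_ge t 0 with h | h
    · rw [z1 t h]; simp
    rcases lt_or_ge 1 t with h' | h'
    · rw [z2 t h']; simp
    · exact (h1 t ⟨h, h'⟩).trans ((le_max_left _ _).trans (le_max_right _ _))
  · rcases lt_or_ge t 0 with h | h
    · rw [key 0 0 _ isOpen_Iio z1 t h]; simp
    rcases lt_or_ge 1 t with h' | h'
    · rw [key 0 0 _ isOpen_Ioi z2 t h']; simp
    · exact (h2 t ⟨h, h'⟩).trans ((le_max_right _ _).trans (le_max_right _ _))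

theorem deriv_smoothTransition_nonneg (t : ℝ) : 0 ≤ deriv Real.smoothTransition t :=
  Real.smoothTransition.monotone.deriv_nonneg

theorem hasDerivAt_smoothTransition (t : ℝ) :
    HasDerivAt Real.smoothTransition (deriv Real.smoothTransition t) t :=
  ((Real.smoothTransition.contDiff (n := 1)).differentiable (by norm_num) t).hasDerivAt

/-! ### A right inverse of the divergence on a cube -/

/-- The point `x` with its `i`-th coordinate replaced by `s`. -/
def upd (x : E3) (i : Fin 3) (s : ℝ) : E3 := x + (s - x i) • bv i

theorem upd_self (x : E3) (i : Fin 3) (s : ℝ) : upd x i s i = s := by simp [upd]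

theorem upd_ne (x : E3) {i k : Fin 3} (h : k ≠ i) (s : ℝ) : upd x i s k = x k := by
  simp [upd, h]

theorem upd_add_smul (x : E3) (i : Fin 3) (h s : ℝ) : upd (x + h • bv i) i s = upd x i s := by
  ext k
  by_cases hk : k = i
  · subst hk; rw [upd_self, upd_self]
  · rw [upd_ne _ hk, upd_ne _ hk]; simp [hk]

theorem contDiff_upd (i : Fin 3) : ContDiff ℝ (⊤ : ℕ∞) (fun p : E3 × ℝ => upd p.1 i p.2) := by
  unfold upd
  exact contDiff_fst.add ((contDiff_snd.sub ((sm_coord i).comp contDiff_fst)).smul contDiff_const)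

theorem continuous_upd (x : E3) (i : Fin 3) : Continuous (fun s => upd x i s) :=
  (contDiff_upd i).continuous.comp (Continuous.prodMk continuous_const continuous_id)

/-- Integral of `f` over the segment of the cube in direction `i` through `x`. -/
def fiberInt (R : ℝ) (i : Fin 3) (f : E3 → ℝ) (x : E3) : ℝ := ∫ s in (-R)..R, f (upd x i s)

/-- Primitive of `f` in the direction `i`. -/
def fiberPrim (R : ℝ) (i : Fin 3) (f : E3 → ℝ) (x : E3) : ℝ :=
  ∫ t in (0 : ℝ)..1, (x i + R) * f (upd x i (-R + (x i + R) * t))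

/-- A smooth step from `0` at `-R` to `1` at `R`. -/
def stepFun (R t : ℝ) : ℝ := Real.smoothTransition ((t + R) / (2 * R))

/-- The derivative of `stepFun`. -/
def stepDer (R t : ℝ) : ℝ := deriv Real.smoothTransition ((t + R) / (2 * R)) / (2 * R)

/-- Compactly supported modification of `fiberPrim`. -/
def fiberK (R : ℝ) (i : Fin 3) (f : E3 → ℝ) (x : E3) : ℝ :=
  fiberPrim R i f x - stepFun R (x i) * fiberInt R i f x

/-- The mass of `f` along each segment in direction `i`, redistributed with a fixed profile. -/
def fiberP (R : ℝ) (i : Fin 3) (f : E3 → ℝ) (x : E3) : ℝ :=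
  stepDer R (x i) * fiberInt R i f x

section
variable {R : ℝ} {f : E3 → ℝ}

theorem fiberPrim_eq (i : Fin 3) (f : E3 → ℝ) (x : E3) :
    fiberPrim R i f x = ∫ s in (-R)..(x i), f (upd x i s) := by
  unfold fiberPrim
  rw [intervalIntegral.integral_const_mul]
  have := intervalIntegral.smul_integral_comp_add_mul (a := 0) (b := 1)
    (fun s => f (upd x i s)) (x i + R) (-R)
  rw [smul_eq_mul] at this
  rw [this]
  congr 1 <;> ring

theorem hasDerivAt_stepFun (R t : ℝ) : HasDerivAt (stepFun R) (stepDer R t) t := by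
  have h1 : HasDerivAt (fun t : ℝ => (t + R) / (2 * R)) (1 / (2 * R)) t :=
    ((hasDerivAt_id t).add_const R).div_const _
  have := (hasDerivAt_smoothTransition ((t + R) / (2 * R))).comp t h1
  exact this.congr_deriv (by unfold stepDer; ring)

theorem contDiff_stepFun (R : ℝ) : ContDiff ℝ (⊤ : ℕ∞) (stepFun R) :=
  Real.smoothTransition.contDiff.comp (by fun_prop)

theorem contDiff_stepDer (R : ℝ) : ContDiff ℝ (⊤ : ℕ∞) (stepDer R) := by
  have hs1 : ContDiff ℝ (⊤ : ℕ∞) (deriv Real.smoothTransition) :=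
    (contDiff_infty_iff_deriv.1 Real.smoothTransition.contDiff).2
  exact (hs1.comp (f := fun t : ℝ => (t + R) / (2 * R)) (by fun_prop)).div_const _

theorem stepFun_of_le (hR : 0 < R) {t : ℝ} (h : t ≤ -R) : stepFun R t = 0 :=
  Real.smoothTransition.zero_of_nonpos (div_nonpos_of_nonpos_of_nonneg (by linarith) (by linarith))

theorem stepFun_of_ge (hR : 0 < R) {t : ℝ} (h : R ≤ t) : stepFun R t = 1 :=
  Real.smoothTransition.one_of_one_le (by rw [le_div_iff₀ (by linarith)]; linarith)

theorem stepDer_eq_zero (hR : 0 < R) {t : ℝ} (h : R < |t|) : stepDer R t = 0 := by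
  refine (hasDerivAt_stepFun R t).unique ?_
  rcases lt_abs.1 h with h | h
  · refine (hasDerivAt_const t (1 : ℝ)).congr_of_eventuallyEq ?_
    filter_upwards [isOpen_Ioi.mem_nhds h] with y hy using stepFun_of_ge hR (le_of_lt hy)
  · refine (hasDerivAt_const t (0 : ℝ)).congr_of_eventuallyEq ?_
    filter_upwards [isOpen_Iio.mem_nhds (show t < -R by linarith)] with y hy
      using stepFun_of_le hR (le_of_lt hy)

theorem fiberInt_sm (hf : Sm f) (i : Fin 3) : Sm (fiberInt R i f) :=
  contDiff_intervalIntegral_param (hf.comp (contDiff_upd i)) _ _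

theorem fiberPrim_sm (hf : Sm f) (i : Fin 3) : Sm (fiberPrim R i f) := by
  have h1 : ContDiff ℝ (⊤ : ℕ∞) (fun p : E3 × ℝ => p.1 i + R) :=
    ((sm_coord i).comp contDiff_fst).add contDiff_const
  refine contDiff_intervalIntegral_param (F := fun x t =>
    (x i + R) * f (upd x i (-R + (x i + R) * t))) (h1.mul (hf.comp ?_)) _ _
  exact (contDiff_upd i).comp (f := fun p : E3 × ℝ => (p.1, -R + (p.1 i + R) * p.2))
    (contDiff_fst.prodMk (contDiff_const.add (h1.mul contDiff_snd)))

theorem fiberK_sm (hf : Sm f) (i : Fin 3) : Sm (fiberK R i f) :=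
  (fiberPrim_sm hf i).sub (((contDiff_stepFun R).comp (sm_coord i)).mul (fiberInt_sm hf i))

theorem fiberP_sm (hf : Sm f) (i : Fin 3) : Sm (fiberP R i f) :=
  ((contDiff_stepDer R).comp (sm_coord i)).mul (fiberInt_sm hf i)

theorem pd_fiberK (hf : Sm f) (i : Fin 3) (x : E3) :
    pd i (fiberK R i f) x = f x - fiberP R i f x := by
  refine pd_eq_of_hasDerivAt (fiberK_sm hf i).diff ?_
  have hc : Continuous fun s => f (upd x i s) := hf.continuous.comp (continuous_upd x i)
  have e : ∀ t : ℝ, (x + t • bv i) i = x i + t := fun t => by simp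
  have e1 : (fun t : ℝ => fiberK R i f (x + t • bv i)) = fun t =>
      (∫ s in (-R)..(x i + t), f (upd x i s)) - stepFun R (x i + t) * fiberInt R i f x := by
    funext t
    simp only [fiberK, fiberPrim_eq, fiberInt, upd_add_smul, e]
  rw [e1]
  have h0 : HasDerivAt (fun t : ℝ => x i + t) 1 0 := (hasDerivAt_id 0).const_add _
  have h1 : HasDerivAt (fun t : ℝ => ∫ s in (-R)..(x i + t), f (upd x i s)) (f x * 1) 0 := by
    have hx : f (upd x i (x i + 0)) = f x := by simp [upd]
    rw [← hx]
    exact (intervalIntegral.integral_hasDerivAt_right (hc.intervalIntegrable _ _)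
      (hc.stronglyMeasurableAtFilter _ _) hc.continuousAt).comp (0 : ℝ) h0
  have h2 : HasDerivAt (fun t : ℝ => stepFun R (x i + t)) (stepDer R (x i) * 1) 0 := by
    have := hasDerivAt_stepFun R (x i + 0)
    have h3 := this.comp (0 : ℝ) h0
    simp only [add_zero] at h3
    exact h3
  have h3 := h1.sub (h2.mul_const (fiberInt R i f x))
  simp only [mul_one] at h3
  exact h3

theorem eq_zero_of_upd (hs : Supp R f) {x : E3} {i k : Fin 3} (hk : k ≠ i) (h : R < |x k|)
    (s : ℝ) : f (upd x i s) = 0 :=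
  hs _ fun hm => by have := hm k; rw [upd_ne _ hk] at this; linarith

theorem eq_zero_of_upd' (hs : Supp R f) {x : E3} {i : Fin 3} {s : ℝ} (h : R < |s|) :
    f (upd x i s) = 0 :=
  hs _ fun hm => by have := hm i; rw [upd_self] at this; linarith

theorem fiberK_supp (hR : 0 < R) (hf : Continuous f) (hs : Supp R f) (i : Fin 3) :
    Supp R (fiberK R i f) := by
  intro x hx
  have hc : Continuous fun s => f (upd x i s) := hf.comp (continuous_upd x i)
  simp only [cube, Set.mem_ofPred_eq, not_forall, not_le] at hx
  obtain ⟨k, hk⟩ := hx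
  rw [fiberK, fiberPrim_eq, fiberInt]
  by_cases hki : k = i
  · subst hki
    rcases lt_abs.1 hk with h | h
    · rw [stepFun_of_ge hR h.le, ← intervalIntegral.integral_add_adjacent_intervals
        (hc.intervalIntegrable (-R) R) (hc.intervalIntegrable R (x k)),
        intervalIntegral.integral_zero_ae (a := R)]
      · ring
      refine Eventually.of_forall fun s hs' => eq_zero_of_upd' hs ?_
      rw [Set.uIoc_of_le h.le] at hs'
      exact hs'.1.trans_le (le_abs_self s)
    · rw [stepFun_of_le hR (by linarith), intervalIntegral.integral_symm,
        intervalIntegral.integral_congr_ae (g := fun _ => (0 : ℝ))]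
      · simp
      have h' : ∀ᵐ s : ℝ, s ≠ -R := by simp [ae_iff]
      filter_upwards [h'] with s hsR hs'
      rw [Set.uIoc_of_le (by linarith)] at hs'
      refine eq_zero_of_upd' hs ?_
      have : s < -R := lt_of_le_of_ne hs'.2 hsR
      exact lt_abs.2 (Or.inr (by linarith))
  · simp [eq_zero_of_upd hs hki hk]

theorem fiberP_supp (hR : 0 < R) (hs : Supp R f) (i : Fin 3) : Supp R (fiberP R i f) := by
  intro x hx
  simp only [cube, Set.mem_ofPred_eq, not_forall, not_le] at hx
  obtain ⟨k, hk⟩ := hx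
  by_cases hki : k = i
  · subst hki
    rw [fiberP, stepDer_eq_zero hR hk, zero_mul]
  · simp [fiberP, fiberInt, eq_zero_of_upd hs hki hk]

theorem integral_abs_fiber_le (hR : 0 < R) (hf : Continuous f) (i : Fin 3) {x : E3}
    (hx : x ∈ cube R) :
    ∫ s in (-R)..R, |f (upd x i s)| ≤ ∫ t in (-(2 * R))..(2 * R), |f (x + t • bv i)| := by
  have hc : Continuous fun t : ℝ => |f (x + t • bv i)| := (hf.comp (by fun_prop)).abs
  have h1 := intervalIntegral.integral_comp_sub_right (a := -R) (b := R)
    (fun t : ℝ => |f (x + t • bv i)|) (x i)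
  have hxi := abs_le.1 (hx i)
  calc _ = ∫ t in (-R - x i)..(R - x i), |f (x + t • bv i)| := h1
    _ ≤ _ := intervalIntegral.integral_mono_interval (by linarith) (by linarith) (by linarith)
      (Eventually.of_forall fun t => abs_nonneg _) (hc.intervalIntegrable _ _)

theorem abs_fiberK_le (hR : 0 < R) (hf : Continuous f) (hs : Supp R f) (i : Fin 3) (x : E3) :
    |fiberK R i f x| ≤ 2 * ∫ t in (-(2 * R))..(2 * R), |f (x + t • bv i)| := by
  by_cases hx : x ∈ cube R
  · have h0 := integral_abs_fiber_le hR hf i hx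
    have hc : Continuous fun s => f (upd x i s) := hf.comp (continuous_upd x i)
    have hxi := abs_le.1 (hx i)
    have h1 : |fiberPrim R i f x| ≤ ∫ s in (-R)..R, |f (upd x i s)| := by
      rw [fiberPrim_eq]
      refine (intervalIntegral.abs_integral_le_integral_abs hxi.1).trans ?_
      exact intervalIntegral.integral_mono_interval le_rfl hxi.1 hxi.2
        (Eventually.of_forall fun t => abs_nonneg _) (hc.abs.intervalIntegrable _ _)
    have h2 : |fiberInt R i f x| ≤ ∫ s in (-R)..R, |f (upd x i s)| :=
      intervalIntegral.abs_integral_le_integral_abs (by linarith)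
    have h3 : |stepFun R (x i)| ≤ 1 := by
      rw [stepFun, abs_of_nonneg (Real.smoothTransition.nonneg _)]
      exact Real.smoothTransition.le_one _
    calc |fiberK R i f x| ≤ |fiberPrim R i f x| + |stepFun R (x i) * fiberInt R i f x| :=
          abs_sub _ _
      _ ≤ |fiberPrim R i f x| + 1 * |fiberInt R i f x| := by rw [abs_mul]; gcongr
      _ ≤ _ := by linarith
  · rw [fiberK_supp hR hf hs i x hx, abs_zero]
    exact mul_nonneg zero_le_two
      (intervalIntegral.integral_nonneg (by linarith) fun t _ => abs_nonneg _)

theorem abs_fiberP_le {c : ℝ} (hc0 : ∀ t, |deriv Real.smoothTransition t| ≤ c) (hR : 0 < R)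
    (hf : Continuous f) (hs : Supp R f) (i : Fin 3) (x : E3) :
    |fiberP R i f x| ≤ (c / (2 * R)) * ∫ t in (-(2 * R))..(2 * R), |f (x + t • bv i)| := by
  have hcn : 0 ≤ c := (abs_nonneg _).trans (hc0 0)
  by_cases hx : x ∈ cube R
  · have h0 := integral_abs_fiber_le hR hf i hx
    have h2 : |fiberInt R i f x| ≤ ∫ s in (-R)..R, |f (upd x i s)| :=
      intervalIntegral.abs_integral_le_integral_abs (by linarith)
    have h3 : |stepDer R (x i)| ≤ c / (2 * R) := by
      rw [stepDer, abs_div, abs_of_pos (show 0 < 2 * R by linarith)]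
      exact div_le_div_of_nonneg_right (hc0 _) (by linarith)
    rw [fiberP, abs_mul]
    exact mul_le_mul h3 (h2.trans h0) (abs_nonneg _) (by positivity)
  · rw [fiberP_supp hR hs i x hx, abs_zero]
    exact mul_nonneg (by positivity)
      (intervalIntegral.integral_nonneg (by linarith) fun t _ => abs_nonneg _)

theorem fiberP_iterate (f : E3 → ℝ) (x : E3) :
    fiberP R 2 (fiberP R 1 (fiberP R 0 f)) x =
      stepDer R (x 0) * stepDer R (x 1) * stepDer R (x 2) *
        ∫ s₂ in (-R)..R, ∫ s₁ in (-R)..R, ∫ s₀ in (-R)..R, f !₂[s₀, s₁, s₂] := by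
  have e : ∀ s₂ s₁ s₀, upd (upd (upd x 2 s₂) 1 s₁) 0 s₀ = !₂[s₀, s₁, s₂] := by
    intro s₂ s₁ s₀
    ext k
    fin_cases k <;> simp [upd]
  have e1 : ∀ s₂ s₁, upd (upd x 2 s₂) 1 s₁ 0 = x 0 := fun s₂ s₁ => by simp [upd]
  have e2 : ∀ s₂, upd x 2 s₂ 1 = x 1 := fun s₂ => by simp [upd]
  simp only [fiberP, fiberInt, e, e1, e2, intervalIntegral.integral_const_mul]
  ring

end

/-- On compactly supported functions of mean zero, the divergence has a right inverse which
gains one length scale in every `L^p`. -/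
theorem exists_divergence_inverse : ∃ C : ℝ, 1 ≤ C ∧ ∀ R : ℝ, 0 < R → ∀ f : E3 → ℝ, Sm f →
    Supp R f → ∫ x, f x = 0 → ∃ B : Fin 3 → E3 → ℝ, (∀ i, Sm (B i)) ∧ (∀ i, Supp R (B i)) ∧
      (∀ x, ∑ i, pd i (B i) x = f x) ∧
      ∀ i, ∀ p : ℝ, 1 ≤ p → ∫ x, |B i x| ^ p ≤ (C * R) ^ p * ∫ x, |f x| ^ p := by
  obtain ⟨c, hc1, hc, -⟩ := exists_bound_deriv_smoothTransition
  refine ⟨8 * (2 * c) ^ 2, by nlinarith, fun R hR f hf hs h0 => ?_⟩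
  have hab : -(2 * R) < 2 * R := by linarith
  have Kp : ∀ i g (p : ℝ), Sm g → Supp R g → 1 ≤ p →
      ∫ x, |fiberK R i g x| ^ p ≤ (8 * R) ^ p * ∫ x, |g x| ^ p := by
    intro i g p hg hgs hp
    have := integral_rpow_le_of_segment hab hp zero_le_two hg.continuous
      (fiberK_sm hg i).continuous hgs (bv i) (abs_fiberK_le hR hg.continuous hgs i)
    rwa [show 2 * (2 * R - -(2 * R)) = 8 * R by ring] at this
  have Pp : ∀ i g (p : ℝ), Sm g → Supp R g → 1 ≤ p →
      ∫ x, |fiberP R i g x| ^ p ≤ (2 * c) ^ p * ∫ x, |g x| ^ p := by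
    intro i g p hg hgs hp
    have := integral_rpow_le_of_segment hab hp (by positivity) hg.continuous
      (fiberP_sm hg i).continuous hgs (bv i) (abs_fiberP_le hc hR hg.continuous hgs i)
    rwa [show c / (2 * R) * (2 * R - -(2 * R)) = 2 * c by field_simp; ring] at this
  set f₁ := fiberP R 0 f with hf₁
  set f₂ := fiberP R 1 f₁ with hf₂
  have s1 : Sm f₁ := fiberP_sm hf 0
  have s2 : Sm f₂ := fiberP_sm s1 1
  have u1 : Supp R f₁ := fiberP_supp hR hs 0
  have u2 : Supp R f₂ := fiberP_supp hR u1 1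
  have u3 : Supp R (fiberP R 2 f₂) := fiberP_supp hR u2 2
  have s3 : Sm (fiberP R 2 f₂) := fiberP_sm s2 2
  have k0 := fiberK_sm (R := R) hf 0
  have k1 := fiberK_sm (R := R) s1 1
  have k2 := fiberK_sm (R := R) s2 2
  have v0 := fiberK_supp hR hf.continuous hs 0
  have v1 := fiberK_supp hR s1.continuous u1 1
  have v2 := fiberK_supp hR s2.continuous u2 2
  have hdiv : ∀ x, pd 0 (fiberK R 0 f) x + pd 1 (fiberK R 1 f₁) x + pd 2 (fiberK R 2 f₂) x
      = f x - fiberP R 2 f₂ x := by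
    intro x
    rw [pd_fiberK hf, pd_fiberK s1, pd_fiberK s2]
    ring
  have hInt : ∫ x, fiberP R 2 f₂ x = 0 := by
    have e : (fun x => fiberP R 2 f₂ x) = fun x => f x - (pd 0 (fiberK R 0 f) x
        + pd 1 (fiberK R 1 f₁) x + pd 2 (fiberK R 2 f₂) x) := by
      funext x; rw [hdiv]; ring
    have i0 := (v0.pd 0).integrable (k0.pd 0).continuous
    have i1 := (v1.pd 1).integrable (k1.pd 1).continuous
    have i2 := (v2.pd 2).integrable (k2.pd 2).continuous
    have i01 : Integrable fun x => pd 0 (fiberK R 0 f) x + pd 1 (fiberK R 1 f₁) x := i0.add i1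
    have i012 : Integrable fun x => pd 0 (fiberK R 0 f) x + pd 1 (fiberK R 1 f₁) x
        + pd 2 (fiberK R 2 f₂) x := i01.add i2
    rw [e, integral_sub (hs.integrable hf.continuous) i012,
      integral_add i01 i2, integral_add i0 i1, h0, integral_pd_eq_zero k0.one v0,
      integral_pd_eq_zero k1.one v1, integral_pd_eq_zero k2.one v2]
    ring
  have hzero : ∀ x, fiberP R 2 f₂ x = 0 := by
    have e : ∀ x, fiberP R 2 f₂ x = _ := fun x => fiberP_iterate f x
    set N := ∫ s₂ in (-R)..R, ∫ s₁ in (-R)..R, ∫ s₀ in (-R)..R, f !₂[s₀, s₁, s₂] with hN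
    by_cases hN0 : N = 0
    · intro x; rw [e, hN0, mul_zero]
    have hpos : ∀ x : E3, 0 ≤ stepDer R (x 0) * stepDer R (x 1) * stepDer R (x 2) := by
      have : ∀ t, 0 ≤ stepDer R t := fun t =>
        div_nonneg (deriv_smoothTransition_nonneg _) (by linarith)
      intro x
      exact mul_nonneg (mul_nonneg (this _) (this _)) (this _)
    have e' : ∀ x : E3, stepDer R (x 0) * stepDer R (x 1) * stepDer R (x 2)
        = N⁻¹ * fiberP R 2 f₂ x := fun x => by rw [e]; field_simp
    have hi : Integrable fun x : E3 => stepDer R (x 0) * stepDer R (x 1) * stepDer R (x 2) := by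
      simp only [e']
      exact (u3.integrable s3.continuous).const_mul _
    have hz := (integral_eq_zero_iff_of_nonneg hpos hi).1 (by
      simp only [e', integral_const_mul, hInt, mul_zero])
    have hcont : Continuous fun x : E3 => stepDer R (x 0) * stepDer R (x 1) * stepDer R (x 2) := by
      simp only [e']
      exact continuous_const.mul s3.continuous
    have hz2 : (fun x : E3 => stepDer R (x 0) * stepDer R (x 1) * stepDer R (x 2)) =
        fun _ => (0 : ℝ) := (hcont.ae_eq_iff_eq volume continuous_const).1 hz
    intro x
    rw [e, congrFun hz2 x, zero_mul]
  have c4 : (1 : ℝ) ≤ 2 * c := by linarith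
  have nn : ∀ (g : E3 → ℝ) (p : ℝ), 0 ≤ ∫ x, |g x| ^ p := fun g p =>
    integral_nonneg fun x => by positivity
  refine ⟨![fiberK R 0 f, fiberK R 1 f₁, fiberK R 2 f₂], ?_, ?_, ?_, ?_⟩
  · intro i; fin_cases i <;> assumption
  · intro i; fin_cases i <;> assumption
  · intro x
    rw [Fin.sum_univ_three]
    simp only [Matrix.cons_val_zero, Matrix.cons_val_one, Matrix.cons_val]
    rw [hdiv, hzero, sub_zero]
  · intro i p hp
    have hp0 : 0 ≤ p := by linarith
    have e8 : (8 * (2 * c) ^ 2 * R) ^ p = (8 * R) ^ p * ((2 * c) ^ p * (2 * c) ^ p) := by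
      rw [← Real.mul_rpow (by positivity) (by positivity),
        ← Real.mul_rpow (by positivity) (by positivity)]
      ring_nf
    have h1 : 1 ≤ (2 * c) ^ p := Real.one_le_rpow c4 hp0
    have h8 : 0 ≤ (8 * R) ^ p := by positivity
    rw [e8]
    have b1 := Pp 0 f p hf hs hp
    have b2 := Pp 1 f₁ p s1 u1 hp
    have hn := nn f p
    have hn1 := nn f₁ p
    set A := (2 * c) ^ p
    set I := ∫ x, |f x| ^ p
    fin_cases i
    · refine (Kp 0 f p hf hs hp).trans ?_
      rw [mul_assoc]
      refine mul_le_mul_of_nonneg_left ?_ h8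
      exact le_mul_of_one_le_left hn (by nlinarith)
    · refine (Kp 1 f₁ p s1 u1 hp).trans ?_
      rw [mul_assoc]
      refine mul_le_mul_of_nonneg_left (b1.trans ?_) h8
      refine mul_le_mul_of_nonneg_right ?_ hn
      nlinarith
    · refine (Kp 2 f₂ p s2 u2 hp).trans ?_
      rw [mul_assoc]
      refine mul_le_mul_of_nonneg_left (b2.trans ?_) h8
      rw [mul_assoc]
      exact mul_le_mul_of_nonneg_left b1 (by linarith)

/-! ### Cutoff functions -/

theorem Sm.mul {f g : E3 → ℝ} (hf : Sm f) (hg : Sm g) : Sm fun x => f x * g x :=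
  ContDiff.mul hf hg

/-- Smooth functions whose derivatives up to order two have size `c` at scale `d`. -/
structure ScaleBound (d c : ℝ) (f : E3 → ℝ) : Prop where
  sm : Sm f
  zero : ∀ x, |f x| ≤ c
  one : ∀ i x, |pd i f x| ≤ c / d
  two : ∀ i j x, |pd i (pd j f) x| ≤ c / d ^ 2

theorem ScaleBound.mul {d c c' : ℝ} (hd : 0 < d) {f g : E3 → ℝ}
    (hf : ScaleBound d c f) (hg : ScaleBound d c' g) :
    ScaleBound d (4 * (c * c')) (fun x => f x * g x) := by
  have c0 : 0 ≤ c := (abs_nonneg _).trans (hf.zero 0)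
  have c0' : 0 ≤ c' := (abs_nonneg _).trans (hg.zero 0)
  have hcc : 0 ≤ c * c' := mul_nonneg c0 c0'
  have e1 : ∀ j, pd j (fun x => f x * g x) = fun x => pd j f x * g x + f x * pd j g x :=
    fun j => funext fun x => pd_mul (hf.sm.diff x) (hg.sm.diff x) j
  have mulb : ∀ {a b A B : ℝ}, |a| ≤ A → |b| ≤ B → |a * b| ≤ A * B := fun ha hb => by
    rw [abs_mul]; exact mul_le_mul ha hb (abs_nonneg _) ((abs_nonneg _).trans ha)
  refine ⟨hf.sm.mul hg.sm, fun x => ?_, fun i x => ?_, fun i j x => ?_⟩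
  · exact (mulb (hf.zero x) (hg.zero x)).trans (by linarith)
  · rw [e1]
    refine (abs_add_le _ _).trans ?_
    have := add_le_add (mulb (hf.one i x) (hg.zero x)) (mulb (hf.zero x) (hg.one i x))
    refine this.trans ?_
    rw [show c / d * c' + c * (c' / d) = 2 * (c * c') / d by ring]
    gcongr; linarith
  · rw [e1, pd_add (((hf.sm.pd j).mul hg.sm).diff x) ((hf.sm.mul (hg.sm.pd j)).diff x),
      pd_mul ((hf.sm.pd j).diff x) (hg.sm.diff x), pd_mul (hf.sm.diff x) ((hg.sm.pd j).diff x)]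
    have h1 := mulb (hf.two i j x) (hg.zero x)
    have h2 := mulb (hf.one j x) (hg.one i x)
    have h3 := mulb (hf.one i x) (hg.one j x)
    have h4 := mulb (hf.zero x) (hg.two i j x)
    have e : 4 * (c * c') / d ^ 2 = c / d ^ 2 * c' + c / d * (c' / d) + c / d * (c' / d)
        + c * (c' / d ^ 2) := by field_simp; ring
    rw [e]
    refine (abs_add_le _ _).trans ?_
    have := abs_add_le (pd i (pd j f) x * g x) (pd j f x * pd i g x)
    have := abs_add_le (pd i f x * pd j g x) (f x * pd i (pd j g) x)
    linarith

theorem pd_step_coord {ρ d ε : ℝ} {τ τ' : ℝ → ℝ} (hτ : ∀ y, HasDerivAt τ (τ' y) y)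
    (i k : Fin 3) (x : E3) :
    pd k (fun y : E3 => τ ((ρ + ε * y i) / d)) x =
      τ' ((ρ + ε * x i) / d) * (ε / d * if i = k then 1 else 0) := by
  have h : DifferentiableAt ℝ (fun y : E3 => (ρ + ε * y i) / d) x := by
    have := (sm_coord i).diff x
    fun_prop
  rw [pd_comp hτ h]
  congr 1
  have e : (fun y : E3 => (ρ + ε * y i) / d) = fun y => ρ / d + ε / d * y i := by
    funext y; ring
  rw [e, pd_add (by fun_prop) (((sm_coord i).diff x).const_mul _), pd_const,
    pd_const_mul _ ((sm_coord i).diff x), pd_coord, zero_add]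

theorem exists_cutoff : ∃ c : ℝ, 1 ≤ c ∧ ∀ ρ d : ℝ, 0 < d → ∃ φ : E3 → ℝ,
    ScaleBound d c φ ∧ (∀ x, 0 ≤ φ x) ∧ (∀ x, φ x ≤ 1) ∧ Supp ρ φ ∧
      ∀ x ∈ cube (ρ - d), φ x = 1 := by
  obtain ⟨c, hc1, hc, hc'⟩ := exists_bound_deriv_smoothTransition
  have step : ∀ ρ d ε : ℝ, 0 < d → |ε| = 1 → ∀ i : Fin 3,
      ScaleBound d c (fun x : E3 => Real.smoothTransition ((ρ + ε * x i) / d)) := by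
    intro ρ d ε hd hε i
    have hs1 : ContDiff ℝ (⊤ : ℕ∞) (deriv Real.smoothTransition) :=
      (contDiff_infty_iff_deriv.1 Real.smoothTransition.contDiff).2
    have hlin : Sm (fun x : E3 => (ρ + ε * x i) / d) :=
      (contDiff_const.add (contDiff_const.mul (sm_coord i))).div_const _
    have e1 : ∀ k, pd k (fun x : E3 => Real.smoothTransition ((ρ + ε * x i) / d)) = fun x =>
        (ε / d * if i = k then 1 else 0) * deriv Real.smoothTransition ((ρ + ε * x i) / d) :=
      fun k => funext fun x => by rw [pd_step_coord hasDerivAt_smoothTransition]; ring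
    have hb : ∀ k, |ε / d * if i = k then (1 : ℝ) else 0| ≤ 1 / d := by
      intro k
      split_ifs
      · rw [mul_one, abs_div, hε, abs_of_pos hd]
      · rw [mul_zero, abs_zero]; positivity
    refine ⟨Real.smoothTransition.contDiff.comp hlin, fun x => ?_, fun k x => ?_, fun k l x => ?_⟩
    · rw [abs_of_nonneg (Real.smoothTransition.nonneg _)]
      exact (Real.smoothTransition.le_one _).trans hc1
    · rw [e1, abs_mul]
      calc _ ≤ 1 / d * c := mul_le_mul (hb k) (hc _) (abs_nonneg _) (by positivity)
        _ = _ := by ring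
    · rw [e1, pd_const_mul (f := fun x : E3 => deriv Real.smoothTransition ((ρ + ε * x i) / d)) _
        ((hs1.comp hlin).differentiable (by simp) x),
        pd_step_coord (τ' := deriv (deriv Real.smoothTransition))
          (fun y => (hs1.differentiable (by simp) y).hasDerivAt), abs_mul,
        abs_mul (deriv (deriv Real.smoothTransition) _)]
      calc _ ≤ 1 / d * (c * (1 / d)) := by
            refine mul_le_mul (hb l) (mul_le_mul (hc' _) (hb k) (abs_nonneg _) (by linarith))
              (by positivity) (by positivity)
        _ = _ := by field_simp
  have c0 : 0 ≤ c := by linarith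
  refine ⟨4 * (4 * (4 * (c * c) * (4 * (c * c))) * (4 * (c * c))), ?_, fun ρ d hd => ?_⟩
  · have : 1 ≤ c * c := by nlinarith
    have h2 : 1 ≤ 4 * (c * c) * (4 * (c * c)) := by nlinarith
    have h3 : 1 ≤ 4 * (4 * (c * c) * (4 * (c * c))) * (4 * (c * c)) := by nlinarith
    linarith
  have pair : ∀ i : Fin 3, ScaleBound d (4 * (c * c)) (fun x : E3 =>
      Real.smoothTransition ((ρ + (-1) * x i) / d) * Real.smoothTransition ((ρ + 1 * x i) / d)) :=
    fun i => (step ρ d (-1) hd (by simp) i).mul hd (step ρ d 1 hd (by simp) i)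
  have p0 : ∀ (i : Fin 3) (x : E3), 0 ≤ Real.smoothTransition ((ρ + (-1) * x i) / d) *
      Real.smoothTransition ((ρ + 1 * x i) / d) := fun i x =>
    mul_nonneg (Real.smoothTransition.nonneg _) (Real.smoothTransition.nonneg _)
  have p1 : ∀ (i : Fin 3) (x : E3), Real.smoothTransition ((ρ + (-1) * x i) / d) *
      Real.smoothTransition ((ρ + 1 * x i) / d) ≤ 1 := fun i x =>
    mul_le_one₀ (Real.smoothTransition.le_one _) (Real.smoothTransition.nonneg _)
      (Real.smoothTransition.le_one _)
  refine ⟨_, ((pair 0).mul hd (pair 1)).mul hd (pair 2), fun x => ?_, fun x => ?_, ?_, ?_⟩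
  · exact mul_nonneg (mul_nonneg (p0 0 x) (p0 1 x)) (p0 2 x)
  · exact mul_le_one₀ (mul_le_one₀ (p1 0 x) (p0 1 x) (p1 1 x)) (p0 2 x) (p1 2 x)
  · intro x hx
    simp only [cube, Set.mem_ofPred_eq, not_forall, not_le] at hx
    obtain ⟨k, hk⟩ := hx
    have : Real.smoothTransition ((ρ + (-1) * x k) / d) *
        Real.smoothTransition ((ρ + 1 * x k) / d) = 0 := by
      rcases lt_abs.1 hk with h | h
      · rw [Real.smoothTransition.zero_of_nonpos
          (div_nonpos_of_nonpos_of_nonneg (by linarith) hd.le), zero_mul]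
      · rw [Real.smoothTransition.zero_of_nonpos (x := (ρ + 1 * x k) / d)
          (div_nonpos_of_nonpos_of_nonneg (by linarith) hd.le), mul_zero]
    fin_cases k <;> simp_all
  · intro x hx
    have : ∀ k, Real.smoothTransition ((ρ + (-1) * x k) / d) *
        Real.smoothTransition ((ρ + 1 * x k) / d) = 1 := by
      intro k
      have hk := abs_le.1 (hx k)
      rw [Real.smoothTransition.one_of_one_le (by rw [le_div_iff₀ hd]; linarith),
        Real.smoothTransition.one_of_one_le (by rw [le_div_iff₀ hd]; linarith), one_mul]
    simp only [this, mul_one]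

/-! ### Test fields with prescribed divergence -/

theorem exists_test_field : ∃ C : ℝ, 1 ≤ C ∧ ∀ (L R d δ c : ℝ), 0 < d → d ≤ R → R ≤ L → 0 < δ →
    1 ≤ c → ∀ (φ : E3 → ℝ), ScaleBound d c φ → Supp R φ → ∀ (F : Fin 3 → Fin 3 → E3 → ℝ)
    (U : Fin 3 → E3 → ℝ), (∀ i j, Sm (F i j)) → (∀ j, Sm (U j)) →
    (∀ j x, ∑ i, pd i (F i j) x = U j x) → (∀ x, ∑ j, pd j (U j) x = 0) →
    ∃ z₁ z₂ : Fin 3 → E3 → ℝ, (∀ i, Sm (z₁ i)) ∧ (∀ i, Sm (z₂ i)) ∧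
      (∀ i, Supp (R + 3 * δ) (z₁ i)) ∧ (∀ i, Supp (R + 3 * δ) (z₂ i)) ∧
      (∀ x, ∑ i, (pd i (z₁ i) x + pd i (z₂ i) x) = ∑ j, U j x * pd j φ x) ∧
      (∀ i, ∀ p : ℝ, 1 ≤ p → ∫ x, |z₁ i x| ^ p ≤
        (C * c * (L / d ^ 2)) ^ p * ∑ i, ∑ j, ∫ x in cube R, |F i j x| ^ p) ∧
      (∀ i k, ∫ x, pd k (z₁ i) x ^ 2 ≤
        4 * (δ⁻¹) ^ 2 * ((C * c * (L / d ^ 2)) ^ 2 * ∑ i, ∑ j, ∫ x in cube R, F i j x ^ 2)) ∧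
      (∀ i k, ∫ x, pd k (z₂ i) x ^ 2 ≤ δ ^ 2 * (6 * c ^ 2 * ∑ j,
        ((d⁻¹) ^ 2 * ∫ x in cube R, pd k (U j) x ^ 2) +
        6 * c ^ 2 * ∑ j, ((d⁻¹) ^ 4 * ∫ x in cube R, U j x ^ 2))) := by
  obtain ⟨CB, hCB, hB⟩ := exists_divergence_inverse
  refine ⟨36 * CB, by linarith, ?_⟩
  intro L R d δ c hd hdR hRL hδ hc φ hφ hφs F U hF hU hFU hUd
  have hR : 0 < R := by linarith
  have hL : 0 < L := by linarith
  set f : E3 → ℝ := fun x => ∑ j, U j x * pd j φ x with hf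
  set G : E3 → ℝ := fun x => ∑ i, ∑ j, F i j x * pd i (pd j φ) x with hG
  set g : Fin 3 → E3 → ℝ := fun i x => ∑ j, F i j x * pd j φ x with hg
  have fsm : Sm f := ContDiff.sum fun j _ => (hU j).mul (hφ.sm.pd j)
  have Gsm : Sm G := ContDiff.sum fun i _ => ContDiff.sum fun j _ =>
    (hF i j).mul ((hφ.sm.pd j).pd i)
  have gsm : ∀ i, Sm (g i) := fun i => ContDiff.sum fun j _ => (hF i j).mul (hφ.sm.pd j)
  have fsu : Supp R f := Supp.sum fun j _ => (hφs.pd j).mul_right _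
  have Gsu : Supp R G := Supp.sum fun i _ => Supp.sum fun j _ => ((hφs.pd j).pd i).mul_right _
  have gsu : ∀ i, Supp R (g i) := fun i => Supp.sum fun j _ => (hφs.pd j).mul_right _
  have gdiv : ∀ x, ∑ i, pd i (g i) x = f x + G x := by
    intro x
    have e : ∀ i, pd i (g i) x = ∑ j, (pd i (F i j) x * pd j φ x + F i j x * pd i (pd j φ) x) := by
      intro i
      rw [hg, pd_sum fun j _ => ((hF i j).mul (hφ.sm.pd j)).diff x]
      exact Finset.sum_congr rfl fun j _ => pd_mul ((hF i j).diff x) ((hφ.sm.pd j).diff x) i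
    simp only [e, Finset.sum_add_distrib, hf, hG, ← hFU, Finset.sum_mul]
    rw [Finset.sum_comm]
  have hint_div : ∀ {v : Fin 3 → E3 → ℝ}, (∀ i, Sm (v i)) → (∀ i, Supp R (v i)) →
      ∫ x, ∑ i, pd i (v i) x = 0 := by
    intro v hv hvs
    rw [integral_finsetSum _ fun i _ => ((hvs i).pd i).integrable ((hv i).pd i).continuous]
    exact Finset.sum_eq_zero fun i _ => integral_pd_eq_zero (hv i).one (hvs i) i
  have fint : ∫ x, f x = 0 := by
    have e : f = fun x => ∑ j, pd j (fun y => U j y * φ y) x := by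
      funext x
      have : ∀ j, pd j (fun y => U j y * φ y) x = pd j (U j) x * φ x + U j x * pd j φ x :=
        fun j => pd_mul ((hU j).diff x) (hφ.sm.diff x) j
      simp only [this, Finset.sum_add_distrib, ← Finset.sum_mul, hUd, zero_mul, zero_add, hf]
    rw [e]
    exact hint_div (fun j => (hU j).mul hφ.sm) fun j => hφs.mul_right _
  have Gint : ∫ x, G x = 0 := by
    have h1 := hint_div gsm gsu
    simp only [gdiv] at h1
    rw [integral_add (fsu.integrable fsm.continuous) (Gsu.integrable Gsm.continuous), fint] at h1
    linarith
  obtain ⟨B, Bsm, Bsu, Bdiv, Bp⟩ := hB R hR G Gsm Gsu Gint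
  have zdiv : ∀ x, ∑ i, pd i (fun y => g i y - B i y) x = f x := by
    intro x
    have : ∀ i, pd i (fun y => g i y - B i y) x = pd i (g i) x - pd i (B i) x :=
      fun i => pd_sub ((gsm i).diff x) ((Bsm i).diff x) i
    simp only [this, Finset.sum_sub_distrib, gdiv, Bdiv]
    ring
  obtain ⟨z₁, z₂, h1, h2, h3, h4, h5, h6, h7, h8⟩ := exists_regularized_split hδ fsm fsu
    (fun i => (gsm i).sub (Bsm i)) (fun i => (gsu i).sub (Bsu i)) zdiv
  have hcd : 0 ≤ c / d := by positivity
  have key : ∀ i, ∀ p : ℝ, 1 ≤ p → ∫ x, |g i x - B i x| ^ p ≤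
      (36 * CB * c * (L / d ^ 2)) ^ p * ∑ i, ∑ j, ∫ x in cube R, |F i j x| ^ p := by
    intro i p hp
    have hp0 : 0 < p := by linarith
    have hFi : ∀ i j, IntegrableOn (fun x => |F i j x| ^ p) (cube R) := fun i j =>
      integrableOn_cube ((hF i j).continuous.abs.rpow_const fun _ => Or.inr hp0.le) R
    set Sg : E3 → ℝ := fun x => ∑ i, ∑ j, |F i j x| ^ p with hSg
    have Sgi : IntegrableOn Sg (cube R) :=
      integrable_finsetSum _ fun i _ => integrable_finsetSum _ fun j _ => hFi i j
    have Sgint : ∫ x in cube R, Sg x = ∑ i, ∑ j, ∫ x in cube R, |F i j x| ^ p := by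
      rw [hSg, integral_finsetSum _ fun i _ => integrable_finsetSum _ fun j _ => hFi i j]
      exact Finset.sum_congr rfl fun i _ => integral_finsetSum _ fun j _ => hFi i j
    have Sg0 : ∀ x, 0 ≤ Sg x := fun x => by positivity
    have sum9 : ∀ x, (∑ q : Fin 3 × Fin 3, |F q.1 q.2 x|) ^ p ≤ 9 ^ p * Sg x := by
      intro x
      have h := Real.rpow_sum_le_const_mul_sum_rpow_of_nonneg (s := Finset.univ)
        (f := fun q : Fin 3 × Fin 3 => |F q.1 q.2 x|) hp fun q _ => abs_nonneg _
      refine h.trans ?_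
      have e : ∑ q : Fin 3 × Fin 3, |F q.1 q.2 x| ^ p = Sg x := by
        rw [hSg, Fintype.sum_prod_type]
      rw [e]
      refine mul_le_mul_of_nonneg_right ?_ (Sg0 x)
      have : ((Finset.univ : Finset (Fin 3 × Fin 3)).card : ℝ) = 9 := by
        norm_num
      rw [this]
      exact Real.rpow_le_rpow_of_exponent_le (by norm_num) (by linarith)
    have gen : ∀ (h : E3 → ℝ) (m : ℝ), Continuous h → Supp R h → 0 ≤ m →
        (∀ x, |h x| ≤ m * ∑ q : Fin 3 × Fin 3, |F q.1 q.2 x|) →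
        ∫ x, |h x| ^ p ≤ (9 * m) ^ p * ∫ x in cube R, Sg x := by
      intro h m hh hhs hm hb
      have hsp : Supp R fun x => |h x| ^ p := fun x hx => by
        simp [hhs x hx, Real.zero_rpow hp0.ne']
      rw [← hsp.integral_eq, ← integral_const_mul]
      refine integral_mono (integrableOn_cube (hh.abs.rpow_const fun _ => Or.inr hp0.le) R)
        (Sgi.const_mul _) fun x => ?_
      calc |h x| ^ p ≤ (m * ∑ q : Fin 3 × Fin 3, |F q.1 q.2 x|) ^ p :=
            Real.rpow_le_rpow (abs_nonneg _) (hb x) hp0.le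
        _ = m ^ p * (∑ q : Fin 3 × Fin 3, |F q.1 q.2 x|) ^ p :=
            Real.mul_rpow hm (by positivity)
        _ ≤ m ^ p * (9 ^ p * Sg x) := by gcongr; exact sum9 x
        _ = _ := by rw [Real.mul_rpow (by norm_num) hm]; ring
    have hg_b : ∀ x, |g i x| ≤ (c / d) * ∑ q : Fin 3 × Fin 3, |F q.1 q.2 x| := by
      intro x
      calc |g i x| ≤ ∑ j, |F i j x * pd j φ x| := Finset.abs_sum_le_sum_abs _ _
        _ ≤ ∑ j, (c / d) * |F i j x| := by
            refine Finset.sum_le_sum fun j _ => ?_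
            rw [abs_mul, mul_comm]
            exact mul_le_mul_of_nonneg_right (hφ.one j x) (abs_nonneg _)
        _ = (c / d) * ∑ j, |F i j x| := by rw [Finset.mul_sum]
        _ ≤ _ := by
            refine mul_le_mul_of_nonneg_left ?_ hcd
            rw [Fintype.sum_prod_type]
            exact Finset.single_le_sum (f := fun i => ∑ j, |F i j x|)
              (fun i _ => by positivity) (Finset.mem_univ i)
    have hG_b : ∀ x, |G x| ≤ (c / d ^ 2) * ∑ q : Fin 3 × Fin 3, |F q.1 q.2 x| := by
      intro x
      rw [Fintype.sum_prod_type, Finset.mul_sum]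
      refine (Finset.abs_sum_le_sum_abs _ _).trans (Finset.sum_le_sum fun i _ => ?_)
      rw [Finset.mul_sum]
      refine (Finset.abs_sum_le_sum_abs _ _).trans (Finset.sum_le_sum fun j _ => ?_)
      rw [abs_mul, mul_comm]
      exact mul_le_mul_of_nonneg_right (hφ.two i j x) (abs_nonneg _)
    have i1 := gen (g i) (c / d) (gsm i).continuous (gsu i) hcd hg_b
    have i2 := gen G (c / d ^ 2) Gsm.continuous Gsu (by positivity) hG_b
    have i3 := Bp i p hp
    have gi : Integrable fun x => |g i x| ^ p :=
      Supp.integrable (R := R) (fun x hx => by simp [gsu i x hx, Real.zero_rpow hp0.ne'])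
        ((gsm i).continuous.abs.rpow_const fun _ => Or.inr hp0.le)
    have Bi : Integrable fun x => |B i x| ^ p :=
      Supp.integrable (R := R) (fun x hx => by simp [Bsu i x hx, Real.zero_rpow hp0.ne'])
        ((Bsm i).continuous.abs.rpow_const fun _ => Or.inr hp0.le)
    have hSI : 0 ≤ ∫ x in cube R, Sg x := integral_nonneg Sg0
    have two : ∀ a b : ℝ, 0 ≤ a → 0 ≤ b → (a + b) ^ p ≤ 2 ^ (p - 1) * (a ^ p + b ^ p) :=
      fun a b ha hb => by
        have := Real.rpow_sum_le_const_mul_sum_rpow_of_nonneg (s := Finset.univ) (f := ![a, b]) hp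
          fun q _ => by fin_cases q <;> simpa
        simpa [Fin.sum_univ_two] using this
    have hm1 : c / d ≤ CB * c * (L / d ^ 2) := by
      have : 1 ≤ L / d := by rw [le_div_iff₀ hd]; linarith
      calc c / d = 1 * (c / d) * 1 := by ring
        _ ≤ CB * (c / d) * (L / d) := by gcongr
        _ = _ := by field_simp
    have hm2 : CB * R * (9 * (c / d ^ 2)) ≤ 9 * (CB * c * (L / d ^ 2)) := by
      calc CB * R * (9 * (c / d ^ 2)) ≤ CB * L * (9 * (c / d ^ 2)) := by gcongr
        _ = _ := by ring
    have hm0 : 0 ≤ CB * c * (L / d ^ 2) := by positivity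
    rw [← Sgint]
    calc ∫ x, |g i x - B i x| ^ p
        ≤ ∫ x, 2 ^ (p - 1) * (|g i x| ^ p + |B i x| ^ p) := by
          refine integral_mono_of_nonneg (Eventually.of_forall fun x => by positivity)
            ((gi.add Bi).const_mul _) (Eventually.of_forall fun x => ?_)
          exact (Real.rpow_le_rpow (abs_nonneg _) (abs_sub _ _) hp0.le).trans
            (two _ _ (abs_nonneg _) (abs_nonneg _))
      _ = 2 ^ (p - 1) * ((∫ x, |g i x| ^ p) + ∫ x, |B i x| ^ p) := by
          rw [integral_const_mul, integral_add gi Bi]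
      _ ≤ 2 ^ (p - 1) * ((9 * (CB * c * (L / d ^ 2))) ^ p * (∫ x in cube R, Sg x)
            + (9 * (CB * c * (L / d ^ 2))) ^ p * (∫ x in cube R, Sg x)) := by
          gcongr
          · refine i1.trans ?_
            gcongr
          · refine i3.trans ((mul_le_mul_of_nonneg_left i2 (by positivity)).trans ?_)
            rw [← mul_assoc, ← Real.mul_rpow (by positivity) (by positivity)]
            gcongr
      _ = (2 ^ (p - 1) * 2) * (9 * (CB * c * (L / d ^ 2))) ^ p * (∫ x in cube R, Sg x) := by
          ring
      _ = (18 * (CB * c * (L / d ^ 2))) ^ p * (∫ x in cube R, Sg x) := by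
          rw [Real.rpow_sub_one two_ne_zero, div_mul_cancel₀ _ two_ne_zero,
            ← Real.mul_rpow (by norm_num) (by positivity)]
          ring_nf
      _ ≤ _ := by
          refine mul_le_mul_of_nonneg_right ?_ hSI
          refine Real.rpow_le_rpow (by positivity) ?_ hp0.le
          linarith
  refine ⟨z₁, z₂, h1, h2, h3, h4, h5, fun i p hp => (h6 i p hp).trans (key i p hp),
    fun i k => (h7 i k).trans ?_, fun i k => (h8 i k).trans ?_⟩
  · refine mul_le_mul_of_nonneg_left ?_ (by positivity)
    have := key i 2 (by norm_num)
    simpa only [Real.rpow_two, sq_abs] using this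
  · refine mul_le_mul_of_nonneg_left ?_ (by positivity)
    have hsq : Supp R fun x => pd k f x ^ 2 := fun x hx => by simp [fsu.pd k x hx]
    rw [← hsq.integral_eq]
    have ia : ∀ j, IntegrableOn (fun x => pd k (U j) x ^ 2) (cube R) := fun j =>
      integrableOn_cube (((hU j).pd k).continuous.pow 2) R
    have ib : ∀ j, IntegrableOn (fun x => U j x ^ 2) (cube R) := fun j =>
      integrableOn_cube ((hU j).continuous.pow 2) R
    calc ∫ x in cube R, pd k f x ^ 2
        ≤ ∫ x in cube R, ((∑ j, 6 * c ^ 2 * (d⁻¹) ^ 2 * pd k (U j) x ^ 2) +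
            ∑ j, 6 * c ^ 2 * (d⁻¹) ^ 4 * U j x ^ 2) := by
          refine integral_mono (integrableOn_cube ((fsm.pd k).continuous.pow 2) R)
            ((integrable_finsetSum _ fun j _ => (ia j).const_mul _).add
              (integrable_finsetSum _ fun j _ => (ib j).const_mul _)) fun x => ?_
          have e : pd k f x = ∑ j, (pd k (U j) x * pd j φ x + U j x * pd k (pd j φ) x) := by
            rw [hf, pd_sum fun j _ => ((hU j).mul (hφ.sm.pd j)).diff x]
            exact Finset.sum_congr rfl fun j _ => pd_mul ((hU j).diff x) ((hφ.sm.pd j).diff x) k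
          have b1 : ∀ j, (pd k (U j) x * pd j φ x) ^ 2 ≤ c ^ 2 * (d⁻¹) ^ 2 * pd k (U j) x ^ 2 := by
            intro j
            have : pd j φ x ^ 2 ≤ (c / d) ^ 2 := sq_le_sq' (abs_le.1 (hφ.one j x)).1
              (abs_le.1 (hφ.one j x)).2
            calc _ = pd j φ x ^ 2 * pd k (U j) x ^ 2 := by ring
              _ ≤ (c / d) ^ 2 * pd k (U j) x ^ 2 := by gcongr
              _ = _ := by rw [div_eq_mul_inv]; ring
          have b2 : ∀ j, (U j x * pd k (pd j φ) x) ^ 2 ≤ c ^ 2 * (d⁻¹) ^ 4 * U j x ^ 2 := by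
            intro j
            have : pd k (pd j φ) x ^ 2 ≤ (c / d ^ 2) ^ 2 := sq_le_sq' (abs_le.1 (hφ.two k j x)).1
              (abs_le.1 (hφ.two k j x)).2
            calc _ = pd k (pd j φ) x ^ 2 * U j x ^ 2 := by ring
              _ ≤ (c / d ^ 2) ^ 2 * U j x ^ 2 := by gcongr
              _ = _ := by rw [div_eq_mul_inv]; ring
          have s6 : ∀ a b e a' b' e' : ℝ, (a + a' + (b + b') + (e + e')) ^ 2 ≤
              6 * (a ^ 2 + b ^ 2 + e ^ 2) + 6 * (a' ^ 2 + b' ^ 2 + e' ^ 2) := by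
            intro a b e a' b' e'
            nlinarith [sq_nonneg (a - b), sq_nonneg (a - e), sq_nonneg (b - e), sq_nonneg (a - a'),
              sq_nonneg (a - b'), sq_nonneg (a - e'), sq_nonneg (b - a'), sq_nonneg (b - b'),
              sq_nonneg (b - e'), sq_nonneg (e - a'), sq_nonneg (e - b'), sq_nonneg (e - e'),
              sq_nonneg (a' - b'), sq_nonneg (a' - e'), sq_nonneg (b' - e')]
          simp only [e, Fin.sum_univ_three]
          refine (s6 _ _ _ _ _ _).trans ?_
          linarith [b1 0, b1 1, b1 2, b2 0, b2 1, b2 2]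
      _ = _ := by
          rw [integral_add (integrable_finsetSum _ fun j _ => (ia j).const_mul _)
              (integrable_finsetSum _ fun j _ => (ib j).const_mul _),
            integral_finsetSum _ fun j _ => (ia j).const_mul _,
            integral_finsetSum _ fun j _ => (ib j).const_mul _, Finset.mul_sum, Finset.mul_sum]
          simp only [integral_const_mul, mul_assoc]

/-! ### Integral inequalities on cubes -/

theorem exists_volume_cube_le : ∃ V : ℝ, 0 ≤ V ∧ ∀ R L : ℝ, 0 ≤ L → R ≤ L →
    volume.real (cube R) ≤ V * L ^ 3 := by
  refine ⟨volume.real (ball (0 : E3) 3), measureReal_nonneg, fun R L hL hR => ?_⟩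
  rcases hL.eq_or_lt with h | h
  · subst h
    have hle : volume (cube R) ≤ volume (cube 0) := measure_mono (cube_mono hR)
    have h0 : cube 0 ⊆ {(0 : E3)} := fun x hx => by
      ext i
      exact abs_nonpos_iff.1 (hx i)
    have : volume (cube R) = 0 :=
      le_antisymm (hle.trans ((measure_mono h0).trans (by simp))) bot_le
    simp [Measure.real, this]
  · have e : volume.real (ball (0 : E3) (L * 3)) = L ^ 3 * volume.real (ball (0 : E3) 3) := by
      rw [Measure.real, Measure.addHaar_ball_mul _ _ hL]
      simp [Measure.real, ENNReal.toReal_mul, hL]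
    calc volume.real (cube R) ≤ volume.real (ball (0 : E3) (L * 3)) := by
          refine measureReal_mono ?_ measure_ball_lt_top.ne
          exact (cube_mono hR).trans (cube_subset_ball hL (by linarith))
      _ = _ := by rw [e, mul_comm]

theorem setIntegral_le_of_flux {R : ℝ} {v : Fin 3 → E3 → ℝ} (hv : ∀ i, ContDiff ℝ 1 (v i))
    (hs : ∀ i, Supp R (v i)) {g h : E3 → ℝ} (hg : Continuous g) (hh : Continuous h)
    (hle : ∀ x ∈ cube R, g x ≤ h x + ∑ i, pd i (v i) x) :
    ∫ x in cube R, g x ≤ ∫ x in cube R, h x := by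
  have hc : Continuous fun x => ∑ i, pd i (v i) x :=
    continuous_finsetSum _ fun i _ => continuous_pd (hv i) i
  have h0 : ∫ x in cube R, ∑ i, pd i (v i) x = 0 := by
    rw [integral_finsetSum _ fun i _ => integrableOn_cube (continuous_pd (hv i) i) R]
    refine Finset.sum_eq_zero fun i _ => ?_
    rw [((hs i).pd i).integral_eq]
    exact integral_pd_eq_zero (hv i) (hs i) i
  calc ∫ x in cube R, g x ≤ ∫ x in cube R, (h x + ∑ i, pd i (v i) x) :=
        setIntegral_mono_on (integrableOn_cube hg R) (integrableOn_cube (hh.add hc) R)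
          (measurableSet_cube R) hle
    _ = _ := by rw [integral_add (integrableOn_cube hh R) (integrableOn_cube hc R), h0, add_zero]

theorem setIntegral_cube_mono {r R : ℝ} (h : r ≤ R) {f : E3 → ℝ} (hf : Continuous f)
    (h0 : ∀ x, 0 ≤ f x) : ∫ x in cube r, f x ≤ ∫ x in cube R, f x :=
  setIntegral_mono_set (integrableOn_cube hf R) (Eventually.of_forall h0)
    (cube_mono h).eventuallyLE

/-- Enlarging the domain when the larger integrand dominates on the smaller cube. -/
theorem setIntegral_cube_le {r R : ℝ} (h : r ≤ R) {f g : E3 → ℝ} (hf : Continuous f)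
    (hg : Continuous g) (h0 : ∀ x, 0 ≤ g x) (hfg : ∀ x ∈ cube r, f x ≤ g x) :
    ∫ x in cube r, f x ≤ ∫ x in cube R, g x :=
  (setIntegral_mono_on (integrableOn_cube hf r) (integrableOn_cube hg r)
    (measurableSet_cube r) hfg).trans (setIntegral_cube_mono h hg h0)

theorem mul_le_weighted {t : ℝ} (ht : 0 < t) {a : ℝ} (ha : |a| ≤ 1) (x y : ℝ) :
    a * (x * y) ≤ t / 2 * x ^ 2 + (2 * t)⁻¹ * y ^ 2 := by
  have h1 : a * (x * y) ≤ |x| * |y| := by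
    refine (le_abs_self _).trans ?_
    rw [abs_mul, abs_mul]
    exact mul_le_of_le_one_left (by positivity) ha
  have h2 : t / 2 * x ^ 2 + (2 * t)⁻¹ * y ^ 2 - |x| * |y| = (t * |x| - |y|) ^ 2 / (2 * t) := by
    rw [← sq_abs x, ← sq_abs y]
    field_simp
    ring
  have h3 : 0 ≤ (t * |x| - |y|) ^ 2 / (2 * t) := by positivity
  linarith

theorem rpow_le_split {p s T y : ℝ} (hp : 0 ≤ p) (hps : p ≤ s) (hT : 0 < T) (hy : 0 ≤ y) :
    y ^ p ≤ T ^ p + T ^ (p - s) * y ^ s := by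
  rcases le_total y T with h | h
  · have := Real.rpow_le_rpow hy h hp
    have : 0 ≤ T ^ (p - s) * y ^ s := by positivity
    linarith
  · have hy' : 0 < y := hT.trans_le h
    have h1 : y ^ (p - s) ≤ T ^ (p - s) := Real.rpow_le_rpow_of_nonpos hT h (by linarith)
    have h2 : y ^ p = y ^ (p - s) * y ^ s := by rw [← Real.rpow_add hy']; ring_nf
    have : 0 ≤ T ^ p := by positivity
    rw [h2]
    have := mul_le_mul_of_nonneg_right h1 (Real.rpow_nonneg hy s)
    linarith

/-- A function `f` with potential `F` on the cube of half side `R ≤ L`: `F` obeys the growth bound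
at scale `L` and the gradient of `f` has energy at most `E`. -/
structure LocalData (s A L d R E : ℝ) (f : E3 → ℝ) (F : Fin 3 → E3 → ℝ) : Prop where
  one_le_L : 1 ≤ L
  d_pos : 0 < d
  d_le : d ≤ L
  R_le : R ≤ L
  one_le_E : 1 ≤ E
  sm : Sm f
  smF : ∀ i, Sm (F i)
  div : ∀ x, ∑ i, pd i (F i) x = f x
  pot : ∀ i, ∫ x in cube R, |F i x| ^ s ≤ A * L ^ (s / 3 + 2)
  energy : ∀ i, ∫ x in cube R, pd i f x ^ 2 ≤ E

theorem LocalData.mono {s A L d R E : ℝ} {f : E3 → ℝ} {F : Fin 3 → E3 → ℝ} (hs : 0 ≤ s)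
    (h : LocalData s A L d R E f F) {r : ℝ} (hr : r ≤ R) : LocalData s A L d r E f F where
  __ := h
  R_le := hr.trans h.R_le
  pot i := (setIntegral_cube_mono hr ((h.smF i).continuous.abs.rpow_const fun _ => Or.inr hs)
    fun _ => Real.rpow_nonneg (abs_nonneg _) _).trans (h.pot i)
  energy i := (setIntegral_cube_mono hr ((h.sm.pd i).continuous.pow 2)
    fun _ => sq_nonneg _).trans (h.energy i)

theorem LocalData.one_le_ratio {s A L d R E : ℝ} {f : E3 → ℝ} {F : Fin 3 → E3 → ℝ}
    (h : LocalData s A L d R E f F) : 1 ≤ L / d := (one_le_div h.d_pos).2 h.d_le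

theorem exists_potential_bound {s A : ℝ} (hs : 3 < s) (hs6 : s ≤ 6) (hA : 0 ≤ A) :
    ∃ C : ℝ, 1 ≤ C ∧ ∀ {L d R E : ℝ} {f : E3 → ℝ} {F : Fin 3 → E3 → ℝ},
      LocalData s A L d R E f F → ∀ i,
        (∫ x in cube R, F i x ^ 2 ≤ C * L ^ (10 / 3 : ℝ)) ∧
          ∫ x in cube R, |F i x| ^ 3 ≤ C * L ^ (4 : ℝ) := by
  obtain ⟨V, hV0, hV⟩ := exists_volume_cube_le
  refine ⟨1 + V + A, by linarith, fun {L d R E f F} h i => ?_⟩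
  have hL0 : 0 < L := by linarith [h.one_le_L]
  have main : ∀ p : ℝ, 0 ≤ p → p ≤ 3 → ∀ q : ℝ, p * (1 / 6) + 3 ≤ q →
      ∫ x in cube R, |F i x| ^ p ≤ (1 + V + A) * L ^ q := by
    intro p hp0 hp3 q hq
    set T := L ^ (1 / 3 - 1 / s) with hT
    have hT0 : 0 < T := by positivity
    have i1 : IntegrableOn (fun x => |F i x| ^ s) (cube R) :=
      integrableOn_cube ((h.smF i).continuous.abs.rpow_const fun _ => Or.inr (by linarith)) R
    have i0 : IntegrableOn (fun _ : E3 => T ^ p) (cube R) := integrableOn_cube continuous_const R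
    have e1 : T ^ (p - s) * L ^ (s / 3 + 2) = L ^ (p * (1 / 3 - 1 / s) + 3) := by
      rw [hT, ← Real.rpow_mul hL0.le, ← Real.rpow_add hL0]
      congr 1
      field_simp
      ring
    have e2 : T ^ p * L ^ (3 : ℕ) = L ^ (p * (1 / 3 - 1 / s) + 3) := by
      rw [hT, ← Real.rpow_mul hL0.le, ← Real.rpow_natCast, ← Real.rpow_add hL0]
      congr 1
      push_cast
      ring
    have hs' : 1 / 6 ≤ 1 / s := one_div_le_one_div_of_le (by linarith) hs6
    have hexp : L ^ (p * (1 / 3 - 1 / s) + 3) ≤ L ^ q :=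
      Real.rpow_le_rpow_of_exponent_le h.one_le_L (by nlinarith)
    calc ∫ x in cube R, |F i x| ^ p
        ≤ ∫ x in cube R, (T ^ p + T ^ (p - s) * |F i x| ^ s) :=
          integral_mono (integrableOn_cube ((h.smF i).continuous.abs.rpow_const
            fun _ => Or.inr hp0) R) (i0.add (i1.const_mul _))
            fun x => rpow_le_split hp0 (by linarith) hT0 (abs_nonneg _)
      _ = volume.real (cube R) * T ^ p + T ^ (p - s) * ∫ x in cube R, |F i x| ^ s := by
          rw [integral_add i0 (i1.const_mul _), integral_const_mul, setIntegral_const, smul_eq_mul]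
      _ ≤ (V * L ^ 3) * T ^ p + T ^ (p - s) * (A * L ^ (s / 3 + 2)) := by
          gcongr
          · exact hV R L hL0.le h.R_le
          · exact h.pot i
      _ = (V + A) * L ^ (p * (1 / 3 - 1 / s) + 3) := by
          rw [mul_assoc, mul_comm (L ^ 3), e2, mul_left_comm, e1]; ring
      _ ≤ _ := by gcongr; linarith
  constructor
  · have := main 2 (by norm_num) (by norm_num) (10 / 3) (by norm_num)
    simpa only [Real.rpow_two, sq_abs] using this
  · have := main 3 (by norm_num) le_rfl 4 (by norm_num)
    simpa only [show (3 : ℝ) = ((3 : ℕ) : ℝ) by norm_num, Real.rpow_natCast] using this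

/-! ### The quadratic bound -/

theorem exists_quadratic_bound {s A : ℝ} (hs : 3 < s) (hs6 : s ≤ 6) (hA : 0 ≤ A) :
    ∃ C : ℝ, 1 ≤ C ∧ ∀ {L d R E : ℝ} {f : E3 → ℝ} {F : Fin 3 → E3 → ℝ},
      LocalData s A L d R E f F →
        ∫ x in cube (R - d), f x ^ 2 ≤ C * (L / d) ^ 2 * (L ^ (5 / 3 : ℝ) * E ^ (1 / 2 : ℝ)) := by
  obtain ⟨C, hC, hpot⟩ := exists_potential_bound hs hs6 hA
  obtain ⟨c, hc, hcut⟩ := exists_cutoff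
  refine ⟨3 * (1 + 12 * c ^ 2) * C + 3, by nlinarith [sq_nonneg c], fun {L d R E f F} h => ?_⟩
  obtain ⟨φ, φb, φ0, φ1, φs, φe⟩ := hcut R d h.d_pos
  have hd := h.d_pos
  have hL0 : 0 < L := by linarith [h.one_le_L]
  have hE0 : 0 < E := by linarith [h.one_le_E]
  set t : ℝ := E ^ (1 / 2 : ℝ) * L ^ (-(5 / 3) : ℝ) with ht
  have ht0 : 0 < t := by positivity
  have φsm := φb.sm
  have φφ : Sm fun x => φ x * φ x := φsm.mul φsm
  have fd := h.sm.diff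
  have hsm2 : ∀ i, Sm fun x => φ x * φ x * f x * F i x := fun i => (φφ.mul h.sm).mul (h.smF i)
  have hpd : ∀ i x, pd i (fun x => φ x * φ x * f x * F i x) x =
      2 * (φ x * f x * (F i x * pd i φ x)) + φ x ^ 2 * (F i x * pd i f x) +
        φ x ^ 2 * f x * pd i (F i) x := by
    intro i x
    rw [pd_mul ((φφ.mul h.sm).diff x) ((h.smF i).diff x), pd_mul (φφ.diff x) (fd x),
      pd_mul (φsm.diff x) (φsm.diff x)]
    ring
  have hFc : ∀ i, Continuous fun x => F i x ^ 2 := fun i => (h.smF i).continuous.pow 2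
  have hfc : ∀ i, Continuous fun x => pd i f x ^ 2 := fun i => (h.sm.pd i).continuous.pow 2
  have key := setIntegral_le_of_flux (R := R) (v := fun i x => φ x * φ x * f x * F i x)
    (g := fun x => 1 / 2 * (φ x ^ 2 * f x ^ 2))
    (h := fun x => (t / 2 + 6 * (c / d) ^ 2) * (∑ i, F i x ^ 2) + (2 * t)⁻¹ * ∑ i, pd i f x ^ 2)
    (fun i => (hsm2 i).one)
    (fun i => ((φs.mul_left _).mul_left _).mul_left _)
    (continuous_const.mul ((φsm.continuous.pow 2).mul (h.sm.continuous.pow 2)))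
    ((continuous_const.mul (continuous_finsetSum _ fun i _ => hFc i)).add
      (continuous_const.mul (continuous_finsetSum _ fun i _ => hfc i)))
    (by
      intro x _
      have a1 : |-(φ x ^ 2)| ≤ 1 := by
        rw [abs_neg, abs_of_nonneg (sq_nonneg _)]
        exact pow_le_one₀ (φ0 x) (φ1 x)
      have b1 := fun i => mul_le_weighted ht0 a1 (F i x) (pd i f x)
      have b2 : ∀ i, -(2 * (φ x * f x * (F i x * pd i φ x))) ≤
          1 / 6 * (φ x ^ 2 * f x ^ 2) + 6 * (c / d) ^ 2 * F i x ^ 2 := by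
        intro i
        have h1 : pd i φ x ^ 2 ≤ (c / d) ^ 2 := sq_le_sq' (abs_le.1 (φb.one i x)).1
          (abs_le.1 (φb.one i x)).2
        have h2 := mul_le_mul_of_nonneg_right h1 (sq_nonneg (F i x))
        nlinarith [sq_nonneg (φ x * f x + 6 * (F i x * pd i φ x))]
      have hdiv := h.div x
      simp only [hpd]
      simp only [Fin.sum_univ_three] at hdiv ⊢
      have e : φ x ^ 2 * f x * pd 0 (F 0) x + φ x ^ 2 * f x * pd 1 (F 1) x +
          φ x ^ 2 * f x * pd 2 (F 2) x = φ x ^ 2 * f x ^ 2 := by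
        rw [← mul_add, ← mul_add, hdiv]; ring
      linarith [b1 0, b1 1, b1 2, b2 0, b2 1, b2 2])
  have e1 : ∫ x in cube R, ((t / 2 + 6 * (c / d) ^ 2) * (∑ i, F i x ^ 2) +
      (2 * t)⁻¹ * ∑ i, pd i f x ^ 2) = (t / 2 + 6 * (c / d) ^ 2) *
        (∑ i, ∫ x in cube R, F i x ^ 2) + (2 * t)⁻¹ * ∑ i, ∫ x in cube R, pd i f x ^ 2 := by
    rw [integral_add, integral_const_mul, integral_const_mul,
      integral_finsetSum _ fun i _ => integrableOn_cube (hFc i) R,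
      integral_finsetSum _ fun i _ => integrableOn_cube (hfc i) R]
    · exact (integrable_finsetSum _ fun i _ => integrableOn_cube (hFc i) R).const_mul _
    · exact (integrable_finsetSum _ fun i _ => integrableOn_cube (hfc i) R).const_mul _
  have e2 : ∫ x in cube (R - d), f x ^ 2 ≤ 2 * ∫ x in cube R, 1 / 2 * (φ x ^ 2 * f x ^ 2) := by
    rw [← integral_const_mul]
    refine setIntegral_cube_le (by linarith) (h.sm.continuous.pow 2)
      (continuous_const.mul (continuous_const.mul
        ((φsm.continuous.pow 2).mul (h.sm.continuous.pow 2))))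
      (fun x => by positivity) fun x hx => ?_
    rw [φe x hx]; linarith
  have s1 : ∑ i, ∫ x in cube R, F i x ^ 2 ≤ 3 * (C * L ^ (10 / 3 : ℝ)) :=
    (Finset.sum_le_card_nsmul _ _ _ fun i _ => (hpot h i).1).trans (by simp)
  have s2 : ∑ i, ∫ x in cube R, pd i f x ^ 2 ≤ 3 * E :=
    (Finset.sum_le_card_nsmul _ _ _ fun i _ => h.energy i).trans (by simp)
  have hκ := h.one_le_ratio
  have hκ2 : 1 ≤ (L / d) ^ 2 := one_le_pow₀ hκ
  set G := L ^ (5 / 3 : ℝ) * E ^ (1 / 2 : ℝ) with hG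
  have p1 : t * L ^ (10 / 3 : ℝ) = G := by
    rw [ht, hG, mul_assoc, ← Real.rpow_add hL0]; norm_num; ring
  have p2 : t⁻¹ * E = G := by
    rw [ht, hG, mul_inv, ← Real.rpow_neg hE0.le, ← Real.rpow_neg hL0.le]
    nth_rewrite 2 [← Real.rpow_one E]
    rw [mul_right_comm, ← Real.rpow_add hE0]; norm_num; ring
  have p3 : (1 / d) ^ 2 * L ^ (10 / 3 : ℝ) ≤ (L / d) ^ 2 * G := by
    have : L ^ (10 / 3 : ℝ) ≤ L ^ 2 * G := by
      rw [hG, ← mul_assoc, ← Real.rpow_natCast, ← Real.rpow_add hL0]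
      calc L ^ (10 / 3 : ℝ) ≤ L ^ (((2 : ℕ) : ℝ) + 5 / 3) * 1 := by
            rw [mul_one]
            exact Real.rpow_le_rpow_of_exponent_le h.one_le_L (by norm_num)
        _ ≤ _ := by
            gcongr
            exact Real.one_le_rpow h.one_le_E (by norm_num)
    calc (1 / d) ^ 2 * L ^ (10 / 3 : ℝ) ≤ (1 / d) ^ 2 * (L ^ 2 * G) := by gcongr
      _ = _ := by ring
  have hG0 : 0 ≤ G := by positivity
  have hGκ : G ≤ (L / d) ^ 2 * G := le_mul_of_one_le_left hG0 hκ2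
  calc ∫ x in cube (R - d), f x ^ 2 ≤ 2 * ((t / 2 + 6 * (c / d) ^ 2) *
        (∑ i, ∫ x in cube R, F i x ^ 2) + (2 * t)⁻¹ * ∑ i, ∫ x in cube R, pd i f x ^ 2) := by
        linarith
    _ ≤ 2 * ((t / 2 + 6 * (c / d) ^ 2) * (3 * (C * L ^ (10 / 3 : ℝ))) + (2 * t)⁻¹ * (3 * E)) := by
        gcongr
    _ = 3 * C * (t * L ^ (10 / 3 : ℝ)) + 36 * c ^ 2 * C * ((1 / d) ^ 2 * L ^ (10 / 3 : ℝ)) +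
        3 * (t⁻¹ * E) := by field_simp; ring
    _ ≤ 3 * C * ((L / d) ^ 2 * G) + 36 * c ^ 2 * C * ((L / d) ^ 2 * G) +
        3 * ((L / d) ^ 2 * G) := by
        rw [p1, p2]; gcongr
    _ = _ := by ring

/-! ### The Sobolev inequality and the sixth power bound -/

theorem norm_fderiv_sq_le (g : E3 → ℝ) (x : E3) : ‖fderiv ℝ g x‖ ^ 2 ≤ ∑ i, pd i g x ^ 2 := by
  have h : ‖fderiv ℝ g x‖ ≤ √(∑ i, pd i g x ^ 2) := by
    refine ContinuousLinearMap.opNorm_le_bound _ (Real.sqrt_nonneg _) fun v => ?_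
    have hv : v = ∑ i, v i • bv i := by
      ext k
      simp [Finset.sum_apply, Pi.single_apply]
    have e : fderiv ℝ g x v = ∑ i, pd i g x * v i := by
      conv_lhs => rw [hv]
      rw [map_sum]
      exact Finset.sum_congr rfl fun i _ => by rw [map_smul, smul_eq_mul, mul_comm]; rfl
    rw [e, EuclideanSpace.norm_eq, Real.norm_eq_abs]
    simp only [Real.norm_eq_abs, sq_abs]
    rw [← Real.sqrt_mul (by positivity)]
    exact Real.abs_le_sqrt (Finset.sum_mul_sq_le_sq_mul_sq _ _ _)
  calc ‖fderiv ℝ g x‖ ^ 2 ≤ √(∑ i, pd i g x ^ 2) ^ 2 := by gcongr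
    _ = _ := Real.sq_sqrt (by positivity)

theorem exists_sobolev : ∃ C : ℝ, 1 ≤ C ∧ ∀ {R : ℝ} {g : E3 → ℝ}, ContDiff ℝ 1 g → Supp R g →
    ∫ x, g x ^ 6 ≤ C * (∫ x, ∑ i, pd i g x ^ 2) ^ 3 := by
  set c : ℝ := (SNormLESNormFDerivOfEqConst ℝ (volume : Measure E3) (2 : NNReal) : ℝ) with hc
  have c0 : 0 ≤ c := NNReal.coe_nonneg _
  refine ⟨c ^ 6 + 1, by have := pow_nonneg c0 6; linarith, fun {R g} hg hs => ?_⟩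
  have hcs : HasCompactSupport g := hs.compact
  have h := eLpNorm_le_eLpNorm_fderiv_of_eq (μ := (volume : Measure E3)) hg hcs
    (p := 2) (p' := 6) (by norm_num) (by simp) (by simp; norm_num)
  have hfc : Continuous (fderiv ℝ g) := hg.continuous_fderiv (by norm_num)
  have m1 : MemLp g ((6 : NNReal) : ℝ≥0∞) volume := hg.continuous.memLp_of_hasCompactSupport hcs
  have m2 : MemLp (fderiv ℝ g) ((2 : NNReal) : ℝ≥0∞) volume :=
    hfc.memLp_of_hasCompactSupport (hcs.fderiv ℝ)
  rw [m1.eLpNorm_eq_integral_rpow_norm (by simp) (by simp),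
    m2.eLpNorm_eq_integral_rpow_norm (by simp) (by simp),
    ← ENNReal.ofReal_coe_nnreal
      (p := SNormLESNormFDerivOfEqConst ℝ (volume : Measure E3) (2 : NNReal)), ← ENNReal.ofReal_mul c0,
    ENNReal.ofReal_le_ofReal_iff (by positivity)] at h
  simp only [ENNReal.coe_toReal, NNReal.coe_ofNat, Real.norm_eq_abs] at h
  have hi : ∫ x, ‖fderiv ℝ g x‖ ^ (2 : ℝ) ≤ ∫ x, ∑ i, pd i g x ^ 2 := by
    simp only [Real.rpow_two]
    have hsq : Supp R fun x => ‖fderiv ℝ g x‖ ^ 2 := fun x hx => by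
      have := norm_fderiv_sq_le g x
      simp only [fun i => hs.pd i x hx] at this
      simp at this
      simp [this]
    refine integral_mono (hsq.integrable (hfc.norm.pow 2)) (integrable_finsetSum _ fun i _ => ?_) fun x => norm_fderiv_sq_le g x
    exact Supp.integrable (R := R) (fun x hx => by simp [hs.pd i x hx])
      ((continuous_pd hg i).pow 2)
  set I := ∫ x, ∑ i, pd i g x ^ 2
  set J := ∫ x, ‖fderiv ℝ g x‖ ^ (2 : ℝ)
  have J0 : 0 ≤ J := integral_nonneg fun x => by positivity
  have e6 : ∫ x, |g x| ^ (6 : ℝ) = ∫ x, g x ^ 6 := by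
    refine integral_congr_ae (Eventually.of_forall fun x => ?_)
    simp only [show (6 : ℝ) = ((6 : ℕ) : ℝ) by norm_num, Real.rpow_natCast]
    rw [(by decide : Even 6).pow_abs]
  rw [e6] at h
  have K0 : 0 ≤ ∫ x, g x ^ 6 := integral_nonneg fun x => by positivity
  set K := ∫ x, g x ^ 6
  have h6 := pow_le_pow_left₀ (by positivity) h 6
  rw [mul_pow, ← Real.rpow_natCast (K ^ _), ← Real.rpow_mul K0, ← Real.rpow_natCast (J ^ _),
    ← Real.rpow_mul J0] at h6
  have h3 : J ^ ((2 : ℝ)⁻¹ * ((6 : ℕ) : ℝ)) = J ^ 3 := by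
    rw [← Real.rpow_natCast J 3]; norm_num
  have h1 : K ^ ((6 : ℝ)⁻¹ * ((6 : ℕ) : ℝ)) = K := by norm_num
  rw [h1, h3] at h6
  calc K ≤ c ^ 6 * J ^ 3 := h6
    _ ≤ (c ^ 6 + 1) * I ^ 3 := by gcongr; linarith

theorem exists_sextic_bound {s A : ℝ} (hs : 3 < s) (hs6 : s ≤ 6) (hA : 0 ≤ A) :
    ∃ C : ℝ, 1 ≤ C ∧ ∀ {L d R E : ℝ} {f : E3 → ℝ} {F : Fin 3 → E3 → ℝ},
      LocalData s A L d R E f F →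
        ∫ x in cube (R - 2 * d), f x ^ 6 ≤ C * (L / d) ^ 12 * E ^ 3 := by
  obtain ⟨C, hC, hquad⟩ := exists_quadratic_bound hs hs6 hA
  obtain ⟨c, hc, hcut⟩ := exists_cutoff
  obtain ⟨S, hS, hsob⟩ := exists_sobolev
  refine ⟨S * (6 + 6 * c ^ 2 * C) ^ 3, ?_, fun {L d R E f F} h => ?_⟩
  · have h0 : 0 ≤ c ^ 2 * C := by positivity
    have : 1 ≤ (6 + 6 * c ^ 2 * C) ^ 3 := one_le_pow₀ (by linarith)
    exact one_le_mul_of_one_le_of_one_le hS this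
  obtain ⟨φ, φb, φ0, φ1, φs, φe⟩ := hcut (R - d) d h.d_pos
  have hd := h.d_pos
  have hL0 : 0 < L := by linarith [h.one_le_L]
  have hE0 : 0 < E := by linarith [h.one_le_E]
  have φsm := φb.sm
  have gsm : Sm fun x => φ x * f x := φsm.mul h.sm
  have gs : Supp (R - d) fun x => φ x * f x := φs.mul_left _
  have hκ := h.one_le_ratio
  set κ := L / d with hκd
  have hfc : ∀ i, Continuous fun x => pd i f x ^ 2 := fun i => (h.sm.pd i).continuous.pow 2
  have h2 := hquad h
  have hgrad : ∫ x, ∑ i, pd i (fun x => φ x * f x) x ^ 2 ≤ (6 + 6 * c ^ 2 * C) * (κ ^ 4 * E) := by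
    have hsupp : Supp (R - d) fun x => ∑ i, pd i (fun x => φ x * f x) x ^ 2 :=
      Supp.sum fun i _ => fun x hx => by simp [gs.pd i x hx]
    rw [← hsupp.integral_eq]
    have i1 : IntegrableOn (fun x => ∑ i, 2 * pd i f x ^ 2) (cube (R - d)) :=
      integrable_finsetSum _ fun i _ => (integrableOn_cube (hfc i) _).const_mul _
    have i2 : IntegrableOn (fun x => 6 * (c / d) ^ 2 * f x ^ 2) (cube (R - d)) :=
      (integrableOn_cube (h.sm.continuous.pow 2) _).const_mul _
    calc ∫ x in cube (R - d), ∑ i, pd i (fun x => φ x * f x) x ^ 2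
        ≤ ∫ x in cube (R - d), ((∑ i, 2 * pd i f x ^ 2) + 6 * (c / d) ^ 2 * f x ^ 2) := by
          refine integral_mono (integrableOn_cube (continuous_finsetSum _ fun i _ =>
            (gsm.pd i).continuous.pow 2) _) (i1.add i2) fun x => ?_
          have b : ∀ i, pd i (fun x => φ x * f x) x ^ 2 ≤
              2 * pd i f x ^ 2 + 2 * (c / d) ^ 2 * f x ^ 2 := by
            intro i
            rw [pd_mul (φsm.diff x) (h.sm.diff x)]
            have h1 : pd i φ x ^ 2 ≤ (c / d) ^ 2 := sq_le_sq' (abs_le.1 (φb.one i x)).1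
              (abs_le.1 (φb.one i x)).2
            have h2 := mul_le_mul_of_nonneg_right h1 (sq_nonneg (f x))
            have h3 := mul_le_mul_of_nonneg_right (pow_le_one₀ (n := 2) (φ0 x) (φ1 x))
              (sq_nonneg (pd i f x))
            nlinarith [sq_nonneg (pd i φ x * f x - φ x * pd i f x)]
          simp only [Fin.sum_univ_three]
          linarith [b 0, b 1, b 2]
      _ = (∑ i, 2 * ∫ x in cube (R - d), pd i f x ^ 2) +
          6 * (c / d) ^ 2 * ∫ x in cube (R - d), f x ^ 2 := by
          rw [integral_add i1 i2, integral_const_mul, integral_finsetSum _ fun i _ =>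
            (integrableOn_cube (hfc i) _).const_mul _]
          simp only [integral_const_mul]
      _ ≤ (∑ i : Fin 3, 2 * E) + 6 * (c / d) ^ 2 *
          (C * κ ^ 2 * (L ^ (5 / 3 : ℝ) * E ^ (1 / 2 : ℝ))) := by
          gcongr with i
          exact (h.mono (by linarith) (by linarith : R - d ≤ R)).energy i
      _ ≤ 6 * (κ ^ 4 * E) + 6 * c ^ 2 * C * (κ ^ 4 * E) := by
          have a1 : E ≤ κ ^ 4 * E := le_mul_of_one_le_left hE0.le (one_le_pow₀ hκ)
          have a2 : L ^ (5 / 3 : ℝ) ≤ L ^ 2 := by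
            rw [← Real.rpow_natCast]
            exact Real.rpow_le_rpow_of_exponent_le h.one_le_L (by norm_num)
          have a3 : E ^ (1 / 2 : ℝ) ≤ E := by
            conv_rhs => rw [← Real.rpow_one E]
            exact Real.rpow_le_rpow_of_exponent_le h.one_le_E (by norm_num)
          have a4 : 6 * (c / d) ^ 2 * (C * κ ^ 2 * (L ^ (5 / 3 : ℝ) * E ^ (1 / 2 : ℝ))) ≤
              6 * (c / d) ^ 2 * (C * κ ^ 2 * (L ^ 2 * E)) := by gcongr
          have a5 : 6 * (c / d) ^ 2 * (C * κ ^ 2 * (L ^ 2 * E)) = 6 * c ^ 2 * C * (κ ^ 4 * E) := by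
            rw [hκd]; field_simp
          rw [Fin.sum_univ_three]
          linarith
      _ = _ := by ring
  have e : ∫ x in cube (R - 2 * d), f x ^ 6 ≤ ∫ x, (φ x * f x) ^ 6 := by
    have hsupp : Supp (R - d) fun x => (φ x * f x) ^ 6 := fun x hx => by simp [φs x hx]
    rw [← hsupp.integral_eq]
    refine setIntegral_cube_le (by linarith) (h.sm.continuous.pow 6) (gsm.continuous.pow 6)
      (fun x => by positivity) fun x hx => ?_
    rw [φe x (by convert hx using 2; ring), one_mul]
  calc ∫ x in cube (R - 2 * d), f x ^ 6 ≤ S * ((6 + 6 * c ^ 2 * C) * (κ ^ 4 * E)) ^ 3 := by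
        refine e.trans ((hsob gsm.one gs).trans ?_)
        gcongr
    _ = _ := by ring

/-! ### Cubic and quartic bounds -/

theorem hasDerivAt_abs_mul_self (y : ℝ) : HasDerivAt (fun t : ℝ => |t| * t) (2 * |y|) y := by
  rcases lt_trichotomy y 0 with h | h | h
  · exact ((hasDerivAt_abs_neg h).fun_mul (hasDerivAt_id' y)).congr_deriv (by
      rw [abs_of_neg h]; ring)
  · subst h
    rw [hasDerivAt_iff_tendsto_slope_zero]
    have : Tendsto (fun t : ℝ => |t|) (𝓝[≠] 0) (𝓝 0) := by
      have h := (continuous_abs (G := ℝ)).tendsto 0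
      rw [abs_zero] at h
      exact h.mono_left nhdsWithin_le_nhds
    simp only [abs_zero, mul_zero]
    refine this.congr' ?_
    filter_upwards [self_mem_nhdsWithin] with t ht
    have : t ≠ 0 := ht
    simp
    field_simp
  · exact ((hasDerivAt_abs_pos h).fun_mul (hasDerivAt_id' y)).congr_deriv (by
      rw [abs_of_pos h]; ring)

theorem contDiff_abs_mul_self : ContDiff ℝ 1 fun t : ℝ => |t| * t := by
  rw [contDiff_one_iff_deriv]
  refine ⟨fun y => (hasDerivAt_abs_mul_self y).differentiableAt, ?_⟩
  have : deriv (fun t : ℝ => |t| * t) = fun y => 2 * |y| :=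
    funext fun y => (hasDerivAt_abs_mul_self y).deriv
  rw [this]
  fun_prop

theorem sq_mul_le_cubes {a b ε : ℝ} (ha : 0 ≤ a) (hb : 0 ≤ b) (hε : 0 < ε) :
    a ^ 2 * b ≤ ε * a ^ 3 + (ε⁻¹) ^ 2 * b ^ 3 := by
  rcases le_total b (ε * a) with h | h
  · have := mul_le_mul_of_nonneg_left h (sq_nonneg a)
    have : 0 ≤ (ε⁻¹) ^ 2 * b ^ 3 := by positivity
    linarith
  · have h1 : a ≤ ε⁻¹ * b := by rwa [le_inv_mul_iff₀ hε]
    have h2 : a ^ 2 * b ≤ (ε⁻¹ * b) ^ 2 * b := by gcongr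
    have : 0 ≤ ε * a ^ 3 := by positivity
    calc _ ≤ (ε⁻¹ * b) ^ 2 * b := h2
      _ = (ε⁻¹) ^ 2 * b ^ 3 := by ring
      _ ≤ _ := by linarith

theorem exists_weighted_product_bound {s β η : ℝ} (hs : 3 < s) (hs6 : s ≤ 6)
    (hβ : 9 ≤ β * (s + 6)) (hη : 0 < η) (hη1 : η ≤ 1) : ∃ K : ℝ, 1 ≤ K ∧
      ∀ {L E Y y : ℝ}, 1 ≤ L → 1 ≤ E → 0 ≤ Y → 0 ≤ y →
        E ^ (1 - β) / L * (Y ^ 2 * y ^ 2) ≤ K * (L ^ (-1 - s / 3) * E ^ β) * Y ^ s + η * y ^ 3 +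
          K * (L * E ^ (β - 3)) * y ^ 6 := by
  have hs0 : 0 < s := by linarith
  set a : ℝ := 2 / s with ha
  set b : ℝ := 4 / 3 - 4 / s with hb
  set c : ℝ := 2 / s - 1 / 3 with hc
  have a0 : 0 < a := by positivity
  have b0 : 0 ≤ b := by
    rw [hb, sub_nonneg, div_le_div_iff₀ hs0 (by norm_num)]; linarith
  have c0 : 0 ≤ c := by
    rw [hc, sub_nonneg, div_le_div_iff₀ (by norm_num) hs0]; linarith
  have habc : a + b + c = 1 := by rw [ha, hb, hc]; ring
  have hac : 0 < a + c := by linarith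
  set K : ℝ := η ^ (-(b / (a + c))) with hK
  have hK1 : 1 ≤ K := Real.one_le_rpow_of_pos_of_le_one_of_nonpos hη hη1
    (neg_nonpos.2 (by positivity))
  have hK0 : 0 < K := by linarith
  have hKη : K ^ a * η ^ b * K ^ c = 1 := by
    rw [mul_right_comm, ← Real.rpow_add hK0, hK, ← Real.rpow_mul hη.le, ← Real.rpow_add hη]
    rw [show -(b / (a + c)) * (a + c) + b = 0 by field_simp; ring, Real.rpow_zero]
  refine ⟨K, hK1, fun {L E Y y} hL hE hY hy => ?_⟩
  have hL0 : 0 < L := by linarith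
  have hE0 : 0 < E := by linarith
  set p₁ := K * (L ^ (-1 - s / 3) * E ^ β) * Y ^ s with hp1
  set p₂ := η * y ^ 3 with hp2
  set p₃ := K * (L * E ^ (β - 3)) * y ^ 6 with hp3
  have p10 : 0 ≤ p₁ := by positivity
  have p20 : 0 ≤ p₂ := by positivity
  have p30 : 0 ≤ p₃ := by positivity
  have amgm := Real.geom_mean_le_arith_mean3_weighted a0.le b0 c0 p10 p20 p30 habc
  have hle : a * p₁ + b * p₂ + c * p₃ ≤ p₁ + p₂ + p₃ := by
    have := mul_le_of_le_one_left p10 (by linarith : a ≤ 1)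
    have := mul_le_of_le_one_left p20 (by linarith : b ≤ 1)
    have := mul_le_of_le_one_left p30 (by linarith : c ≤ 1)
    linarith
  refine le_trans ?_ (amgm.trans hle)
  have f1 : p₁ ^ a = K ^ a * (L ^ ((-1 - s / 3) * a) * E ^ (β * a)) * Y ^ 2 := by
    rw [hp1, Real.mul_rpow (by positivity) (by positivity),
      Real.mul_rpow hK0.le (by positivity), Real.mul_rpow (by positivity) (by positivity),
      ← Real.rpow_mul hL0.le, ← Real.rpow_mul hE0.le, ← Real.rpow_mul hY,
      show s * a = 2 by rw [ha]; field_simp, Real.rpow_two]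
  have f2 : p₂ ^ b = η ^ b * y ^ (3 * b) := by
    rw [hp2, Real.mul_rpow hη.le (by positivity), ← Real.rpow_natCast, ← Real.rpow_mul hy]
    norm_num
  have f3 : p₃ ^ c = K ^ c * (L ^ c * E ^ ((β - 3) * c)) * y ^ (6 * c) := by
    rw [hp3, Real.mul_rpow (by positivity) (by positivity), Real.mul_rpow hK0.le (by positivity),
      Real.mul_rpow hL0.le (by positivity), ← Real.rpow_mul hE0.le, ← Real.rpow_natCast,
      ← Real.rpow_mul hy]
    norm_num
  have hy2 : y ^ (3 * b) * y ^ (6 * c) = y ^ 2 := by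
    rw [← Real.rpow_add_of_nonneg hy (by positivity) (by positivity), ← Real.rpow_natCast]
    congr 1
    rw [hb, hc]; push_cast; ring
  have hLe : L ^ ((-1 - s / 3) * a) * L ^ c = L⁻¹ := by
    rw [← Real.rpow_add hL0, ← Real.rpow_neg_one]
    congr 1
    rw [ha, hc]; field_simp; ring
  have hEe : E ^ (1 - β) ≤ E ^ (β * a) * E ^ ((β - 3) * c) := by
    rw [← Real.rpow_add hE0]
    refine Real.rpow_le_rpow_of_exponent_le hE ?_
    rw [ha, hc]
    have : β * (2 / s) + (β - 3) * (2 / s - 1 / 3) - (1 - β) = (β * (s + 6) - 9) * (2 / (3 * s)) := by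
      field_simp; ring
    have h2 : 0 ≤ (β * (s + 6) - 9) * (2 / (3 * s)) :=
      mul_nonneg (by linarith) (by positivity)
    linarith
  rw [f1, f2, f3]
  calc E ^ (1 - β) / L * (Y ^ 2 * y ^ 2)
      ≤ (E ^ (β * a) * E ^ ((β - 3) * c)) / L * (Y ^ 2 * y ^ 2) := by gcongr
    _ = (K ^ a * η ^ b * K ^ c) * (E ^ (β * a) * E ^ ((β - 3) * c)) *
        (L ^ ((-1 - s / 3) * a) * L ^ c) * (Y ^ 2 * (y ^ (3 * b) * y ^ (6 * c))) := by
        rw [hKη, hLe, hy2]; ring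
    _ = _ := by ring

theorem exists_cubic_bound {s A β : ℝ} (hs : 3 < s) (hs6 : s ≤ 6) (hA : 0 ≤ A)
    (hβ : 9 ≤ β * (s + 6)) :
    ∃ C : ℝ, 1 ≤ C ∧ ∀ {L d R E : ℝ} {f : E3 → ℝ} {F : Fin 3 → E3 → ℝ},
      LocalData s A L d R E f F →
        ∫ x in cube (R - 3 * d), |f x| ^ 3 ≤ C * (L / d) ^ 12 * (L * E ^ β) := by
  obtain ⟨C₁, hC₁, hpot⟩ := exists_potential_bound hs hs6 hA
  obtain ⟨C₂, hC₂, hsext⟩ := exists_sextic_bound hs hs6 hA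
  obtain ⟨c, hc, hcut⟩ := exists_cutoff
  obtain ⟨K, hK, hprod⟩ := exists_weighted_product_bound (η := 1 / 12) hs hs6 hβ (by norm_num)
    (by norm_num)
  have hβ0 : 0 ≤ β := by
    by_contra! hneg
    nlinarith
  refine ⟨6 * (1 + K * A + K * C₂ + 3888 * c ^ 3 * C₁), ?_, fun {L d R E f F} h => ?_⟩
  · have : 0 ≤ K * A + K * C₂ + 3888 * c ^ 3 * C₁ := by positivity
    linarith
  obtain ⟨φ, φb, φ0, φ1, φs, φe⟩ := hcut (R - 2 * d) d h.d_pos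
  have hd := h.d_pos
  have hL0 : 0 < L := by linarith [h.one_le_L]
  have hE0 : 0 < E := by linarith [h.one_le_E]
  have hκ := h.one_le_ratio
  have h' := h.mono (by linarith) (by linarith : R - 2 * d ≤ R)
  have φsm := φb.sm
  set t : ℝ := E ^ (1 - β) / L with ht
  have ht0 : 0 < t := by positivity
  set p : ℝ := L ^ (-1 - s / 3) * E ^ β with hp
  set q : ℝ := L * E ^ (β - 3) with hq
  have habs : ContDiff ℝ 1 fun x => |f x| * f x := contDiff_abs_mul_self.comp h.sm.one
  have φ3 : Sm fun x => φ x ^ 3 := φsm.pow 3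
  have v1 : ContDiff ℝ 1 fun x => φ x ^ 3 * (|f x| * f x) := φ3.one.mul habs
  have hv : ∀ i, ContDiff ℝ 1 fun x => φ x ^ 3 * (|f x| * f x) * F i x := fun i =>
    v1.mul (h.smF i).one
  have hpd : ∀ i x, pd i (fun x => φ x ^ 3 * (|f x| * f x) * F i x) x =
      3 * (φ x ^ 2 * (|f x| * f x) * (pd i φ x * F i x)) +
        2 * (φ x ^ 3 * (|f x| * F i x * pd i f x)) +
          φ x ^ 3 * (|f x| * f x) * pd i (F i) x := by
    intro i x
    have e1 : pd i (fun x => |f x| * f x) x = 2 * |f x| * pd i f x :=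
      pd_comp (τ := fun t : ℝ => |t| * t) hasDerivAt_abs_mul_self (h.sm.diff x) i
    have e2 : pd i (fun x => φ x ^ 3) x = 3 * φ x ^ 2 * pd i φ x :=
      pd_comp (τ := fun t : ℝ => t ^ 3) (τ' := fun t => 3 * t ^ 2)
        (fun y => by simpa using hasDerivAt_pow 3 y) (φsm.diff x) i
    rw [pd_mul (v1.differentiable (by norm_num) x) ((h.smF i).diff x),
      pd_mul (φ3.diff x) (habs.differentiable (by norm_num) x), e1, e2]
    ring
  have cF3 : ∀ i, Continuous fun x => |F i x| ^ 3 := fun i => (h.smF i).continuous.abs.pow 3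
  have cFs : ∀ i, Continuous fun x => |F i x| ^ s := fun i =>
    (h.smF i).continuous.abs.rpow_const fun _ => Or.inr (by linarith)
  have cdf : ∀ i, Continuous fun x => pd i f x ^ 2 := fun i => (h.sm.pd i).continuous.pow 2
  have cf6 : Continuous fun x => f x ^ 6 := h.sm.continuous.pow 6
  set H : Fin 3 → E3 → ℝ := fun i x => t⁻¹ * pd i f x ^ 2 + K * p * |F i x| ^ s + K * q * f x ^ 6 +
    3888 * (c / d) ^ 3 * |F i x| ^ 3 with hH
  have cH : ∀ i, Continuous (H i) := fun i =>
    (((continuous_const.mul (cdf i)).add (continuous_const.mul (cFs i))).add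
      (continuous_const.mul cf6)).add (continuous_const.mul (cF3 i))
  have key := setIntegral_le_of_flux (R := R - 2 * d)
    (g := fun x => 1 / 2 * (φ x ^ 3 * |f x| ^ 3)) (h := fun x => ∑ i, H i x) hv
    (fun i => fun x hx => by simp [φs x hx])
    (continuous_const.mul ((φsm.continuous.pow 3).mul (h.sm.continuous.abs.pow 3)))
    (continuous_finsetSum _ fun i _ => cH i)
    (by
      intro x _
      have φ30 : 0 ≤ φ x ^ 3 := pow_nonneg (φ0 x) 3
      have φ31 : φ x ^ 3 ≤ 1 := pow_le_one₀ (φ0 x) (φ1 x)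
      have b1 : ∀ i, -(2 * (φ x ^ 3 * (|f x| * F i x * pd i f x))) ≤
          t⁻¹ * pd i f x ^ 2 + K * p * |F i x| ^ s + 1 / 12 * (φ x ^ 3 * |f x| ^ 3) +
            K * q * f x ^ 6 := by
        intro i
        have w := hprod h.one_le_L h.one_le_E (abs_nonneg (F i x)) (abs_nonneg (f x))
        rw [(by decide : Even 6).pow_abs] at w
        have w1 : -(2 * (|f x| * F i x * pd i f x)) ≤
            t⁻¹ * pd i f x ^ 2 + t * (|F i x| ^ 2 * |f x| ^ 2) := by
          have e : t⁻¹ * pd i f x ^ 2 + t * (|F i x| ^ 2 * |f x| ^ 2) +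
              2 * (|f x| * F i x * pd i f x) = (pd i f x + t * (|f x| * F i x)) ^ 2 / t := by
            rw [sq_abs (F i x)]; field_simp; ring
          have : 0 ≤ (pd i f x + t * (|f x| * F i x)) ^ 2 / t := by positivity
          linarith
        have w2 := mul_le_mul_of_nonneg_left (w1.trans (add_le_add_right w _)) φ30
        have n1 : φ x ^ 3 * (t⁻¹ * pd i f x ^ 2) ≤ t⁻¹ * pd i f x ^ 2 :=
          mul_le_of_le_one_left (by positivity) φ31
        have n2 : φ x ^ 3 * (K * p * |F i x| ^ s) ≤ K * p * |F i x| ^ s :=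
          mul_le_of_le_one_left (by positivity) φ31
        have n3 : φ x ^ 3 * (K * q * f x ^ 6) ≤ K * q * f x ^ 6 :=
          mul_le_of_le_one_left (by positivity) φ31
        linarith
      have b2 : ∀ i, -(3 * (φ x ^ 2 * (|f x| * f x) * (pd i φ x * F i x))) ≤
          1 / 12 * (φ x ^ 3 * |f x| ^ 3) + 3888 * (c / d) ^ 3 * |F i x| ^ 3 := by
        intro i
        have hcd : 0 ≤ c / d := by positivity
        have y := sq_mul_le_cubes (a := φ x * |f x|) (b := 3 * (c / d) * |F i x|) (ε := 1 / 12)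
          (mul_nonneg (φ0 x) (abs_nonneg _)) (by positivity) (by norm_num)
        have y1 : -(3 * (φ x ^ 2 * (|f x| * f x) * (pd i φ x * F i x))) ≤
            (φ x * |f x|) ^ 2 * (3 * (c / d) * |F i x|) := by
          refine (neg_le_abs _).trans ?_
          simp only [abs_mul, abs_abs, abs_pow, abs_of_nonneg (φ0 x)]
          rw [abs_of_pos (by norm_num : (0 : ℝ) < 3)]
          calc 3 * (φ x ^ 2 * (|f x| * |f x|) * (|pd i φ x| * |F i x|))
              ≤ 3 * (φ x ^ 2 * (|f x| * |f x|) * (c / d * |F i x|)) := by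
                gcongr
                exact φb.one i x
            _ = _ := by ring
        refine y1.trans (y.trans (le_of_eq ?_))
        ring
      have hdiv := h.div x
      simp only [hpd, hH]
      simp only [Fin.sum_univ_three] at hdiv ⊢
      have e : φ x ^ 3 * (|f x| * f x) * pd 0 (F 0) x + φ x ^ 3 * (|f x| * f x) * pd 1 (F 1) x +
          φ x ^ 3 * (|f x| * f x) * pd 2 (F 2) x = φ x ^ 3 * |f x| ^ 3 := by
        rw [← mul_add, ← mul_add, hdiv, pow_succ |f x| 2, sq_abs]; ring
      linarith [b1 0, b1 1, b1 2, b2 0, b2 1, b2 2])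
  have hHi : ∀ i, ∫ x in cube (R - 2 * d), H i x ≤
      (1 + K * A + K * C₂ + 3888 * c ^ 3 * C₁) * ((L / d) ^ 12 * (L * E ^ β)) := by
    intro i
    have I1 := (integrableOn_cube (cdf i) (R - 2 * d)).const_mul t⁻¹
    have I2 := (integrableOn_cube (cFs i) (R - 2 * d)).const_mul (K * p)
    have I3 := (integrableOn_cube cf6 (R - 2 * d)).const_mul (K * q)
    have I4 := (integrableOn_cube (cF3 i) (R - 2 * d)).const_mul (3888 * (c / d) ^ 3)
    have split : ∫ x in cube (R - 2 * d), H i x =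
        t⁻¹ * (∫ x in cube (R - 2 * d), pd i f x ^ 2) +
        K * p * (∫ x in cube (R - 2 * d), |F i x| ^ s) +
        K * q * (∫ x in cube (R - 2 * d), f x ^ 6) +
        3888 * (c / d) ^ 3 * ∫ x in cube (R - 2 * d), |F i x| ^ 3 := by
      have I12 : IntegrableOn (fun x => t⁻¹ * pd i f x ^ 2 + K * p * |F i x| ^ s)
        (cube (R - 2 * d)) := I1.add I2
      have I123 : IntegrableOn (fun x => t⁻¹ * pd i f x ^ 2 + K * p * |F i x| ^ s +
        K * q * f x ^ 6) (cube (R - 2 * d)) := I12.add I3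
      simp only [hH]
      rw [integral_add I123 I4, integral_add I12 I3, integral_add I1 I2]
      simp only [integral_const_mul]
    set G := L * E ^ β with hG
    have hG0 : 0 ≤ G := by positivity
    have hk : 1 ≤ (L / d) ^ 12 := one_le_pow₀ hκ
    have hGk : G ≤ (L / d) ^ 12 * G := le_mul_of_one_le_left hG0 hk
    have e1 : t⁻¹ * E = G := by
      rw [ht, inv_div, hG, div_mul_eq_mul_div, mul_div_assoc]
      congr 1
      rw [div_eq_iff (by positivity), ← Real.rpow_add hE0]
      simp
    have e2 : p * L ^ (s / 3 + 2) = G := by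
      rw [hp, hG, mul_right_comm, ← Real.rpow_add hL0,
        show -1 - s / 3 + (s / 3 + 2) = 1 by ring, Real.rpow_one]
    have e3 : q * E ^ 3 = G := by
      rw [hq, hG, mul_assoc, ← Real.rpow_natCast E, ← Real.rpow_add hE0]
      norm_num
    have e4 : (1 / d) ^ 3 * L ^ (4 : ℝ) ≤ (L / d) ^ 12 * G := by
      have : (L / d) ^ 3 * L ≤ (L / d) ^ 12 * G := by
        refine mul_le_mul (pow_le_pow_right₀ hκ (by norm_num)) ?_ hL0.le (by positivity)
        exact le_mul_of_one_le_right hL0.le (Real.one_le_rpow h.one_le_E hβ0)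
      refine le_trans (le_of_eq ?_) this
      rw [show (4 : ℝ) = ((4 : ℕ) : ℝ) by norm_num, Real.rpow_natCast]
      field_simp
    have hp0 : 0 ≤ p := by positivity
    have hq0 : 0 ≤ q := by positivity
    rw [split]
    calc _ ≤ t⁻¹ * E + K * p * (A * L ^ (s / 3 + 2)) + K * q * (C₂ * (L / d) ^ 12 * E ^ 3) +
          3888 * (c / d) ^ 3 * (C₁ * L ^ (4 : ℝ)) := by
          gcongr
          · exact h'.energy i
          · exact h'.pot i
          · exact hsext h
          · exact (hpot h' i).2
      _ = t⁻¹ * E + K * A * (p * L ^ (s / 3 + 2)) + K * C₂ * ((L / d) ^ 12 * (q * E ^ 3)) +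
          3888 * c ^ 3 * C₁ * ((1 / d) ^ 3 * L ^ (4 : ℝ)) := by ring
      _ ≤ (L / d) ^ 12 * G + K * A * ((L / d) ^ 12 * G) + K * C₂ * ((L / d) ^ 12 * G) +
          3888 * c ^ 3 * C₁ * ((L / d) ^ 12 * G) := by
          rw [e1, e2, e3]; gcongr
      _ = _ := by ring
  have e : ∫ x in cube (R - 3 * d), |f x| ^ 3 ≤
      2 * ∫ x in cube (R - 2 * d), 1 / 2 * (φ x ^ 3 * |f x| ^ 3) := by
    rw [← integral_const_mul]
    refine setIntegral_cube_le (by linarith) (h.sm.continuous.abs.pow 3)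
      (continuous_const.mul (continuous_const.mul
        ((φsm.continuous.pow 3).mul (h.sm.continuous.abs.pow 3))))
      (fun x => mul_nonneg (by norm_num) (mul_nonneg (by norm_num)
        (mul_nonneg (pow_nonneg (φ0 x) 3) (by positivity)))) fun x hx => ?_
    rw [φe x (by convert hx using 2; ring)]; linarith
  rw [integral_finsetSum _ fun i _ => integrableOn_cube (cH i) _] at key
  have hsum := Finset.sum_le_card_nsmul Finset.univ _ _ fun i _ => hHi i
  simp only [Finset.card_univ, Fintype.card_fin, nsmul_eq_mul, Nat.cast_ofNat] at hsum
  calc _ ≤ _ := e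
    _ ≤ 2 * (3 * ((1 + K * A + K * C₂ + 3888 * c ^ 3 * C₁) * ((L / d) ^ 12 * (L * E ^ β)))) := by
        linarith
    _ = _ := by ring

/-! ### The local energy inequality -/

/-- Componentwise curl. -/
def rot (v : Fin 3 → E3 → ℝ) (x : E3) : Fin 3 → ℝ :=
  ![pd 1 (v 2) x - pd 2 (v 1) x, pd 2 (v 0) x - pd 0 (v 2) x, pd 0 (v 1) x - pd 1 (v 0) x]

/-- Componentwise cross product. -/
def crossv (v w : Fin 3 → E3 → ℝ) (i : Fin 3) (x : E3) : ℝ :=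
  ![v 1 x * w 2 x - v 2 x * w 1 x, v 2 x * w 0 x - v 0 x * w 2 x,
    v 0 x * w 1 x - v 1 x * w 0 x] i

/-- Componentwise form of the stationary magneto-micropolar system. -/
structure MMPFlow (u w b : Fin 3 → E3 → ℝ) (P : E3 → ℝ) : Prop where
  smu : ∀ j, Sm (u j)
  smw : ∀ j, Sm (w j)
  smb : ∀ j, Sm (b j)
  smP : Sm P
  eq_u : ∀ x j, -(∑ i, pd i (pd i (u j)) x) + (∑ i, u i x * pd i (u j) x) + pd j P x =
    rot w x j + ∑ i, b i x * pd i (b j) x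
  eq_w : ∀ x j, -(∑ i, pd i (pd i (w j)) x) + (∑ i, u i x * pd i (w j) x) =
    pd j (fun y => ∑ i, pd i (w i) y) x + rot u x j - 2 * w j x
  eq_b : ∀ x j, -(∑ i, pd i (pd i (b j)) x) + (∑ i, u i x * pd i (b j) x) =
    ∑ i, b i x * pd i (u j) x
  div_u : ∀ x, ∑ i, pd i (u i) x = 0
  div_b : ∀ x, ∑ i, pd i (b i) x = 0

theorem IsMMPSolution.flow {u w b : E3 → E3} {P : E3 → ℝ} (h : IsMMPSolution u w b P) :
    MMPFlow (fun j x => u x j) (fun j x => w x j) (fun j x => b x j) P where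
  smu j := (contDiff_euclidean.1 h.smooth_u) j
  smw j := (contDiff_euclidean.1 h.smooth_w) j
  smb j := (contDiff_euclidean.1 h.smooth_b) j
  smP := h.smooth_P
  eq_u := h.eq_u
  eq_w := h.eq_w
  eq_b := h.eq_b
  div_u := h.div_u
  div_b := h.div_b

/-- Squared norm of the gradient. -/
def gsq (v : Fin 3 → E3 → ℝ) (x : E3) : ℝ := ∑ j, ∑ i, pd i (v j) x ^ 2

/-- The energy flux without its pressure part. -/
def energyFlux (u w b : Fin 3 → E3 → ℝ) (i : Fin 3) (x : E3) : ℝ :=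
  (∑ j, (u j x * pd i (u j) x + w j x * pd i (w j) x + b j x * pd i (b j) x)) -
    1 / 2 * (u i x * ∑ j, (u j x * u j x + w j x * w j x + b j x * b j x)) +
    b i x * (∑ j, u j x * b j x) + w i x * (∑ j, pd j (w j) x) - crossv u w i x -
    2 / 3 * ∑ j, u j x * pd j (u i) x

theorem Sm.const_mul {f : E3 → ℝ} (hf : Sm f) (c : ℝ) : Sm fun x => c * f x :=
  contDiff_const.mul hf

theorem sm_crossv {v w : Fin 3 → E3 → ℝ} (hv : ∀ j, Sm (v j)) (hw : ∀ j, Sm (w j)) (i : Fin 3) :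
    Sm (crossv v w i) := by
  fin_cases i
  · exact ((hv 1).mul (hw 2)).sub ((hv 2).mul (hw 1))
  · exact ((hv 2).mul (hw 0)).sub ((hv 0).mul (hw 2))
  · exact ((hv 0).mul (hw 1)).sub ((hv 1).mul (hw 0))

theorem Sm.sum {f : Fin 3 → E3 → ℝ} (hf : ∀ j, Sm (f j)) : Sm fun x => ∑ j, f j x :=
  ContDiff.sum fun j _ => hf j

theorem MMPFlow.sm_energyFlux {u w b : Fin 3 → E3 → ℝ} {P : E3 → ℝ} (h : MMPFlow u w b P) (i : Fin 3) :
    Sm (energyFlux u w b i) := by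
  have hu := h.smu
  have hw := h.smw
  have hb := h.smb
  refine ContDiff.sub (ContDiff.sub (ContDiff.add (ContDiff.add (ContDiff.sub ?_ ?_) ?_) ?_) ?_) ?_
  · exact Sm.sum fun j => (((hu j).mul ((hu j).pd i)).add ((hw j).mul ((hw j).pd i))).add
      ((hb j).mul ((hb j).pd i))
  · exact ((hu i).mul (Sm.sum fun j => (((hu j).mul (hu j)).add ((hw j).mul (hw j))).add
      ((hb j).mul (hb j)))).const_mul _
  · exact (hb i).mul (Sm.sum fun j => (hu j).mul (hb j))
  · exact (hw i).mul (Sm.sum fun j => (hw j).pd j)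
  · exact sm_crossv hu hw i
  · exact (Sm.sum fun j => (hu j).mul ((hu i).pd j)).const_mul _

theorem div_crossv {v w : Fin 3 → E3 → ℝ} (hv : ∀ j, Sm (v j)) (hw : ∀ j, Sm (w j)) (x : E3) :
    ∑ i, pd i (crossv v w i) x = (∑ j, w j x * rot v x j) - ∑ j, v j x * rot w x j := by
  have hv := fun j => (hv j).diff
  have hw := fun j => (hw j).diff
  have e : ∀ a b c d i, pd i (fun x => v a x * w b x - v c x * w d x) x =
      (pd i (v a) x * w b x + v a x * pd i (w b) x) -
        (pd i (v c) x * w d x + v c x * pd i (w d) x) := fun a b c d i => by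
    rw [pd_sub (by fun_prop) (by fun_prop), pd_mul (hv a x) (hw b x),
      pd_mul (hv c x) (hw d x)]
  have e0 : crossv v w 0 = fun x => v 1 x * w 2 x - v 2 x * w 1 x := rfl
  have e1 : crossv v w 1 = fun x => v 2 x * w 0 x - v 0 x * w 2 x := rfl
  have e2 : crossv v w 2 = fun x => v 0 x * w 1 x - v 1 x * w 0 x := rfl
  rw [Fin.sum_univ_three, e0, e1, e2, e, e, e]
  simp [Fin.sum_univ_three, rot]
  ring

theorem MMPFlow.pd_energyFlux {u w b : Fin 3 → E3 → ℝ} {P : E3 → ℝ} (h : MMPFlow u w b P)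
    (i : Fin 3) (x : E3) : pd i (energyFlux u w b i) x =
      (∑ j, ((pd i (u j) x ^ 2 + u j x * pd i (pd i (u j)) x) +
        (pd i (w j) x ^ 2 + w j x * pd i (pd i (w j)) x) +
        (pd i (b j) x ^ 2 + b j x * pd i (pd i (b j)) x))) -
      (1 / 2 * (pd i (u i) x * ∑ j, (u j x * u j x + w j x * w j x + b j x * b j x)) +
        u i x * ∑ j, (u j x * pd i (u j) x + w j x * pd i (w j) x + b j x * pd i (b j) x)) +
      (pd i (b i) x * (∑ j, u j x * b j x) +
        b i x * (∑ j, (pd i (u j) x * b j x + u j x * pd i (b j) x))) +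
      (pd i (w i) x * (∑ j, pd j (w j) x) + w i x * pd i (fun y => ∑ j, pd j (w j) y) x) -
      pd i (crossv u w i) x -
      2 / 3 * ∑ j, (pd i (u j) x * pd j (u i) x + u j x * pd j (pd i (u i)) x) := by
  have hu := fun j => (h.smu j).diff
  have hw := fun j => (h.smw j).diff
  have hb := fun j => (h.smb j).diff
  have hdu := fun i j => ((h.smu j).pd i).diff
  have hdw := fun i j => ((h.smw j).pd i).diff
  have hdb := fun i j => ((h.smb j).pd i).diff
  have hcr := (sm_crossv h.smu h.smw i).diff
  have hdiv : Differentiable ℝ (fun y => ∑ j, pd j (w j) y) := (Sm.sum fun j => (h.smw j).pd j).diff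
  have m1 : ∀ j, pd i (fun x => u j x * pd i (u j) x + w j x * pd i (w j) x + b j x * pd i (b j) x) x
      = (pd i (u j) x ^ 2 + u j x * pd i (pd i (u j)) x) +
        (pd i (w j) x ^ 2 + w j x * pd i (pd i (w j)) x) +
        (pd i (b j) x ^ 2 + b j x * pd i (pd i (b j)) x) := fun j => by
    rw [pd_add (by fun_prop) (by fun_prop), pd_add (by fun_prop) (by fun_prop),
      pd_mul (by fun_prop) (by fun_prop), pd_mul (by fun_prop) (by fun_prop),
      pd_mul (by fun_prop) (by fun_prop)]
    ring
  have m2 : ∀ j, pd i (fun x => u j x * u j x + w j x * w j x + b j x * b j x) x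
      = 2 * (u j x * pd i (u j) x + w j x * pd i (w j) x + b j x * pd i (b j) x) := fun j => by
    rw [pd_add (by fun_prop) (by fun_prop), pd_add (by fun_prop) (by fun_prop),
      pd_mul (by fun_prop) (by fun_prop), pd_mul (by fun_prop) (by fun_prop),
      pd_mul (by fun_prop) (by fun_prop)]
    ring
  have m3 : ∀ j, pd i (fun x => u j x * b j x) x = pd i (u j) x * b j x + u j x * pd i (b j) x :=
    fun j => pd_mul (by fun_prop) (by fun_prop) i
  have m4 : ∀ j, pd i (fun x => u j x * pd j (u i) x) x =
      pd i (u j) x * pd j (u i) x + u j x * pd j (pd i (u i)) x := fun j => by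
    rw [pd_mul (by fun_prop) (by fun_prop), pd_comm (h.smu i) i j]
  have e : energyFlux u w b i = fun x =>
      (∑ j, (u j x * pd i (u j) x + w j x * pd i (w j) x + b j x * pd i (b j) x)) -
        1 / 2 * (u i x * ∑ j, (u j x * u j x + w j x * w j x + b j x * b j x)) +
        b i x * (∑ j, u j x * b j x) + w i x * (∑ j, pd j (w j) x) - crossv u w i x -
        2 / 3 * ∑ j, u j x * pd j (u i) x := rfl
  rw [e, pd_sub (by fun_prop) (by fun_prop), pd_sub (by fun_prop) (by fun_prop),
    pd_add (by fun_prop) (by fun_prop), pd_add (by fun_prop) (by fun_prop),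
    pd_sub (by fun_prop) (by fun_prop), pd_const_mul _ (by fun_prop),
    pd_const_mul _ (by fun_prop), pd_mul (hu i x) (by fun_prop), pd_mul (hb i x) (by fun_prop),
    pd_mul (hw i x) (hdiv x), pd_sum (fun j _ => by fun_prop), pd_sum (fun j _ => by fun_prop),
    pd_sum (fun j _ => by fun_prop), pd_sum (f := fun j x => u j x * pd j (u i) x) (fun j _ => by fun_prop)]
  simp only [m1, m2, m3, m4, ← Finset.mul_sum]
  ring

theorem MMPFlow.energy_le_div {u w b : Fin 3 → E3 → ℝ} {P : E3 → ℝ} (h : MMPFlow u w b P) (x : E3) :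
    1 / 3 * (gsq u x + gsq w x + gsq b x + ∑ j, w j x ^ 2) ≤
      (∑ i, pd i (energyFlux u w b i) x) - ∑ j, u j x * pd j P x := by
  have eu := h.eq_u x
  have ew := h.eq_w x
  have eb := h.eq_b x
  have du := h.div_u x
  have db := h.div_b x
  have ddu : ∀ j, ∑ i, pd j (pd i (u i)) x = 0 := fun j => by
    rw [← pd_sum (fun i _ => ((h.smu i).pd i).diff x), funext h.div_u]; exact pd_const 0 x j
  have dc := div_crossv h.smu h.smw x
  simp only [h.pd_energyFlux]
  obtain ⟨q, hq⟩ : ∃ q : Fin 3 → ℝ, ∀ j, pd j (fun y => ∑ i, pd i (w i) y) x = q j :=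
    ⟨_, fun _ => rfl⟩
  simp only [hq] at ew ⊢
  have key : (∑ i, ((∑ j, ((pd i (u j) x ^ 2 + u j x * pd i (pd i (u j)) x) +
        (pd i (w j) x ^ 2 + w j x * pd i (pd i (w j)) x) +
        (pd i (b j) x ^ 2 + b j x * pd i (pd i (b j)) x))) -
      (1 / 2 * (pd i (u i) x * ∑ j, (u j x * u j x + w j x * w j x + b j x * b j x)) +
        u i x * ∑ j, (u j x * pd i (u j) x + w j x * pd i (w j) x + b j x * pd i (b j) x)) +
      (pd i (b i) x * (∑ j, u j x * b j x) +
        b i x * (∑ j, (pd i (u j) x * b j x + u j x * pd i (b j) x))) +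
      (pd i (w i) x * (∑ j, pd j (w j) x) + w i x * q i) -
      pd i (crossv u w i) x -
      2 / 3 * ∑ j, (pd i (u j) x * pd j (u i) x + u j x * pd j (pd i (u i)) x))) -
        ∑ j, u j x * pd j P x = 1 / 3 * gsq u x + gsq w x + gsq b x + (∑ i, pd i (w i) x) ^ 2 +
        1 / 2 * ∑ j, w j x ^ 2 + 2 / 3 * ∑ j, (rot u x j - 3 / 2 * w j x) ^ 2 := by
    have eu0 := eu 0
    have eu1 := eu 1
    have eu2 := eu 2
    have ew0 := ew 0
    have ew1 := ew 1
    have ew2 := ew 2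
    have eb0 := eb 0
    have eb1 := eb 1
    have eb2 := eb 2
    have ddu0 := ddu 0
    have ddu1 := ddu 1
    have ddu2 := ddu 2
    clear eu ew eb ddu
    simp [gsq, Fin.sum_univ_three, rot] at eu0 eu1 eu2 ew0 ew1 ew2 eb0 eb1 eb2 ddu0 ddu1 ddu2 du db dc ⊢
    linear_combination (-u 0 x) * eu0 - u 1 x * eu1 - u 2 x * eu2 - w 0 x * ew0 - w 1 x * ew1 -
      w 2 x * ew2 - b 0 x * eb0 - b 1 x * eb1 - b 2 x * eb2 - dc -
      1 / 2 * (u 0 x ^ 2 + u 1 x ^ 2 + u 2 x ^ 2 + w 0 x ^ 2 + w 1 x ^ 2 + w 2 x ^ 2 +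
        b 0 x ^ 2 + b 1 x ^ 2 + b 2 x ^ 2) * du +
      (u 0 x * b 0 x + u 1 x * b 1 x + u 2 x * b 2 x) * db -
      2 / 3 * (u 0 x * ddu0 + u 1 x * ddu1 + u 2 x * ddu2)
  rw [key]
  have hn : ∀ v : Fin 3 → E3 → ℝ, 0 ≤ gsq v x := fun v =>
    Finset.sum_nonneg fun _ _ => Finset.sum_nonneg fun _ _ => sq_nonneg _
  have n1 : 0 ≤ ∑ j, w j x ^ 2 := Finset.sum_nonneg fun _ _ => sq_nonneg _
  have n2 : 0 ≤ ∑ j, (rot u x j - 3 / 2 * w j x) ^ 2 := Finset.sum_nonneg fun _ _ => sq_nonneg _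
  nlinarith [hn w, hn b, sq_nonneg (∑ i, pd i (w i) x)]

/-! ### The pressure flux and pointwise estimates -/

/-- The flux used to eliminate the pressure. -/
def pressureFlux (u w b z₁ z₂ : Fin 3 → E3 → ℝ) (P φ : E3 → ℝ) (i : Fin 3) (x : E3) : ℝ :=
  P x * (z₁ i x + z₂ i x) - φ x * (u i x * P x) -
    (∑ j, (z₁ j x + z₂ j x) * pd i (u j) x) + crossv (fun j x => z₁ j x + z₂ j x) w i x +
    ∑ j, z₂ j x * (u i x * u j x - b i x * b j x)

theorem MMPFlow.sm_pressureFlux {u w b z₁ z₂ : Fin 3 → E3 → ℝ} {P φ : E3 → ℝ}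
    (h : MMPFlow u w b P) (hz₁ : ∀ j, Sm (z₁ j)) (hz₂ : ∀ j, Sm (z₂ j)) (hφ : Sm φ) (i : Fin 3) :
    Sm (pressureFlux u w b z₁ z₂ P φ i) := by
  have hz := fun j => (hz₁ j).add (hz₂ j)
  refine ContDiff.add (ContDiff.add (ContDiff.sub (ContDiff.sub ?_ ?_) ?_) ?_) ?_
  · exact h.smP.mul (hz i)
  · exact hφ.mul ((h.smu i).mul h.smP)
  · exact Sm.sum fun j => (hz j).mul ((h.smu j).pd i)
  · exact sm_crossv hz h.smw i
  · exact Sm.sum fun j => (hz₂ j).mul (((h.smu i).mul (h.smu j)).sub ((h.smb i).mul (h.smb j)))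

theorem supp_crossv {R : ℝ} {v : Fin 3 → E3 → ℝ} (hv : ∀ j, Supp R (v j)) (w : Fin 3 → E3 → ℝ)
    (i : Fin 3) : Supp R (crossv v w i) := fun x hx => by
  fin_cases i <;> simp [crossv, hv _ x hx]

theorem supp_pressureFlux {R : ℝ} {u w b z₁ z₂ : Fin 3 → E3 → ℝ} {P φ : E3 → ℝ}
    (hz₁ : ∀ j, Supp R (z₁ j)) (hz₂ : ∀ j, Supp R (z₂ j)) (hφ : Supp R φ) (i : Fin 3) :
    Supp R (pressureFlux u w b z₁ z₂ P φ i) := fun x hx => by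
  have := supp_crossv (fun j => (hz₁ j).add (hz₂ j)) w i x hx
  simp [pressureFlux, this, hz₁ _ x hx, hz₂ _ x hx, hφ x hx]

theorem MMPFlow.pd_pressureFlux {u w b z₁ z₂ : Fin 3 → E3 → ℝ} {P φ : E3 → ℝ}
    (h : MMPFlow u w b P) (hz₁ : ∀ j, Sm (z₁ j)) (hz₂ : ∀ j, Sm (z₂ j)) (hφ : Sm φ) (i : Fin 3)
    (x : E3) : pd i (pressureFlux u w b z₁ z₂ P φ i) x =
      (pd i P x * (z₁ i x + z₂ i x) + P x * (pd i (z₁ i) x + pd i (z₂ i) x)) -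
      (pd i φ x * (u i x * P x) + φ x * (pd i (u i) x * P x + u i x * pd i P x)) -
      (∑ j, ((pd i (z₁ j) x + pd i (z₂ j) x) * pd i (u j) x +
        (z₁ j x + z₂ j x) * pd i (pd i (u j)) x)) +
      pd i (crossv (fun j x => z₁ j x + z₂ j x) w i) x +
      ∑ j, (pd i (z₂ j) x * (u i x * u j x - b i x * b j x) + z₂ j x *
        ((pd i (u i) x * u j x + u i x * pd i (u j) x) -
          (pd i (b i) x * b j x + b i x * pd i (b j) x))) := by
  have hu := fun j => (h.smu j).diff
  have hb := fun j => (h.smb j).diff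
  have hP := h.smP.diff
  have dφ := hφ.diff
  have d1 := fun j => (hz₁ j).diff
  have d2 := fun j => (hz₂ j).diff
  have hdu := fun i j => ((h.smu j).pd i).diff
  have hcr := (sm_crossv (fun j => (hz₁ j).add (hz₂ j)) h.smw i).diff
  have m1 : ∀ j, pd i (fun x => (z₁ j x + z₂ j x) * pd i (u j) x) x =
      (pd i (z₁ j) x + pd i (z₂ j) x) * pd i (u j) x +
        (z₁ j x + z₂ j x) * pd i (pd i (u j)) x := fun j => by
    rw [pd_mul (by fun_prop) (by fun_prop), pd_add (by fun_prop) (by fun_prop)]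
  have m2 : ∀ j, pd i (fun x => z₂ j x * (u i x * u j x - b i x * b j x)) x =
      pd i (z₂ j) x * (u i x * u j x - b i x * b j x) + z₂ j x *
        ((pd i (u i) x * u j x + u i x * pd i (u j) x) -
          (pd i (b i) x * b j x + b i x * pd i (b j) x)) := fun j => by
    rw [pd_mul (by fun_prop) (by fun_prop), pd_sub (by fun_prop) (by fun_prop),
      pd_mul (by fun_prop) (by fun_prop), pd_mul (by fun_prop) (by fun_prop)]
  have e : pressureFlux u w b z₁ z₂ P φ i = fun x =>
    P x * (z₁ i x + z₂ i x) - φ x * (u i x * P x) -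
    (∑ j, (z₁ j x + z₂ j x) * pd i (u j) x) + crossv (fun j x => z₁ j x + z₂ j x) w i x +
    ∑ j, z₂ j x * (u i x * u j x - b i x * b j x) := rfl
  rw [e, pd_add (by fun_prop) (by fun_prop), pd_add (by fun_prop) (by fun_prop),
    pd_sub (by fun_prop) (by fun_prop), pd_sub (by fun_prop) (by fun_prop),
    pd_mul (by fun_prop) (by fun_prop), pd_mul (by fun_prop) (by fun_prop),
    pd_mul (by fun_prop) (by fun_prop), pd_add (by fun_prop) (by fun_prop),
    pd_sum (f := fun j x => (z₁ j x + z₂ j x) * pd i (u j) x) (fun j _ => by fun_prop),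
    pd_sum (f := fun j x => z₂ j x * (u i x * u j x - b i x * b j x)) (fun j _ => by fun_prop)]
  simp only [m1, m2]

theorem MMPFlow.pressure_eq {u w b z₁ z₂ : Fin 3 → E3 → ℝ} {P φ : E3 → ℝ}
    (h : MMPFlow u w b P) (hz₁ : ∀ j, Sm (z₁ j)) (hz₂ : ∀ j, Sm (z₂ j)) (hφ : Sm φ)
    (x : E3) (hz : ∑ i, (pd i (z₁ i) x + pd i (z₂ i) x) = ∑ j, u j x * pd j φ x) :
    -(φ x * ∑ j, u j x * pd j P x) = (∑ i, pd i (pressureFlux u w b z₁ z₂ P φ i) x) +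
      (∑ i, ∑ j, (pd i (z₁ j) x + pd i (z₂ j) x) * pd i (u j) x) -
      (∑ j, w j x * (rot z₁ x j + rot z₂ x j)) +
      (∑ i, ∑ j, z₁ j x * (u i x * pd i (u j) x - b i x * pd i (b j) x)) -
      ∑ i, ∑ j, pd i (z₂ j) x * (u i x * u j x - b i x * b j x) := by
  have eu := h.eq_u x
  have du := h.div_u x
  have db := h.div_b x
  have dc := div_crossv (fun j => (hz₁ j).add (hz₂ j)) h.smw x
  have a1 : ∀ i j, pd i (fun x => z₁ j x + z₂ j x) x = pd i (z₁ j) x + pd i (z₂ j) x := fun i j =>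
    pd_add ((hz₁ j).diff x) ((hz₂ j).diff x) i
  have eu0 := eu 0
  have eu1 := eu 1
  have eu2 := eu 2
  simp only [h.pd_pressureFlux hz₁ hz₂ hφ]
  clear eu
  simp [Fin.sum_univ_three, rot, a1] at eu0 eu1 eu2 du db dc hz ⊢
  linear_combination (-(z₁ 0 x + z₂ 0 x)) * eu0 - (z₁ 1 x + z₂ 1 x) * eu1 -
    (z₁ 2 x + z₂ 2 x) * eu2 - dc - P x * hz + (φ x * P x - (z₂ 0 x * u 0 x + z₂ 1 x * u 1 x +
      z₂ 2 x * u 2 x)) * du + (z₂ 0 x * b 0 x + z₂ 1 x * b 1 x + z₂ 2 x * b 2 x) * db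

/-! ### Pointwise bounds for the lower order terms -/

theorem le_sum_sum {g : Fin 3 → Fin 3 → ℝ} (hg : ∀ k j, 0 ≤ g k j) (k j : Fin 3) :
    g k j ≤ ∑ k, ∑ j, g k j :=
  (Finset.single_le_sum (fun j _ => hg k j) (Finset.mem_univ j)).trans
    (Finset.single_le_sum (f := fun k => ∑ j, g k j)
      (fun k _ => Finset.sum_nonneg fun j _ => hg k j) (Finset.mem_univ k))

theorem abs_sum_three_le {f : Fin 3 → ℝ} {B : ℝ} (h : ∀ j, |f j| ≤ B) : |∑ j, f j| ≤ 3 * B := by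
  refine (Finset.abs_sum_le_sum_abs _ _).trans ?_
  simpa using Finset.sum_le_card_nsmul Finset.univ _ B fun j _ => h j

theorem abs_mul_le_of_sq_le {t a b A B : ℝ} (ht : 0 < t) (ha : a ^ 2 ≤ A) (hb : b ^ 2 ≤ B) :
    |a * b| ≤ t * A + t⁻¹ * B := by
  have h1 : |a * b| ≤ t / 2 * a ^ 2 + (2 * t)⁻¹ * b ^ 2 := by
    refine abs_le.2 ⟨?_, ?_⟩
    · have := mul_le_weighted ht (a := -1) (by simp) a b
      linarith
    · have := mul_le_weighted ht (a := 1) (by simp) a b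
      linarith
  have h2 : t / 2 * a ^ 2 ≤ t * A := by nlinarith [sq_nonneg a]
  have h3 : (2 * t)⁻¹ * b ^ 2 ≤ t⁻¹ * B := by
    rw [mul_inv]
    have : 0 < t⁻¹ := inv_pos.2 ht
    nlinarith [sq_nonneg b]
  linarith

theorem abs_mul_mul_le_of_cube_le {a b c T : ℝ} (ha : |a| ^ 3 ≤ T) (hb : |b| ^ 3 ≤ T)
    (hc : |c| ^ 3 ≤ T) : |a * (b * c)| ≤ T := by
  have hT : 0 ≤ T := le_trans (by positivity) ha
  have h : |a * (b * c)| ^ 3 ≤ T ^ 3 := by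
    rw [abs_mul, abs_mul, mul_pow, mul_pow]
    calc |a| ^ 3 * (|b| ^ 3 * |c| ^ 3) ≤ T * (T * T) := by gcongr
      _ = T ^ 3 := by ring
  exact le_of_pow_le_pow_left₀ (by norm_num) hT h

/-- Dissipation density. -/
def dens (X : Fin 3 → Fin 3 → E3 → ℝ) (x : E3) : ℝ := (∑ k, gsq (X k) x) + ∑ j, X 1 j x ^ 2

theorem gsq_nonneg (v : Fin 3 → E3 → ℝ) (x : E3) : 0 ≤ gsq v x :=
  Finset.sum_nonneg fun _ _ => Finset.sum_nonneg fun _ _ => sq_nonneg _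

theorem pd_sq_le_gsq (v : Fin 3 → E3 → ℝ) (x : E3) (i j : Fin 3) : pd i (v j) x ^ 2 ≤ gsq v x :=
  le_sum_sum (g := fun j i => pd i (v j) x ^ 2) (fun _ _ => sq_nonneg _) j i

theorem gsq_le_dens (X : Fin 3 → Fin 3 → E3 → ℝ) (x : E3) (k : Fin 3) : gsq (X k) x ≤ dens X x := by
  have h1 := Finset.single_le_sum (f := fun k => gsq (X k) x)
    (fun k _ => gsq_nonneg (X k) x) (Finset.mem_univ k)
  have h2 : 0 ≤ ∑ j, X 1 j x ^ 2 := Finset.sum_nonneg fun _ _ => sq_nonneg _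
  unfold dens
  linarith

theorem dens_nonneg (X : Fin 3 → Fin 3 → E3 → ℝ) (x : E3) : 0 ≤ dens X x :=
  (gsq_nonneg (X 0) x).trans (gsq_le_dens X x 0)

theorem pd_sq_le_dens (X : Fin 3 → Fin 3 → E3 → ℝ) (x : E3) (k i j : Fin 3) :
    pd i (X k j) x ^ 2 ≤ dens X x := (pd_sq_le_gsq (X k) x i j).trans (gsq_le_dens X x k)

theorem micro_sq_le_dens (X : Fin 3 → Fin 3 → E3 → ℝ) (x : E3) (j : Fin 3) :
    X 1 j x ^ 2 ≤ dens X x := by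
  have h1 := Finset.single_le_sum (f := fun j => X 1 j x ^ 2)
    (fun j _ => sq_nonneg _) (Finset.mem_univ j)
  have h2 : 0 ≤ ∑ k, gsq (X k) x := Finset.sum_nonneg fun _ _ => gsq_nonneg _ _
  unfold dens
  linarith

theorem abs_energyFlux_le (X : Fin 3 → Fin 3 → E3 → ℝ) (x : E3) {σ : ℝ} (hσ : 0 < σ) (i : Fin 3) :
    |energyFlux (X 0) (X 1) (X 2) i x| ≤
      20 * (σ * (∑ k, ∑ j, X k j x ^ 2) + σ⁻¹ * dens X x + ∑ k, ∑ j, |X k j x| ^ 3) := by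
  set Y := ∑ k, ∑ j, X k j x ^ 2 with hY
  set T := ∑ k, ∑ j, |X k j x| ^ 3 with hT
  set B := σ * Y + σ⁻¹ * dens X x with hB
  have y : ∀ k j, X k j x ^ 2 ≤ Y := le_sum_sum (g := fun k j => X k j x ^ 2) fun _ _ => sq_nonneg _
  have c : ∀ k j, |X k j x| ^ 3 ≤ T :=
    le_sum_sum (g := fun k j => |X k j x| ^ 3) fun _ _ => by positivity
  have p : ∀ k j l i m, |X k j x * pd i (X l m) x| ≤ B := fun k j l i m =>
    abs_mul_le_of_sq_le hσ (y k j) (pd_sq_le_dens X x l i m)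
  have q : ∀ k j m, |X k j x * X 1 m x| ≤ B := fun k j m =>
    abs_mul_le_of_sq_le hσ (y k j) (micro_sq_le_dens X x m)
  have r : ∀ k j l m n o, |X k j x * (X l m x * X n o x)| ≤ T := fun k j l m n o =>
    abs_mul_mul_le_of_cube_le (c k j) (c l m) (c n o)
  have hB0 : 0 ≤ B := (abs_nonneg _).trans (q 0 0 0)
  have hT0 : 0 ≤ T := (abs_nonneg _).trans (r 0 0 0 0 0 0)
  have s1 : |∑ j, (X 0 j x * pd i (X 0 j) x + X 1 j x * pd i (X 1 j) x +
      X 2 j x * pd i (X 2 j) x)| ≤ 3 * (3 * B) := abs_sum_three_le fun j => by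
    refine (abs_add_three _ _ _).trans ?_
    linarith [p 0 j 0 i j, p 1 j 1 i j, p 2 j 2 i j]
  have s2 : |X 0 i x * ∑ j, (X 0 j x * X 0 j x + X 1 j x * X 1 j x + X 2 j x * X 2 j x)| ≤
      3 * (3 * T) := by
    rw [Finset.mul_sum]
    refine abs_sum_three_le fun j => ?_
    rw [mul_add, mul_add]
    refine (abs_add_three _ _ _).trans ?_
    linarith [r 0 i 0 j 0 j, r 0 i 1 j 1 j, r 0 i 2 j 2 j]
  have s3 : |X 2 i x * ∑ j, X 0 j x * X 2 j x| ≤ 3 * T := by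
    rw [Finset.mul_sum]
    exact abs_sum_three_le fun j => r 2 i 0 j 2 j
  have s4 : |X 1 i x * ∑ j, pd j (X 1 j) x| ≤ 3 * B := by
    rw [Finset.mul_sum]
    exact abs_sum_three_le fun j => p 1 i 1 j j
  have s5 : |crossv (X 0) (X 1) i x| ≤ 2 * B := by
    have g : ∀ a b c d, |X 0 a x * X 1 b x - X 0 c x * X 1 d x| ≤ 2 * B := fun a b c d => by
      refine (abs_sub _ _).trans ?_
      linarith [q 0 a b, q 0 c d]
    fin_cases i
    · exact g 1 2 2 1
    · exact g 2 0 0 2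
    · exact g 0 1 1 0
  have s6 : |∑ j, X 0 j x * pd j (X 0 i) x| ≤ 3 * B := abs_sum_three_le fun j => p 0 j 0 j i
  unfold energyFlux
  rw [abs_le] at s1 s2 s3 s4 s5 s6 ⊢
  constructor <;> linarith

theorem pressure_terms_le (X : Fin 3 → Fin 3 → E3 → ℝ) (z₁ z₂ : Fin 3 → E3 → ℝ) (x : E3)
    {τ t t' : ℝ} (hτ : 0 < τ) (ht : 0 < t) (ht' : 0 < t') :
    (∑ i, ∑ j, (pd i (z₁ j) x + pd i (z₂ j) x) * pd i (X 0 j) x) -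
      (∑ j, X 1 j x * (rot z₁ x j + rot z₂ x j)) +
      (∑ i, ∑ j, z₁ j x * (X 0 i x * pd i (X 0 j) x - X 2 i x * pd i (X 2 j) x)) -
      (∑ i, ∑ j, pd i (z₂ j) x * (X 0 i x * X 0 j x - X 2 i x * X 2 j x)) ≤
    30 * (τ * (gsq z₁ x + gsq z₂ x) + τ⁻¹ * dens X x) +
      18 * (t' * (∑ l, ∑ k, ∑ j, z₁ l x ^ 2 * X k j x ^ 2) + t'⁻¹ * dens X x) +
      36 * (t * (∑ k, ∑ j, X k j x ^ 4) + t⁻¹ * gsq z₂ x) := by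
  set B := τ * (gsq z₁ x + gsq z₂ x) + τ⁻¹ * dens X x with hB
  set Z := t' * (∑ l, ∑ k, ∑ j, z₁ l x ^ 2 * X k j x ^ 2) + t'⁻¹ * dens X x with hZ
  set Q := t * (∑ k, ∑ j, X k j x ^ 4) + t⁻¹ * gsq z₂ x with hQ
  have g1 : ∀ i j, pd i (z₁ j) x ^ 2 ≤ gsq z₁ x + gsq z₂ x := fun i j =>
    (pd_sq_le_gsq z₁ x i j).trans (le_add_of_nonneg_right (gsq_nonneg z₂ x))
  have g2 : ∀ i j, pd i (z₂ j) x ^ 2 ≤ gsq z₁ x + gsq z₂ x := fun i j =>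
    (pd_sq_le_gsq z₂ x i j).trans (le_add_of_nonneg_left (gsq_nonneg z₁ x))
  have p1 : ∀ i j k l, |pd i (z₁ j) x * pd k (X 0 l) x| ≤ B := fun i j k l =>
    abs_mul_le_of_sq_le hτ (g1 i j) (pd_sq_le_dens X x 0 k l)
  have p2 : ∀ i j k l, |pd i (z₂ j) x * pd k (X 0 l) x| ≤ B := fun i j k l =>
    abs_mul_le_of_sq_le hτ (g2 i j) (pd_sq_le_dens X x 0 k l)
  have q1 : ∀ i j k, |pd i (z₁ j) x * X 1 k x| ≤ B := fun i j k =>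
    abs_mul_le_of_sq_le hτ (g1 i j) (micro_sq_le_dens X x k)
  have q2 : ∀ i j k, |pd i (z₂ j) x * X 1 k x| ≤ B := fun i j k =>
    abs_mul_le_of_sq_le hτ (g2 i j) (micro_sq_le_dens X x k)
  have hz : ∀ l k j, (z₁ l x * X k j x) ^ 2 ≤ ∑ l, ∑ k, ∑ j, z₁ l x ^ 2 * X k j x ^ 2 :=
    fun l k j => by
      rw [mul_pow]
      exact (le_sum_sum (g := fun k j => z₁ l x ^ 2 * X k j x ^ 2) (fun _ _ => by positivity)
        k j).trans (Finset.single_le_sum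
          (f := fun l => ∑ k, ∑ j, z₁ l x ^ 2 * X k j x ^ 2) (fun l _ => by positivity)
          (Finset.mem_univ l))
  have r : ∀ l k i m j, |z₁ l x * X k i x * pd m (X k j) x| ≤ Z := fun l k i m j =>
    abs_mul_le_of_sq_le ht' (hz l k i) (pd_sq_le_dens X x k m j)
  have h4 : ∀ k i j, (X k i x * X k j x) ^ 2 ≤ ∑ k, ∑ j, X k j x ^ 4 := fun k i j => by
    have e : ∀ i, X k i x ^ 4 ≤ ∑ k, ∑ j, X k j x ^ 4 := fun i =>
      le_sum_sum (g := fun k j => X k j x ^ 4) (fun _ _ => by positivity) k i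
    nlinarith [e i, e j, sq_nonneg (X k i x ^ 2 - X k j x ^ 2)]
  have s : ∀ m l k i j, |X k i x * X k j x * pd m (z₂ l) x| ≤ Q := fun m l k i j =>
    abs_mul_le_of_sq_le ht (h4 k i j) (pd_sq_le_gsq z₂ x m l)
  have a1 : |∑ i, ∑ j, (pd i (z₁ j) x + pd i (z₂ j) x) * pd i (X 0 j) x| ≤ 3 * (3 * (2 * B)) :=
    abs_sum_three_le fun i => abs_sum_three_le fun j => by
      rw [add_mul]
      exact (abs_add_le _ _).trans (by linarith [p1 i j i j, p2 i j i j])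
  have a2 : |∑ j, X 1 j x * (rot z₁ x j + rot z₂ x j)| ≤ 3 * (4 * B) :=
    abs_sum_three_le fun j => by
      have g : ∀ a b c d, |X 1 j x * ((pd a (z₁ b) x - pd c (z₁ d) x) +
          (pd a (z₂ b) x - pd c (z₂ d) x))| ≤ 4 * B := fun a b c d => by
        have w1 := q1 a b j
        have w2 := q1 c d j
        have w3 := q2 a b j
        have w4 := q2 c d j
        rw [abs_le] at w1 w2 w3 w4 ⊢
        constructor <;> linarith
      fin_cases j
      · exact g 1 2 2 1
      · exact g 2 0 0 2
      · exact g 0 1 1 0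
  have a3 : |∑ i, ∑ j, z₁ j x * (X 0 i x * pd i (X 0 j) x - X 2 i x * pd i (X 2 j) x)| ≤
      3 * (3 * (2 * Z)) := abs_sum_three_le fun i => abs_sum_three_le fun j => by
    rw [mul_sub, ← mul_assoc, ← mul_assoc]
    exact (abs_sub _ _).trans (by linarith [r j 0 i i j, r j 2 i i j])
  have a4 : |∑ i, ∑ j, pd i (z₂ j) x * (X 0 i x * X 0 j x - X 2 i x * X 2 j x)| ≤
      3 * (3 * (2 * Q)) := abs_sum_three_le fun i => abs_sum_three_le fun j => by
    rw [mul_comm, sub_mul]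
    exact (abs_sub _ _).trans (by linarith [s i j 0 i j, s i j 2 i j])
  have Q0 : 0 ≤ Q := (abs_nonneg _).trans (s 0 0 0 0 0)
  rw [abs_le] at a1 a2 a3 a4
  linarith

/-! ### Product and quartic bounds -/

theorem exists_product_bound {s A β : ℝ} (hs : 3 < s) (hs6 : s ≤ 6) (hA : 0 ≤ A)
    (hβ : 9 ≤ β * (s + 6)) :
    ∃ C : ℝ, 1 ≤ C ∧ ∀ {L d R E : ℝ} {f : E3 → ℝ} {F : Fin 3 → E3 → ℝ},
      LocalData s A L d R E f F → ∀ {z : E3 → ℝ} {M : ℝ}, Continuous z →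
        ∫ x in cube (R - 3 * d), |z x| ^ s ≤ M * (L⁻¹ ^ s * L ^ (s / 3 + 2)) →
          E ^ (1 - β) * ∫ x in cube (R - 3 * d), z x ^ 2 * f x ^ 2 ≤
            C * (M + (L / d) ^ 12) * E ^ β := by
  obtain ⟨C₃, hC₃, hcub⟩ := exists_cubic_bound hs hs6 hA hβ
  obtain ⟨C₆, hC₆, hsext⟩ := exists_sextic_bound hs hs6 hA
  obtain ⟨K, hK, hprod⟩ := exists_weighted_product_bound (η := 1) hs hs6 hβ (by norm_num) le_rfl
  refine ⟨K + (C₃ + K * C₆), by nlinarith, fun {L d R E f F} h {z M} hz hzM => ?_⟩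
  have hd := h.d_pos
  have hL0 : 0 < L := by linarith [h.one_le_L]
  have hE0 : 0 < E := by linarith [h.one_le_E]
  have hκ := h.one_le_ratio
  have h3 := hcub h
  have c6 : Continuous fun x => f x ^ 6 := h.sm.continuous.pow 6
  have h6 : ∫ x in cube (R - 3 * d), f x ^ 6 ≤ C₆ * (L / d) ^ 12 * E ^ 3 :=
    (setIntegral_cube_mono (by linarith) c6 fun x => by positivity).trans (hsext h)
  have c1 : Continuous fun x => z x ^ 2 * f x ^ 2 := (hz.pow 2).mul (h.sm.continuous.pow 2)
  have c2 : Continuous fun x => |z x| ^ s := hz.abs.rpow_const fun _ => Or.inr (by linarith)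
  have c3 : Continuous fun x => |f x| ^ 3 := h.sm.continuous.abs.pow 3
  have I1 := (integrableOn_cube c2 (R - 3 * d)).const_mul
    (L⁻¹ * (K * (L ^ (-1 - s / 3) * E ^ β) * L ^ s))
  have I2 := (integrableOn_cube c3 (R - 3 * d)).const_mul L⁻¹
  have I3 := (integrableOn_cube c6 (R - 3 * d)).const_mul (L⁻¹ * (K * (L * E ^ (β - 3))))
  have I12 : IntegrableOn (fun x => L⁻¹ * (K * (L ^ (-1 - s / 3) * E ^ β) * L ^ s) * |z x| ^ s +
    L⁻¹ * |f x| ^ 3) (cube (R - 3 * d)) := I1.add I2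
  have key : E ^ (1 - β) * ∫ x in cube (R - 3 * d), z x ^ 2 * f x ^ 2 ≤
      ∫ x in cube (R - 3 * d), (L⁻¹ * (K * (L ^ (-1 - s / 3) * E ^ β) * L ^ s) * |z x| ^ s +
        L⁻¹ * |f x| ^ 3 + L⁻¹ * (K * (L * E ^ (β - 3))) * f x ^ 6) := by
    rw [← integral_const_mul]
    refine integral_mono ((integrableOn_cube c1 _).const_mul _) (I12.add I3) fun x => ?_
    have w := hprod h.one_le_L h.one_le_E (Y := L * |z x|) (by positivity) (abs_nonneg (f x))
    rw [(by decide : Even 6).pow_abs, mul_pow, sq_abs, sq_abs,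
      Real.mul_rpow hL0.le (abs_nonneg _)] at w
    have w' := mul_le_mul_of_nonneg_left w (inv_nonneg.2 hL0.le)
    calc E ^ (1 - β) * (z x ^ 2 * f x ^ 2)
        = L⁻¹ * (E ^ (1 - β) / L * (L ^ 2 * z x ^ 2 * f x ^ 2)) := by field_simp
      _ ≤ _ := w'
      _ = _ := by ring
  rw [integral_add I12 I3, integral_add I1 I2, integral_const_mul, integral_const_mul,
    integral_const_mul] at key
  have e1 : L⁻¹ * (L ^ (-1 - s / 3) * L ^ s * (L⁻¹ ^ s * L ^ (s / 3 + 2))) = 1 := by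
    rw [Real.inv_rpow hL0.le, ← Real.rpow_neg hL0.le, ← Real.rpow_neg_one, ← Real.rpow_add hL0,
      ← Real.rpow_add hL0, ← Real.rpow_add hL0, ← Real.rpow_add hL0]
    rw [show -1 + (-1 - s / 3 + s + (-s + (s / 3 + 2))) = 0 by ring, Real.rpow_zero]
  have e3 : E ^ (β - 3) * E ^ 3 = E ^ β := by
    rw [← Real.rpow_natCast E, ← Real.rpow_add hE0]; norm_num
  refine key.trans ?_
  have p1 : 0 ≤ L⁻¹ * (K * (L ^ (-1 - s / 3) * E ^ β) * L ^ s) := by positivity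
  have p3 : 0 ≤ L⁻¹ * (K * (L * E ^ (β - 3))) := by positivity
  calc _ ≤ L⁻¹ * (K * (L ^ (-1 - s / 3) * E ^ β) * L ^ s) * (M * (L⁻¹ ^ s * L ^ (s / 3 + 2))) +
        L⁻¹ * (C₃ * (L / d) ^ 12 * (L * E ^ β)) +
        L⁻¹ * (K * (L * E ^ (β - 3))) * (C₆ * (L / d) ^ 12 * E ^ 3) := by gcongr
    _ = K * M * E ^ β * (L⁻¹ * (L ^ (-1 - s / 3) * L ^ s * (L⁻¹ ^ s * L ^ (s / 3 + 2)))) +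
        C₃ * (L / d) ^ 12 * E ^ β + K * C₆ * (L / d) ^ 12 * (E ^ (β - 3) * E ^ 3) := by
        field_simp
    _ = K * M * E ^ β + (C₃ + K * C₆) * (L / d) ^ 12 * E ^ β := by rw [e1, e3]; ring
    _ ≤ _ := by
        have hM : 0 ≤ M := by
          by_contra! hneg
          have : 0 ≤ ∫ x in cube (R - 3 * d), |z x| ^ s :=
            integral_nonneg fun x => Real.rpow_nonneg (abs_nonneg _) _
          have : M * (L⁻¹ ^ s * L ^ (s / 3 + 2)) < 0 := mul_neg_of_neg_of_pos hneg (by positivity)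
          linarith
        have q1 : 0 ≤ K * (L / d) ^ 12 * E ^ β := by positivity
        have q2 : 0 ≤ (C₃ + K * C₆) * M * E ^ β := by positivity
        linarith

theorem exists_quartic_bound {s A β : ℝ} (hs : 3 < s) (hs6 : s ≤ 6) (hA : 0 ≤ A)
    (hβ : 9 ≤ β * (s + 6)) :
    ∃ C : ℝ, 1 ≤ C ∧ ∀ {L d R E : ℝ} {f : E3 → ℝ} {F : Fin 3 → E3 → ℝ},
      LocalData s A L d R E f F → ∫ x in cube (R - 3 * d), f x ^ 4 ≤
        C * (L / d) ^ 12 * (L ^ (2 / 3 : ℝ) * E ^ (1 + 2 * β / 3)) := by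
  obtain ⟨C₃, hC₃, hcub⟩ := exists_cubic_bound hs hs6 hA hβ
  obtain ⟨C₆, hC₆, hsext⟩ := exists_sextic_bound hs hs6 hA
  refine ⟨C₃ + C₆, by linarith, fun {L d R E f F} h => ?_⟩
  have hd := h.d_pos
  have hL0 : 0 < L := by linarith [h.one_le_L]
  have hE0 : 0 < E := by linarith [h.one_le_E]
  have h3 := hcub h
  have c6 : Continuous fun x => f x ^ 6 := h.sm.continuous.pow 6
  have h6 : ∫ x in cube (R - 3 * d), f x ^ 6 ≤ C₆ * (L / d) ^ 12 * E ^ 3 :=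
    (setIntegral_cube_mono (by linarith) c6 fun x => by positivity).trans (hsext h)
  set m : ℝ := L ^ (-1 / 3 : ℝ) * E ^ (1 - β / 3) with hm
  have m0 : 0 < m := by positivity
  have c3 : Continuous fun x => |f x| ^ 3 := h.sm.continuous.abs.pow 3
  have I1 := (integrableOn_cube c3 (R - 3 * d)).const_mul m
  have I2 := (integrableOn_cube c6 (R - 3 * d)).const_mul (m⁻¹ ^ 2)
  have key : ∫ x in cube (R - 3 * d), f x ^ 4 ≤
      ∫ x in cube (R - 3 * d), (m * |f x| ^ 3 + m⁻¹ ^ 2 * f x ^ 6) := by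
    refine integral_mono (integrableOn_cube (h.sm.continuous.pow 4) _) (I1.add I2) fun x => ?_
    have w := sq_mul_le_cubes (a := |f x|) (b := f x ^ 2) (abs_nonneg _) (sq_nonneg _) m0
    rw [sq_abs] at w
    calc f x ^ 4 = f x ^ 2 * f x ^ 2 := by ring
      _ ≤ _ := w
      _ = _ := by ring
  rw [integral_add I1 I2, integral_const_mul, integral_const_mul] at key
  have e1 : m * (L * E ^ β) = L ^ (2 / 3 : ℝ) * E ^ (1 + 2 * β / 3) := by
    rw [hm]
    nth_rewrite 2 [← Real.rpow_one L]
    rw [mul_mul_mul_comm, ← Real.rpow_add hL0, ← Real.rpow_add hE0]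
    norm_num
    left
    ring_nf
  have e2 : m⁻¹ ^ 2 * E ^ 3 = L ^ (2 / 3 : ℝ) * E ^ (1 + 2 * β / 3) := by
    rw [hm, mul_inv, ← Real.rpow_neg hL0.le, ← Real.rpow_neg hE0.le, mul_pow,
      ← Real.rpow_natCast, ← Real.rpow_natCast, ← Real.rpow_natCast, ← Real.rpow_mul hL0.le,
      ← Real.rpow_mul hE0.le, mul_assoc, ← Real.rpow_add hE0]
    norm_num
    left
    ring_nf
  calc _ ≤ _ := key
    _ ≤ m * (C₃ * (L / d) ^ 12 * (L * E ^ β)) + m⁻¹ ^ 2 * (C₆ * (L / d) ^ 12 * E ^ 3) := by gcongr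
    _ = C₃ * (L / d) ^ 12 * (m * (L * E ^ β)) + C₆ * (L / d) ^ 12 * (m⁻¹ ^ 2 * E ^ 3) := by ring
    _ = _ := by rw [e1, e2]; ring

/-! ### The integrated local energy inequality -/

/-- `f` is continuous with integral at most `a` over the cube of half side `R`. -/
structure IntLE (R : ℝ) (f : E3 → ℝ) (a : ℝ) : Prop where
  cont : Continuous f
  le : ∫ x in cube R, f x ≤ a

theorem IntLE.add {R a a' : ℝ} {f g : E3 → ℝ} (hf : IntLE R f a) (hg : IntLE R g a') :
    IntLE R (fun x => f x + g x) (a + a') := by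
  refine ⟨hf.cont.add hg.cont, ?_⟩
  rw [integral_add (integrableOn_cube hf.cont R) (integrableOn_cube hg.cont R)]
  exact add_le_add hf.le hg.le

theorem IntLE.const_mul {R a : ℝ} {f : E3 → ℝ} (hf : IntLE R f a) {c : ℝ} (hc : 0 ≤ c) :
    IntLE R (fun x => c * f x) (c * a) := by
  refine ⟨hf.cont.const_mul c, ?_⟩
  rw [integral_const_mul]
  exact mul_le_mul_of_nonneg_left hf.le hc

theorem IntLE.sum {R a : ℝ} {f : Fin 3 → E3 → ℝ} (hf : ∀ k, IntLE R (f k) a) :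
    IntLE R (fun x => ∑ k, f k x) (3 * a) := by
  refine ⟨continuous_finsetSum _ fun k _ => (hf k).cont, ?_⟩
  rw [integral_finsetSum _ fun k _ => integrableOn_cube (hf k).cont R]
  refine (Finset.sum_le_sum fun k _ => (hf k).le).trans ?_
  simp

theorem MMPFlow.sm {X : Fin 3 → Fin 3 → E3 → ℝ} {P : E3 → ℝ}
    (h : MMPFlow (X 0) (X 1) (X 2) P) (k j : Fin 3) : Sm (X k j) := by
  fin_cases k
  exacts [h.smu j, h.smw j, h.smb j]

theorem continuous_gsq {v : Fin 3 → E3 → ℝ} (hv : ∀ j, Sm (v j)) : Continuous (gsq v) :=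
  continuous_finsetSum _ fun j _ => continuous_finsetSum _ fun i _ =>
    ((hv j).pd i).continuous.pow 2

theorem continuous_dens {X : Fin 3 → Fin 3 → E3 → ℝ} (hX : ∀ k j, Sm (X k j)) :
    Continuous (dens X) :=
  (continuous_finsetSum _ fun k _ => continuous_gsq (hX k)).add
    (continuous_finsetSum _ fun j _ => (hX 1 j).continuous.pow 2)

theorem gsq_intLE {R a : ℝ} {v : Fin 3 → E3 → ℝ} (hv : ∀ j, Sm (v j))
    (h : ∀ j i, ∫ x in cube R, pd i (v j) x ^ 2 ≤ a) : IntLE R (gsq v) (3 * (3 * a)) :=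
  IntLE.sum fun j => IntLE.sum fun i => ⟨((hv j).pd i).continuous.pow 2, h j i⟩

theorem local_energy_le {X : Fin 3 → Fin 3 → E3 → ℝ} {P φ : E3 → ℝ} {z₁ z₂ : Fin 3 → E3 → ℝ}
    (h : MMPFlow (X 0) (X 1) (X 2) P) {r R d c : ℝ} (hrR : r ≤ R) (hd : 0 < d) (hc : 0 ≤ c)
    (hφ : ScaleBound d c φ) (φ0 : ∀ x, 0 ≤ φ x) (φs : Supp R φ) (φe : ∀ x ∈ cube r, φ x = 1)
    (hz₁ : ∀ j, Sm (z₁ j)) (hz₂ : ∀ j, Sm (z₂ j)) (hs₁ : ∀ j, Supp R (z₁ j))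
    (hs₂ : ∀ j, Supp R (z₂ j))
    (hz : ∀ x, ∑ i, (pd i (z₁ i) x + pd i (z₂ i) x) = ∑ j, X 0 j x * pd j φ x)
    {σ τ t t' : ℝ} (hσ : 0 < σ) (hτ : 0 < τ) (ht : 0 < t) (ht' : 0 < t')
    {q e m y₁ y₂ W m₄ : ℝ} (hq : ∀ k j, ∫ x in cube R, X k j x ^ 2 ≤ q)
    (he : ∫ x in cube R, dens X x ≤ e) (hm : ∀ k j, ∫ x in cube R, |X k j x| ^ 3 ≤ m)
    (hy₁ : ∀ j i, ∫ x in cube R, pd i (z₁ j) x ^ 2 ≤ y₁)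
    (hy₂ : ∀ j i, ∫ x in cube R, pd i (z₂ j) x ^ 2 ≤ y₂)
    (hW : ∀ l k j, ∫ x in cube R, z₁ l x ^ 2 * X k j x ^ 2 ≤ W)
    (hm₄ : ∀ k j, ∫ x in cube R, X k j x ^ 4 ≤ m₄) :
    ∫ x in cube r, dens X x ≤ 3 * (60 * (c / d) * (σ * (3 * (3 * q)) + σ⁻¹ * e + 3 * (3 * m)) +
      (30 * (τ * (3 * (3 * y₁) + 3 * (3 * y₂)) + τ⁻¹ * e) +
      18 * (t' * (3 * (3 * (3 * W))) + t'⁻¹ * e) +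
      36 * (t * (3 * (3 * m₄)) + t⁻¹ * (3 * (3 * y₂))))) := by
  have hX := h.sm
  have D : IntLE R (dens X) e := ⟨continuous_dens hX, he⟩
  have G₁ := gsq_intLE hz₁ hy₁
  have G₂ := gsq_intLE hz₂ hy₂
  have A₁ := (((IntLE.sum fun k => IntLE.sum fun j =>
    (⟨(hX k j).continuous.pow 2, hq k j⟩ : IntLE R (fun x => X k j x ^ 2) q)).const_mul hσ.le).add
    (D.const_mul (inv_pos.2 hσ).le)).add (IntLE.sum fun k => IntLE.sum fun j =>
    (⟨(hX k j).continuous.abs.pow 3, hm k j⟩ : IntLE R (fun x => |X k j x| ^ 3) m))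
  have A₂ := ((G₁.add G₂).const_mul hτ.le).add (D.const_mul (inv_pos.2 hτ).le)
  have A₃ := ((IntLE.sum fun l => IntLE.sum fun k => IntLE.sum fun j =>
    (⟨((hz₁ l).continuous.pow 2).mul ((hX k j).continuous.pow 2), hW l k j⟩ :
      IntLE R (fun x => z₁ l x ^ 2 * X k j x ^ 2) W)).const_mul ht'.le).add
      (D.const_mul (inv_pos.2 ht').le)
  have A₄ := ((IntLE.sum fun k => IntLE.sum fun j =>
    (⟨(hX k j).continuous.pow 4, hm₄ k j⟩ : IntLE R (fun x => X k j x ^ 4) m₄)).const_mul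
      ht.le).add (G₂.const_mul (inv_pos.2 ht).le)
  have A := (A₁.const_mul (c := 60 * (c / d)) (by positivity)).add
    (((A₂.const_mul (c := 30) (by norm_num)).add (A₃.const_mul (c := 18) (by norm_num))).add
      (A₄.const_mul (c := 36) (by norm_num)))
  have A' := A.const_mul (c := 3) (by norm_num)
  have V := h.sm_energyFlux
  have S : ∀ i, Sm fun x => φ x * energyFlux (X 0) (X 1) (X 2) i x +
      pressureFlux (X 0) (X 1) (X 2) z₁ z₂ P φ i x := fun i =>
    (hφ.sm.mul (V i)).add (h.sm_pressureFlux hz₁ hz₂ hφ.sm i)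
  have flux := setIntegral_le_of_flux (R := R)
    (v := fun i x => 3 * (φ x * energyFlux (X 0) (X 1) (X 2) i x +
      pressureFlux (X 0) (X 1) (X 2) z₁ z₂ P φ i x))
    (fun i => ((S i).const_mul 3).one)
    (fun i => (((φs.mul_left _).add (supp_pressureFlux hs₁ hs₂ φs i)).mul_right fun _ => 3))
    (g := fun x => φ x * dens X x) (hφ.sm.continuous.mul D.cont) A'.cont (fun x _ => by
      have e1 : ∀ i, pd i (fun x => 3 * (φ x * energyFlux (X 0) (X 1) (X 2) i x +
          pressureFlux (X 0) (X 1) (X 2) z₁ z₂ P φ i x)) x =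
          3 * (pd i φ x * energyFlux (X 0) (X 1) (X 2) i x +
            φ x * pd i (energyFlux (X 0) (X 1) (X 2) i) x +
            pd i (pressureFlux (X 0) (X 1) (X 2) z₁ z₂ P φ i) x) := fun i => by
        rw [pd_const_mul 3 ((S i).diff x) i,
          pd_add ((hφ.sm.mul (V i)).diff x) ((h.sm_pressureFlux hz₁ hz₂ hφ.sm i).diff x) i,
          pd_mul (hφ.sm.diff x) ((V i).diff x) i]
      have e2 := mul_le_mul_of_nonneg_left (h.energy_le_div x) (φ0 x)
      have e3 := h.pressure_eq hz₁ hz₂ hφ.sm x (hz x)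
      have e4 := pressure_terms_le X z₁ z₂ x hτ ht ht'
      have e5 : ∀ i, -(pd i φ x * energyFlux (X 0) (X 1) (X 2) i x) ≤ c / d *
          (20 * (σ * (∑ k, ∑ j, X k j x ^ 2) + σ⁻¹ * dens X x + ∑ k, ∑ j, |X k j x| ^ 3)) :=
        fun i => (neg_le_abs _).trans (by
          rw [abs_mul]
          exact mul_le_mul (hφ.one i x) (abs_energyFlux_le X x hσ i) (abs_nonneg _)
            (by positivity))
      have e6 := add_le_add (add_le_add (e5 0) (e5 1)) (e5 2)
      have e7 : dens X x = gsq (X 0) x + gsq (X 1) x + gsq (X 2) x + ∑ j, X 1 j x ^ 2 := by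
        rw [dens, Fin.sum_univ_three]
      simp only [e1]
      rw [← e7] at e2
      rw [Fin.sum_univ_three (fun i => 3 * (pd i φ x * energyFlux (X 0) (X 1) (X 2) i x +
            φ x * pd i (energyFlux (X 0) (X 1) (X 2) i) x +
            pd i (pressureFlux (X 0) (X 1) (X 2) z₁ z₂ P φ i) x))]
      rw [Fin.sum_univ_three (fun i => pd i (energyFlux (X 0) (X 1) (X 2) i) x)] at e2
      rw [Fin.sum_univ_three (fun i => pd i (pressureFlux (X 0) (X 1) (X 2) z₁ z₂ P φ i) x)] at e3
      generalize dens X x = D at *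
      linarith)
  refine le_trans ?_ (flux.trans A'.le)
  exact setIntegral_cube_le hrR D.cont (hφ.sm.continuous.mul D.cont)
    (fun x => mul_nonneg (φ0 x) (dens_nonneg X x)) fun x hx => by rw [φe x hx, one_mul]

/-! ### The recursive energy estimate -/

/-- A solution with divergence-form potentials controlled on the cube of half side `R ≤ L`. -/
structure SystemData (s A L R : ℝ) (X : Fin 3 → Fin 3 → E3 → ℝ) (P : E3 → ℝ)
    (F : Fin 3 → Fin 3 → Fin 3 → E3 → ℝ) : Prop where
  flow : MMPFlow (X 0) (X 1) (X 2) P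
  one_le_L : 1 ≤ L
  R_le : R ≤ L
  smF : ∀ k i j, Sm (F k i j)
  div : ∀ k j x, ∑ i, pd i (F k i j) x = X k j x
  pot : ∀ k i j, ∫ x in cube R, |F k i j x| ^ s ≤ A * L ^ (s / 3 + 2)

theorem SystemData.mono {s A L R : ℝ} {X : Fin 3 → Fin 3 → E3 → ℝ} {P : E3 → ℝ}
    {F : Fin 3 → Fin 3 → Fin 3 → E3 → ℝ} (h : SystemData s A L R X P F) (hs : 0 ≤ s) {r : ℝ}
    (hr : r ≤ R) : SystemData s A L r X P F where
  __ := h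
  R_le := hr.trans h.R_le
  pot k i j := (setIntegral_cube_mono hr ((h.smF k i j).continuous.abs.rpow_const fun _ => Or.inr hs)
    fun _ => Real.rpow_nonneg (abs_nonneg _) _).trans (h.pot k i j)

theorem SystemData.localData {s A L R d E : ℝ} {X : Fin 3 → Fin 3 → E3 → ℝ} {P : E3 → ℝ}
    {F : Fin 3 → Fin 3 → Fin 3 → E3 → ℝ} (h : SystemData s A L R X P F) (hd : 0 < d) (hdL : d ≤ L)
    (hE : 1 ≤ E) (hD : ∫ x in cube R, dens X x ≤ E) (k j : Fin 3) :
    LocalData s A L d R E (X k j) (fun i => F k i j) where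
  one_le_L := h.one_le_L
  d_pos := hd
  d_le := hdL
  R_le := h.R_le
  one_le_E := hE
  sm := h.flow.sm k j
  smF i := h.smF k i j
  div := h.div k j
  pot i := h.pot k i j
  energy i := (setIntegral_cube_le le_rfl (((h.flow.sm k j).pd i).continuous.pow 2)
    (continuous_dens h.flow.sm) (dens_nonneg X) fun x _ => pd_sq_le_dens X x k i j).trans hD

theorem exists_local_test_field {s A c : ℝ} (hs : 3 < s) (hs6 : s ≤ 6) (hA : 0 ≤ A) (hc : 1 ≤ c) :
    ∃ K : ℝ, 1 ≤ K ∧ ∀ {L R d E : ℝ} {X : Fin 3 → Fin 3 → E3 → ℝ} {P : E3 → ℝ}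
      {F : Fin 3 → Fin 3 → Fin 3 → E3 → ℝ}, SystemData s A L R X P F → 0 < d → 5 * d ≤ R →
      1 ≤ E → ∫ x in cube R, dens X x ≤ E → ∀ {φ : E3 → ℝ}, ScaleBound d c φ →
      Supp (R - 4 * d) φ → ∃ z₁ z₂ : Fin 3 → E3 → ℝ, (∀ i, Sm (z₁ i)) ∧ (∀ i, Sm (z₂ i)) ∧
        (∀ i, Supp (R - 3 * d) (z₁ i)) ∧ (∀ i, Supp (R - 3 * d) (z₂ i)) ∧
        (∀ x, ∑ i, (pd i (z₁ i) x + pd i (z₂ i) x) = ∑ j, X 0 j x * pd j φ x) ∧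
        (∀ i, ∫ x in cube (R - 3 * d), |z₁ i x| ^ s ≤
          K * (L / d) ^ 12 * (L⁻¹ ^ s * L ^ (s / 3 + 2))) ∧
        (∀ i k, ∫ x in cube (R - 3 * d), pd k (z₁ i) x ^ 2 ≤
          K * ((L / d) ^ 6 * E ^ (5 / 6 : ℝ))) ∧
        ∀ i k, ∫ x in cube (R - 3 * d), pd k (z₂ i) x ^ 2 ≤
          K * ((L / d) ^ 4 * (L ^ (-2 / 3 : ℝ) * E ^ (1 / 6 : ℝ))) := by
  obtain ⟨C, hC, htest⟩ := exists_test_field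
  obtain ⟨Cp, hCp, hpot⟩ := exists_potential_bound hs hs6 hA
  obtain ⟨Cq, hCq, hquad⟩ := exists_quadratic_bound hs hs6 hA
  have hCc : 1 ≤ C * c := by nlinarith
  refine ⟨(C * c) ^ 6 * (9 * A) + 324 * (C * c) ^ 2 * Cp + 2 * c ^ 2 * (1 + Cq), ?_, ?_⟩
  · have : 0 ≤ (C * c) ^ 6 * (9 * A) := by positivity
    have : 0 ≤ 2 * c ^ 2 * (1 + Cq) := by positivity
    have : 1 ≤ (C * c) ^ 2 * Cp := one_le_mul_of_one_le_of_one_le (one_le_pow₀ hCc) hCp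
    linarith
  intro L R d E X P F h hd hdR hE hD φ hφ hφs
  have hL := h.one_le_L
  have hL0 : 0 < L := by linarith
  have hE0 : 0 < E := by linarith
  have hRL := h.R_le
  have hdL : d ≤ L := by linarith
  have loc := fun k j => h.localData hd hdL hE hD k j
  set κ := L / d with hκ
  have κ1 : 1 ≤ κ := (one_le_div hd).2 hdL
  have κ0 : 0 < κ := by linarith
  have hdκ : d = L / κ := by rw [hκ]; field_simp
  set δ := d / 3 * (L ^ (-1 / 3 : ℝ) * E ^ (-5 / 12 : ℝ)) with hδ
  have δ0 : 0 < δ := by positivity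
  have δd : 3 * δ ≤ d := by
    have l1 : L ^ (-1 / 3 : ℝ) ≤ 1 := Real.rpow_le_one_of_one_le_of_nonpos hL (by norm_num)
    have l2 : E ^ (-5 / 12 : ℝ) ≤ 1 := Real.rpow_le_one_of_one_le_of_nonpos hE (by norm_num)
    have : L ^ (-1 / 3 : ℝ) * E ^ (-5 / 12 : ℝ) ≤ 1 :=
      mul_le_one₀ l1 (by positivity) l2
    rw [hδ]; nlinarith
  obtain ⟨z₁, z₂, sm₁, sm₂, su₁, su₂, hz, hp, hg₁, hg₂⟩ := htest L (R - 4 * d) d δ c hd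
    (by linarith) (by linarith) δ0 hc φ hφ hφs (F 0) (X 0) (h.smF 0) (h.flow.sm 0) (h.div 0)
    h.flow.div_u
  have su₁' := fun i => (su₁ i).mono (show R - 4 * d + 3 * δ ≤ R - 3 * d by linarith)
  have su₂' := fun i => (su₂ i).mono (show R - 4 * d + 3 * δ ≤ R - 3 * d by linarith)
  have hδsq : δ ^ 2 = d ^ 2 / 9 * (L ^ (-2 / 3 : ℝ) * E ^ (-5 / 6 : ℝ)) := by
    rw [hδ, mul_pow, mul_pow, ← Real.rpow_natCast (L ^ (_ : ℝ)), ← Real.rpow_natCast (E ^ (_ : ℝ)),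
      ← Real.rpow_mul hL0.le, ← Real.rpow_mul hE0.le]
    norm_num
    left; ring
  have hδinv : δ⁻¹ ^ 2 = 9 / d ^ 2 * (L ^ (2 / 3 : ℝ) * E ^ (5 / 6 : ℝ)) := by
    rw [inv_pow, hδsq, mul_inv, mul_inv, ← Real.rpow_neg hL0.le, ← Real.rpow_neg hE0.le, inv_div]
    norm_num
  have k1 : 0 ≤ (C * c) ^ 6 * (9 * A) := by positivity
  have k2 : 0 ≤ 324 * (C * c) ^ 2 * Cp := by positivity
  have k3 : 0 ≤ 2 * c ^ 2 * (1 + Cq) := by positivity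
  refine ⟨z₁, z₂, sm₁, sm₂, su₁', su₂', hz, fun i => ?_, fun i k => ?_, fun i k => ?_⟩
  · have hpow : ∀ i, Supp (R - 3 * d) fun x => |z₁ i x| ^ s := fun i x hx => by
      simp only [su₁' i x hx, abs_zero]
      exact Real.zero_rpow (by linarith)
    rw [(hpow i).integral_eq]
    refine (hp i s (by linarith)).trans ?_
    have hsum : ∑ i, ∑ j, ∫ x in cube (R - 4 * d), |F 0 i j x| ^ s ≤
        9 * (A * L ^ (s / 3 + 2)) := by
      refine (Finset.sum_le_sum fun i _ => Finset.sum_le_sum fun j _ =>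
        (h.mono (by linarith) (show R - 4 * d ≤ R by linarith)).pot 0 i j).trans ?_
      simp; linarith
    have e1 : C * c * (L / d ^ 2) = C * c * κ ^ 2 * L⁻¹ := by rw [hdκ]; field_simp
    have e2 : (C * c * κ ^ 2) ^ s ≤ (C * c) ^ 6 * κ ^ 12 := by
      have : 1 ≤ C * c * κ ^ 2 := one_le_mul_of_one_le_of_one_le hCc (one_le_pow₀ κ1)
      calc (C * c * κ ^ 2) ^ s ≤ (C * c * κ ^ 2) ^ (6 : ℝ) :=
            Real.rpow_le_rpow_of_exponent_le this hs6
        _ = (C * c) ^ 6 * κ ^ 12 := by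
            rw [show (6 : ℝ) = ((6 : ℕ) : ℝ) by norm_num, Real.rpow_natCast]; ring
    rw [e1, Real.mul_rpow (by positivity) (by positivity)]
    calc _ ≤ (C * c) ^ 6 * κ ^ 12 * L⁻¹ ^ s * (9 * (A * L ^ (s / 3 + 2))) := by gcongr
      _ = (C * c) ^ 6 * (9 * A) * (κ ^ 12 * (L⁻¹ ^ s * L ^ (s / 3 + 2))) := by ring
      _ ≤ _ := by
          rw [mul_assoc _ (κ ^ 12)]
          refine mul_le_mul_of_nonneg_right (by linarith) (by positivity)
  · have hsq : Supp (R - 3 * d) fun x => pd k (z₁ i) x ^ 2 := fun x hx => by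
      simp [(su₁' i).pd k x hx]
    rw [hsq.integral_eq]
    refine (hg₁ i k).trans ?_
    have hsum : ∑ i, ∑ j, ∫ x in cube (R - 4 * d), F 0 i j x ^ 2 ≤ 9 * (Cp * L ^ (10 / 3 : ℝ)) := by
      refine (Finset.sum_le_sum fun i _ => Finset.sum_le_sum fun j _ =>
        (hpot ((loc 0 j).mono (by linarith) (show R - 4 * d ≤ R by linarith)) i).1).trans ?_
      simp; linarith
    have e1 : L ^ (2 / 3 : ℝ) * L ^ (10 / 3 : ℝ) = L ^ 4 := by
      rw [← Real.rpow_add hL0, ← Real.rpow_natCast]; norm_num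
    rw [hδinv]
    calc _ ≤ 4 * (9 / d ^ 2 * (L ^ (2 / 3 : ℝ) * E ^ (5 / 6 : ℝ))) *
          ((C * c * (L / d ^ 2)) ^ 2 * (9 * (Cp * L ^ (10 / 3 : ℝ)))) := by gcongr
      _ = 324 * (C * c) ^ 2 * Cp * (L ^ 2 / d ^ 6 * (L ^ (2 / 3 : ℝ) * L ^ (10 / 3 : ℝ)) *
            E ^ (5 / 6 : ℝ)) := by field_simp; ring
      _ = 324 * (C * c) ^ 2 * Cp * (κ ^ 6 * E ^ (5 / 6 : ℝ)) := by
          rw [e1, hκ]; congr 2; field_simp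
      _ ≤ _ := mul_le_mul_of_nonneg_right (by linarith) (by positivity)
  · have hsq : Supp (R - 3 * d) fun x => pd k (z₂ i) x ^ 2 := fun x hx => by
      simp [(su₂' i).pd k x hx]
    rw [hsq.integral_eq]
    refine (hg₂ i k).trans ?_
    have s1 : ∑ j, ((d⁻¹) ^ 2 * ∫ x in cube (R - 4 * d), pd k (X 0 j) x ^ 2) ≤
        3 * (d⁻¹ ^ 2 * E) := by
      refine (Finset.sum_le_sum fun j _ => mul_le_mul_of_nonneg_left
        (((loc 0 j).mono (by linarith) (show R - 4 * d ≤ R by linarith)).energy k)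
        (by positivity)).trans ?_
      simp
    have s2 : ∑ j, ((d⁻¹) ^ 4 * ∫ x in cube (R - 4 * d), X 0 j x ^ 2) ≤
        3 * (d⁻¹ ^ 4 * (Cq * κ ^ 2 * (L ^ (5 / 3 : ℝ) * E ^ (1 / 2 : ℝ)))) := by
      refine (Finset.sum_le_sum fun j _ => mul_le_mul_of_nonneg_left
        ((setIntegral_cube_mono (show R - 4 * d ≤ R - d by linarith)
          ((h.flow.sm 0 j).continuous.pow 2) fun _ => sq_nonneg _).trans (hquad (loc 0 j)))
        (by positivity)).trans ?_
      simp [hκ]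
    have e1 : E ^ (-5 / 6 : ℝ) * E = E ^ (1 / 6 : ℝ) := by
      nth_rewrite 2 [← Real.rpow_one E]
      rw [← Real.rpow_add hE0]; norm_num
    have e2 : L ^ (-2 / 3 : ℝ) * L ^ (5 / 3 : ℝ) = L ^ 2 * L ^ (-1 : ℝ) := by
      rw [← Real.rpow_natCast, ← Real.rpow_add hL0, ← Real.rpow_add hL0]; norm_num
    have e3 : E ^ (-5 / 6 : ℝ) * E ^ (1 / 2 : ℝ) = E ^ (-1 / 3 : ℝ) := by
      rw [← Real.rpow_add hE0]; norm_num
    have l1 : L ^ (-1 : ℝ) ≤ L ^ (-2 / 3 : ℝ) := Real.rpow_le_rpow_of_exponent_le hL (by norm_num)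
    have l2 : E ^ (-1 / 3 : ℝ) ≤ E ^ (1 / 6 : ℝ) :=
      Real.rpow_le_rpow_of_exponent_le hE (by norm_num)
    rw [hδsq]
    calc _ ≤ d ^ 2 / 9 * (L ^ (-2 / 3 : ℝ) * E ^ (-5 / 6 : ℝ)) *
          (6 * c ^ 2 * (3 * (d⁻¹ ^ 2 * E)) +
            6 * c ^ 2 * (3 * (d⁻¹ ^ 4 * (Cq * κ ^ 2 * (L ^ (5 / 3 : ℝ) * E ^ (1 / 2 : ℝ)))))) := by
          gcongr
      _ = 2 * c ^ 2 * (L ^ (-2 / 3 : ℝ) * (E ^ (-5 / 6 : ℝ) * E) +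
            Cq * κ ^ 2 / d ^ 2 * (L ^ (-2 / 3 : ℝ) * L ^ (5 / 3 : ℝ)) *
              (E ^ (-5 / 6 : ℝ) * E ^ (1 / 2 : ℝ))) := by field_simp; ring
      _ = 2 * c ^ 2 * (1 * (L ^ (-2 / 3 : ℝ) * E ^ (1 / 6 : ℝ)) +
            Cq * (κ ^ 4 * (L ^ (-1 : ℝ) * E ^ (-1 / 3 : ℝ)))) := by
          rw [e1, e2, e3, hκ]; congr 2
          · ring
          · field_simp
      _ ≤ 2 * c ^ 2 * (κ ^ 4 * (L ^ (-2 / 3 : ℝ) * E ^ (1 / 6 : ℝ)) +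
            Cq * (κ ^ 4 * (L ^ (-2 / 3 : ℝ) * E ^ (1 / 6 : ℝ)))) := by
          gcongr
          exact one_le_pow₀ κ1
      _ = 2 * c ^ 2 * (1 + Cq) * (κ ^ 4 * (L ^ (-2 / 3 : ℝ) * E ^ (1 / 6 : ℝ))) := by ring
      _ ≤ _ := mul_le_mul_of_nonneg_right (by linarith) (by positivity)

theorem exists_energy_recursion {s A β : ℝ} (hs : 3 < s) (hs6 : s ≤ 6) (hA : 0 ≤ A)
    (hβ : 9 ≤ β * (s + 6)) (hβ' : 11 / 12 ≤ β) :
    ∃ C : ℝ, 1 ≤ C ∧ ∀ {L R d E : ℝ} {X : Fin 3 → Fin 3 → E3 → ℝ} {P : E3 → ℝ}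
      {F : Fin 3 → Fin 3 → Fin 3 → E3 → ℝ}, SystemData s A L R X P F → 0 < d → 5 * d ≤ R →
      1 ≤ E → ∫ x in cube R, dens X x ≤ E →
      ∫ x in cube (R - 5 * d), dens X x ≤ C * ((L / d) ^ 13 * E ^ β) := by
  obtain ⟨c, hc, hcut⟩ := exists_cutoff
  obtain ⟨K, hK, hfield⟩ := exists_local_test_field hs hs6 hA hc
  obtain ⟨Cq, hCq, hquad⟩ := exists_quadratic_bound hs hs6 hA
  obtain ⟨C₃, hC₃, hcub⟩ := exists_cubic_bound hs hs6 hA hβ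
  obtain ⟨C₄, hC₄, hquart⟩ := exists_quartic_bound hs hs6 hA hβ
  obtain ⟨Cw, hCw, hprod⟩ := exists_product_bound hs hs6 hA hβ
  refine ⟨3 * (60 * (3 * (3 * (c * Cq)) + c + 3 * (3 * (c * C₃))) +
    (30 * (3 * (3 * K) + 3 * (3 * K) + 1) + 18 * (3 * (3 * (3 * (Cw * (K + 1)))) + 1) +
      36 * (3 * (3 * C₄) + 3 * (3 * K)))), ?_, ?_⟩
  · have : 1 ≤ c * Cq := one_le_mul_of_one_le_of_one_le hc hCq
    have : 1 ≤ c * C₃ := one_le_mul_of_one_le_of_one_le hc hC₃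
    have : 0 ≤ Cw * (K + 1) := by positivity
    linarith
  intro L R d E X P F h hd hdR hE hD
  have hL := h.one_le_L
  have hL0 : 0 < L := by linarith
  have hE0 : 0 < E := by linarith
  have hRL := h.R_le
  have hdL : d ≤ L := by linarith
  have loc := fun k j => h.localData hd hdL hE hD k j
  obtain ⟨φ, hφ, φ0, -, φs, φe⟩ := hcut (R - 4 * d) d hd
  rw [show R - 4 * d - d = R - 5 * d by ring] at φe
  obtain ⟨z₁, z₂, sm₁, sm₂, su₁, su₂, hz, hzs, hg₁, hg₂⟩ := hfield h hd hdR hE hD hφ φs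
  set κ := L / d with hκ
  have κ1 : 1 ≤ κ := (one_le_div hd).2 hdL
  have κ0 : 0 < κ := by linarith
  set Z := κ ^ 13 * E ^ β with hZ
  have hcd : c / d = c * (κ * L ^ (-1 : ℝ)) := by
    rw [hκ, Real.rpow_neg_one]; field_simp
  have absorb : ∀ (n : ℕ) (q : ℝ), n ≤ 13 → q ≤ β → κ ^ n * E ^ q ≤ Z := fun n q hn hq =>
    mul_le_mul (pow_le_pow_right₀ κ1 hn) (Real.rpow_le_rpow_of_exponent_le hE hq)
      (by positivity) (by positivity)
  have hW : ∀ l k j, ∫ x in cube (R - 3 * d), z₁ l x ^ 2 * X k j x ^ 2 ≤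
      E ^ (β - 1) * (Cw * (K * κ ^ 12 + κ ^ 12) * E ^ β) := fun l k j => by
    have w := mul_le_mul_of_nonneg_left (hprod (loc k j) (sm₁ l).continuous (hzs l))
      (show 0 ≤ E ^ (β - 1) by positivity)
    rwa [← mul_assoc, ← Real.rpow_add hE0, show β - 1 + (1 - β) = 0 by ring, Real.rpow_zero,
      one_mul] at w
  have main := local_energy_le h.flow (show R - 5 * d ≤ R - 3 * d by linarith) hd
    (by linarith) hφ φ0 (φs.mono (by linarith)) φe sm₁ sm₂ su₁ su₂ hz
    (σ := L ^ (-1 : ℝ) * E ^ (1 / 4 : ℝ)) (τ := E ^ (1 / 12 : ℝ))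
    (t := L ^ (-2 / 3 : ℝ) * E ^ (-5 / 12 - β / 3)) (t' := E ^ (1 - β))
    (by positivity) (by positivity) (by positivity) (by positivity)
    (fun k j => (setIntegral_cube_mono (show R - 3 * d ≤ R - d by linarith)
      ((h.flow.sm k j).continuous.pow 2) fun _ => sq_nonneg _).trans (hquad (loc k j)))
    ((setIntegral_cube_mono (by linarith) (continuous_dens h.flow.sm) (dens_nonneg X)).trans hD)
    (fun k j => hcub (loc k j)) hg₁ hg₂ hW (fun k j => hquart (loc k j))
  have split : ∀ q : ℝ, E * E ^ q = E ^ (1 + q) := fun q => by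
    rw [Real.rpow_add hE0, Real.rpow_one]
  have a1 : c / d * (L ^ (-1 : ℝ) * E ^ (1 / 4 : ℝ) *
      (Cq * κ ^ 2 * (L ^ (5 / 3 : ℝ) * E ^ (1 / 2 : ℝ)))) ≤ c * Cq * Z := by
    have e1 : L ^ (-1 : ℝ) * (L ^ (-1 : ℝ) * L ^ (5 / 3 : ℝ)) ≤ 1 := by
      rw [← Real.rpow_add hL0, ← Real.rpow_add hL0]
      exact Real.rpow_le_one_of_one_le_of_nonpos hL (by norm_num)
    have e2 : E ^ (1 / 4 : ℝ) * E ^ (1 / 2 : ℝ) = E ^ (3 / 4 : ℝ) := by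
      rw [← Real.rpow_add hE0]; norm_num
    calc _ = c * Cq * ((L ^ (-1 : ℝ) * (L ^ (-1 : ℝ) * L ^ (5 / 3 : ℝ))) *
          (κ ^ 3 * (E ^ (1 / 4 : ℝ) * E ^ (1 / 2 : ℝ)))) := by rw [hcd]; ring
      _ ≤ c * Cq * (1 * (κ ^ 3 * E ^ (3 / 4 : ℝ))) := by rw [e2]; gcongr
      _ ≤ _ := by
        rw [one_mul]
        exact mul_le_mul_of_nonneg_left (absorb 3 _ (by norm_num) (by linarith)) (by positivity)
  have a2 : c / d * ((L ^ (-1 : ℝ) * E ^ (1 / 4 : ℝ))⁻¹ * E) ≤ c * Z := by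
    calc _ = c * (κ ^ 1 * (E ^ (-(1 / 4) : ℝ) * E)) := by
          rw [hcd, mul_inv, ← Real.rpow_neg hE0.le]; field_simp
      _ = c * (κ ^ 1 * E ^ (3 / 4 : ℝ)) := by rw [mul_comm _ E, split]; norm_num
      _ ≤ _ := mul_le_mul_of_nonneg_left (absorb 1 _ (by norm_num) (by linarith)) (by positivity)
  have a3 : c / d * (C₃ * κ ^ 12 * (L * E ^ β)) ≤ c * C₃ * Z := by
    refine le_of_eq ?_
    rw [hcd, Real.rpow_neg_one, hZ]; field_simp
  have a4 : E ^ (1 / 12 : ℝ) * (K * (κ ^ 6 * E ^ (5 / 6 : ℝ))) ≤ K * Z := by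
    calc _ = K * (κ ^ 6 * (E ^ (1 / 12 : ℝ) * E ^ (5 / 6 : ℝ))) := by ring
      _ = K * (κ ^ 6 * E ^ (11 / 12 : ℝ)) := by rw [← Real.rpow_add hE0]; norm_num
      _ ≤ _ := mul_le_mul_of_nonneg_left (absorb 6 _ (by norm_num) hβ') (by positivity)
  have a5 : E ^ (1 / 12 : ℝ) * (K * (κ ^ 4 * (L ^ (-2 / 3 : ℝ) * E ^ (1 / 6 : ℝ)))) ≤ K * Z := by
    have e1 : L ^ (-2 / 3 : ℝ) ≤ 1 := Real.rpow_le_one_of_one_le_of_nonpos hL (by norm_num)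
    calc _ ≤ E ^ (1 / 12 : ℝ) * (K * (κ ^ 4 * (1 * E ^ (1 / 6 : ℝ)))) := by gcongr
      _ = K * (κ ^ 4 * (E ^ (1 / 12 : ℝ) * E ^ (1 / 6 : ℝ))) := by ring
      _ = K * (κ ^ 4 * E ^ (1 / 4 : ℝ)) := by rw [← Real.rpow_add hE0]; norm_num
      _ ≤ _ := mul_le_mul_of_nonneg_left (absorb 4 _ (by norm_num) (by linarith)) (by positivity)
  have a6 : (E ^ (1 / 12 : ℝ))⁻¹ * E ≤ Z := by
    calc _ = κ ^ 0 * E ^ (11 / 12 : ℝ) := by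
          rw [← Real.rpow_neg hE0.le, mul_comm, split]; norm_num
      _ ≤ _ := absorb 0 _ (by norm_num) hβ'
  have inv' : (E ^ (1 - β))⁻¹ = E ^ (β - 1) := by rw [← Real.rpow_neg hE0.le, neg_sub]
  have a7 : E ^ (1 - β) * (E ^ (β - 1) * (Cw * (K * κ ^ 12 + κ ^ 12) * E ^ β)) ≤
      Cw * (K + 1) * Z := by
    calc _ = E ^ (1 - β) * E ^ (β - 1) * (Cw * (K + 1) * (κ ^ 12 * E ^ β)) := by ring
      _ = Cw * (K + 1) * (κ ^ 12 * E ^ β) := by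
          rw [← inv', mul_inv_cancel₀ (by positivity), one_mul]
      _ ≤ _ := mul_le_mul_of_nonneg_left (absorb 12 _ (by norm_num) le_rfl) (by positivity)
  have a8 : (E ^ (1 - β))⁻¹ * E ≤ Z := by
    calc _ = κ ^ 0 * E ^ β := by rw [inv', mul_comm, split]; norm_num
      _ ≤ _ := absorb 0 _ (by norm_num) le_rfl
  have a9 : L ^ (-2 / 3 : ℝ) * E ^ (-5 / 12 - β / 3) *
      (C₄ * κ ^ 12 * (L ^ (2 / 3 : ℝ) * E ^ (1 + 2 * β / 3))) ≤ C₄ * Z := by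
    have e1 : L ^ (-2 / 3 : ℝ) * L ^ (2 / 3 : ℝ) = 1 := by
      rw [← Real.rpow_add hL0]; norm_num
    have e2 : E ^ (-5 / 12 - β / 3) * E ^ (1 + 2 * β / 3) = E ^ (7 / 12 + β / 3) := by
      rw [← Real.rpow_add hE0]; congr 1; ring
    calc _ = C₄ * (κ ^ 12 * (L ^ (-2 / 3 : ℝ) * L ^ (2 / 3 : ℝ) *
          (E ^ (-5 / 12 - β / 3) * E ^ (1 + 2 * β / 3)))) := by ring
      _ = C₄ * (κ ^ 12 * E ^ (7 / 12 + β / 3)) := by rw [e1, e2, one_mul]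
      _ ≤ _ := mul_le_mul_of_nonneg_left (absorb 12 _ (by norm_num) (by linarith)) (by positivity)
  have a10 : (L ^ (-2 / 3 : ℝ) * E ^ (-5 / 12 - β / 3))⁻¹ *
      (K * (κ ^ 4 * (L ^ (-2 / 3 : ℝ) * E ^ (1 / 6 : ℝ)))) ≤ K * Z := by
    have e2 : (E ^ (-5 / 12 - β / 3))⁻¹ * E ^ (1 / 6 : ℝ) = E ^ (7 / 12 + β / 3) := by
      rw [← Real.rpow_neg hE0.le, ← Real.rpow_add hE0]; congr 1; ring
    calc _ = K * (κ ^ 4 * ((E ^ (-5 / 12 - β / 3))⁻¹ * E ^ (1 / 6 : ℝ))) := by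
          rw [mul_inv]; field_simp
      _ = K * (κ ^ 4 * E ^ (7 / 12 + β / 3)) := by rw [e2]
      _ ≤ _ := mul_le_mul_of_nonneg_left (absorb 4 _ (by norm_num) (by linarith)) (by positivity)
  refine main.trans ?_
  nlinarith only [a1, a2, a3, a4, a5, a6, a7, a8, a9, a10]

/-! ### Iteration -/

theorem exists_iteration_bound {C A β : ℝ} (hC : 1 ≤ C) (hA : 1 ≤ A) (hβ0 : 0 ≤ β) (hβ1 : β < 1) :
    ∃ K : ℝ, 1 ≤ K ∧ ∀ {e : ℕ → ℝ} {M : ℝ}, (∀ n, 0 ≤ e n) → (∀ n, e n ≤ M) →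
      (∀ n, e n ≤ C * A ^ n * e (n + 1) ^ β) → e 0 ≤ K := by
  have hβ : 0 < 1 - β := by linarith
  have hexp : 0 ≤ 1 / (1 - β) := by positivity
  set B := A ^ (1 / (1 - β)) with hB
  have B1 : 1 ≤ B := Real.one_le_rpow hA hexp
  have hCB : 1 ≤ C * B ^ β := one_le_mul_of_one_le_of_one_le hC (Real.one_le_rpow B1 hβ0)
  set K := (C * B ^ β) ^ (1 / (1 - β)) with hK
  have K1 : 1 ≤ K := Real.one_le_rpow hCB hexp
  have K0 : 0 < K := by linarith
  have B0 : 0 < B := by linarith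
  have fix : ∀ {a : ℝ}, 1 ≤ a → a * (a ^ (1 / (1 - β))) ^ β = a ^ (1 / (1 - β)) := fun {a} ha => by
    have a0 : 0 < a := by linarith
    nth_rewrite 1 [← Real.rpow_one a]
    rw [← Real.rpow_mul a0.le, ← Real.rpow_add a0]
    congr 1
    field_simp
    ring
  have fB : A * B ^ β = B := fix hA
  have fK : C * B ^ β * K ^ β = K := fix hCB
  refine ⟨K, K1, fun {e M} he hM hrec => ?_⟩
  set M' := max M 1 with hM'
  have M1 : 1 ≤ M' := le_max_right _ _
  have M0 : 0 < M' := by linarith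
  have main : ∀ n k : ℕ, e k ≤ K * B ^ k * M' ^ (β ^ n) := by
    intro n
    induction n with
    | zero =>
      intro k
      have : 1 ≤ K * B ^ k := one_le_mul_of_one_le_of_one_le K1 (one_le_pow₀ B1)
      rw [pow_zero, Real.rpow_one]
      exact ((hM k).trans (le_max_left _ _)).trans (le_mul_of_one_le_left M0.le this)
    | succ n ih =>
      intro k
      have p : (B ^ (k + 1)) ^ β = B ^ β * (B ^ β) ^ k := by
        rw [← Real.rpow_natCast B, ← Real.rpow_mul B0.le, mul_comm, Real.rpow_mul B0.le,
          Real.rpow_natCast, pow_succ, mul_comm]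
      calc e k ≤ C * A ^ k * e (k + 1) ^ β := hrec k
        _ ≤ C * A ^ k * (K * B ^ (k + 1) * M' ^ (β ^ n)) ^ β := by
            gcongr
            · exact he _
            · exact ih _
        _ = (C * B ^ β * K ^ β) * (A * B ^ β) ^ k * M' ^ (β ^ (n + 1)) := by
            rw [Real.mul_rpow (by positivity) (by positivity),
              Real.mul_rpow (by positivity) (by positivity), ← Real.rpow_mul M0.le, p, mul_pow,
              ← pow_succ]
            ring
        _ = _ := by rw [fK, fB]
  have lim : Tendsto (fun n : ℕ => K * B ^ 0 * M' ^ (β ^ n)) atTop (𝓝 (K * B ^ 0 * M' ^ (0 : ℝ))) :=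
    (tendsto_const_nhds.rpow (tendsto_pow_atTop_nhds_zero_of_lt_one hβ0 hβ1)
      (Or.inl M0.ne')).const_mul _
  have := ge_of_tendsto' lim fun n => main n 0
  simpa using this

theorem exists_energy_bound {s A : ℝ} (hs : 3 < s) (hs6 : s ≤ 6) (hA : 0 ≤ A) :
    ∃ K : ℝ, 1 ≤ K ∧ ∀ {L : ℝ} {X : Fin 3 → Fin 3 → E3 → ℝ} {P : E3 → ℝ}
      {F : Fin 3 → Fin 3 → Fin 3 → E3 → ℝ}, SystemData s A L L X P F →
      ∫ x in cube (L / 2), dens X x ≤ K := by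
  set β := max (11 / 12) (9 / (s + 6)) with hβ
  have b1 : 11 / 12 ≤ β := le_max_left _ _
  have b2 : 9 ≤ β * (s + 6) := (div_le_iff₀ (by linarith)).1 (le_max_right _ _)
  have b3 : β < 1 := max_lt (by norm_num) ((div_lt_one (by linarith)).2 (by linarith))
  obtain ⟨C, hC, hrec⟩ := exists_energy_recursion hs hs6 hA b2 b1
  obtain ⟨K, hK, hiter⟩ := exists_iteration_bound (C := 2 * C * 20 ^ 13) (A := 2 ^ 13) (β := β)
    (by linarith) (by norm_num) (by linarith) b3
  refine ⟨K, hK, fun {L X P F} h => ?_⟩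
  have hL0 : 0 < L := by linarith [h.one_le_L]
  have hc := continuous_dens h.flow.sm
  set r : ℕ → ℝ := fun n => L - L / 2 ^ (n + 1) with hr
  have hrL : ∀ n, r n ≤ L := fun n => by
    have : 0 ≤ L / 2 ^ (n + 1) := by positivity
    simp only [hr]; linarith
  have hr0 : ∀ n, 0 ≤ r n := fun n => sub_nonneg.2 (div_le_self hL0.le (one_le_pow₀ (by norm_num)))
  have D0 : ∀ n, 0 ≤ ∫ x in cube (r n), dens X x := fun n =>
    integral_nonneg fun x => dens_nonneg X x
  have := hiter (e := fun n => 1 + ∫ x in cube (r n), dens X x)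
    (M := 1 + ∫ x in cube L, dens X x) (fun n => by linarith [D0 n])
    (fun n => by linarith [setIntegral_cube_mono (hrL n) hc (dens_nonneg X)]) (fun n => by
      have E1 : 1 ≤ 1 + ∫ x in cube (r (n + 1)), dens X x := by linarith [D0 (n + 1)]
      have hdiff : r (n + 1) - 5 * (L / (20 * 2 ^ n)) = r n := by
        simp only [hr, pow_succ]; field_simp; ring
      have step := hrec (h.mono (by linarith) (hrL (n + 1))) (d := L / (20 * 2 ^ n))
        (by positivity) (by linarith [hr0 n]) E1 (by linarith)
      rw [hdiff, show L / (L / (20 * 2 ^ n)) = 20 * 2 ^ n by field_simp] at step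
      have one : 1 ≤ C * 20 ^ 13 * (2 ^ 13) ^ n * (1 + ∫ x in cube (r (n + 1)), dens X x) ^ β :=
        one_le_mul_of_one_le_of_one_le (one_le_mul_of_one_le_of_one_le (by linarith)
          (one_le_pow₀ (by norm_num))) (Real.one_le_rpow E1 (by linarith))
      have e1 : ((20 : ℝ) * 2 ^ n) ^ 13 = 20 ^ 13 * (2 ^ 13) ^ n := by
        rw [mul_pow, ← pow_mul, ← pow_mul, mul_comm n]
      rw [e1] at step
      linarith)
  have e0 : r 0 = L / 2 := by simp only [hr]; ring
  simp only [e0] at this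
  linarith

theorem exists_cubic_linear_bound {s A : ℝ} (hs : 3 < s) (hs6 : s ≤ 6) (hA : 0 ≤ A) :
    ∃ C : ℝ, ∀ {L : ℝ} {X : Fin 3 → Fin 3 → E3 → ℝ} {P : E3 → ℝ}
      {F : Fin 3 → Fin 3 → Fin 3 → E3 → ℝ}, SystemData s A L L X P F → ∀ k j,
      ∫ x in cube (L / 4), |X k j x| ^ 3 ≤ C * L := by
  obtain ⟨K, hK, hbound⟩ := exists_energy_bound hs hs6 hA
  obtain ⟨C, hC, hcub⟩ := exists_cubic_bound hs hs6 hA (β := 1) (by linarith)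
  refine ⟨C * 12 ^ 12 * K, fun {L X P F} h k j => ?_⟩
  have hL0 : 0 < L := by linarith [h.one_le_L]
  have := hcub ((h.mono (by linarith) (show L / 2 ≤ L by linarith)).localData (d := L / 12)
    (by positivity) (by linarith) hK (hbound h) k j)
  rw [show L / 2 - 3 * (L / 12) = L / 4 by ring, show L / (L / 12) = 12 by field_simp,
    Real.rpow_one] at this
  linarith

/-! ### The potential growth hypothesis -/

theorem abs_le_frob (A : Fin 3 → Fin 3 → ℝ) (i j : Fin 3) : |A i j| ≤ frob A := by
  refine Real.abs_le_sqrt ?_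
  exact (Finset.single_le_sum (f := fun j => A i j ^ 2) (fun _ _ => sq_nonneg _)
    (Finset.mem_univ j)).trans (Finset.single_le_sum (f := fun i => ∑ j, A i j ^ 2)
    (fun _ _ => Finset.sum_nonneg fun _ _ => sq_nonneg _) (Finset.mem_univ i))

theorem integrableOn_ball3 {f : E3 → ℝ} (hf : Continuous f) (r : ℝ) : IntegrableOn f (ball3 r) :=
  (hf.continuousOn.integrableOn_compact (isCompact_closedBall (0 : E3) r)).mono_set
    ball_subset_closedBall

theorem volume_ball3 {r : ℝ} (hr : 0 ≤ r) :
    (volume (ball3 r)).toReal = r ^ 3 * (volume (ball3 1)).toReal := by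
  rw [ball3, ball3, Measure.addHaar_ball _ _ hr, ENNReal.toReal_mul,
    ENNReal.toReal_ofReal (by positivity)]
  simp

theorem meanOsc_nonneg (Φ : E3 → Fin 3 → Fin 3 → ℝ) (s r : ℝ) : 0 ≤ meanOsc Φ s r :=
  Real.rpow_nonneg (mul_nonneg (inv_nonneg.2 ENNReal.toReal_nonneg)
    (integral_nonneg fun _ => Real.rpow_nonneg (Real.sqrt_nonneg _) _)) _

theorem setIntegral_cube_sub_mavg_le {Φ : E3 → Fin 3 → Fin 3 → ℝ} {s C₀ L : ℝ}
    (hΦ : ∀ i j, Continuous fun x => Φ x i j) (hs : 3 < s) (hC₀ : 0 < C₀) (hL : 1 ≤ L)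
    (hosc : meanOsc Φ s (3 * L) ≤ C₀ * (3 * L) ^ ((1 : ℝ) / 3 - 1 / s)) (i j : Fin 3) :
    ∫ x in cube L, |Φ x i j - mavg Φ (3 * L) i j| ^ s ≤
      ((volume (ball3 1)).toReal * (C₀ ^ s * 3 ^ (s / 3 + 2))) * L ^ (s / 3 + 2) := by
  have hs0 : 0 < s := by linarith
  have hr : 0 < 3 * L := by linarith
  have hL0 : 0 < L := by linarith
  have v1 : 0 < (volume (ball3 1)).toReal :=
    ENNReal.toReal_pos (measure_ball_pos _ _ one_pos).ne' measure_ball_lt_top.ne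
  have v : 0 < (volume (ball3 (3 * L))).toReal := by rw [volume_ball3 hr.le]; positivity
  set G : E3 → ℝ := fun x => (frob fun i j => Φ x i j - mavg Φ (3 * L) i j) ^ s with hG
  have cG : Continuous G := by
    refine Continuous.rpow_const (Real.continuous_sqrt.comp ?_) fun _ => Or.inr hs0.le
    exact continuous_finsetSum _ fun i _ => continuous_finsetSum _ fun j _ =>
      ((hΦ i j).sub continuous_const).pow 2
  have G0 : ∀ x, 0 ≤ G x := fun x => Real.rpow_nonneg (Real.sqrt_nonneg _) _
  set m := (volume (ball3 (3 * L))).toReal⁻¹ * ∫ x in ball3 (3 * L), G x with hm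
  have m0 : 0 ≤ m := mul_nonneg (inv_nonneg.2 v.le) (integral_nonneg G0)
  have hm' : m ≤ (C₀ * (3 * L) ^ ((1 : ℝ) / 3 - 1 / s)) ^ s := by
    have := Real.rpow_le_rpow (Real.rpow_nonneg m0 _) (show m ^ (1 / s) ≤ _ from hosc) hs0.le
    rwa [← Real.rpow_mul m0, one_div_mul_cancel hs0.ne', Real.rpow_one] at this
  have hInt : ∫ x in ball3 (3 * L), G x = (volume (ball3 (3 * L))).toReal * m := by
    rw [hm, mul_inv_cancel_left₀ v.ne']
  calc ∫ x in cube L, |Φ x i j - mavg Φ (3 * L) i j| ^ s ≤ ∫ x in cube L, G x := by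
        refine integral_mono (integrableOn_cube ((((hΦ i j).sub continuous_const).abs).rpow_const
          fun _ => Or.inr hs0.le) L) (integrableOn_cube cG L) fun x => ?_
        exact Real.rpow_le_rpow (abs_nonneg _)
          (abs_le_frob (fun i j => Φ x i j - mavg Φ (3 * L) i j) i j) hs0.le
    _ ≤ ∫ x in ball3 (3 * L), G x := setIntegral_mono_set (integrableOn_ball3 cG _)
        (Eventually.of_forall G0) (cube_subset_ball hL0.le (by linarith)).eventuallyLE
    _ ≤ (volume (ball3 (3 * L))).toReal * (C₀ * (3 * L) ^ ((1 : ℝ) / 3 - 1 / s)) ^ s := by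
        rw [hInt]; gcongr
    _ = (volume (ball3 1)).toReal * (C₀ ^ s * ((3 * L) ^ ((3 : ℕ) : ℝ) *
          (3 * L) ^ ((1 / 3 - 1 / s) * s))) := by
        rw [volume_ball3 hr.le, Real.mul_rpow hC₀.le (by positivity), ← Real.rpow_mul hr.le,
          Real.rpow_natCast]
        ring
    _ = _ := by
        rw [← Real.rpow_add hr, show ((3 : ℕ) : ℝ) + (1 / 3 - 1 / s) * s = s / 3 + 2 by
          push_cast; field_simp; ring, Real.mul_rpow (by norm_num) hL0.le]
        ring

theorem systemData_of_meanOsc {u w b : E3 → E3} {P : E3 → ℝ} (hsol : IsMMPSolution u w b P)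
    {Φ Ψ Υ : E3 → Fin 3 → Fin 3 → ℝ}
    (hΦ : ∀ i j, ContDiff ℝ (⊤ : ℕ∞) (fun x => Φ x i j))
    (hΨ : ∀ i j, ContDiff ℝ (⊤ : ℕ∞) (fun x => Ψ x i j))
    (hΥ : ∀ i j, ContDiff ℝ (⊤ : ℕ∞) (fun x => Υ x i j))
    (hΦu : ∀ (x : E3) (j : Fin 3), mdiv Φ x j = u x j)
    (hΨb : ∀ (x : E3) (j : Fin 3), mdiv Ψ x j = b x j)
    (hΥw : ∀ (x : E3) (j : Fin 3), mdiv Υ x j = w x j)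
    {s C₀ L : ℝ} (hs : 3 < s) (hC₀ : 0 < C₀) (hL : 1 ≤ L)
    (hosc : meanOsc Φ s (3 * L) + meanOsc Ψ s (3 * L) + meanOsc Υ s (3 * L) ≤
      C₀ * (3 * L) ^ ((1 : ℝ) / 3 - 1 / s)) :
    SystemData s ((volume (ball3 1)).toReal * (C₀ ^ s * 3 ^ (s / 3 + 2))) L L
      ![fun j x => u x j, fun j x => w x j, fun j x => b x j] P
      ![fun i j x => Φ x i j - mavg Φ (3 * L) i j, fun i j x => Υ x i j - mavg Υ (3 * L) i j,
        fun i j x => Ψ x i j - mavg Ψ (3 * L) i j] := by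
  have n1 := meanOsc_nonneg Φ s (3 * L)
  have n2 := meanOsc_nonneg Ψ s (3 * L)
  have n3 := meanOsc_nonneg Υ s (3 * L)
  have key : ∀ {G : E3 → Fin 3 → Fin 3 → ℝ} (_ : ∀ i j, ContDiff ℝ (⊤ : ℕ∞) (fun x => G x i j))
      (a : Fin 3 → Fin 3 → ℝ) (x : E3) (j : Fin 3),
      ∑ i, pd i (fun x => G x i j - a i j) x = mdiv G x j := fun {G} hG a x j =>
    Finset.sum_congr rfl fun i _ => by
      rw [pd_sub (Sm.diff (hG i j) x) (differentiableAt_const _) i, pd_const, sub_zero]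
  refine ⟨hsol.flow, hL, le_rfl, fun k i j => ?_, fun k j x => ?_, fun k i j => ?_⟩ <;> fin_cases k
  · exact (hΦ i j).sub contDiff_const
  · exact (hΥ i j).sub contDiff_const
  · exact (hΨ i j).sub contDiff_const
  · exact (key hΦ _ x j).trans (hΦu x j)
  · exact (key hΥ _ x j).trans (hΥw x j)
  · exact (key hΨ _ x j).trans (hΨb x j)
  · exact setIntegral_cube_sub_mavg_le (fun i j => (hΦ i j).continuous) hs hC₀ hL (by linarith) i j
  · exact setIntegral_cube_sub_mavg_le (fun i j => (hΥ i j).continuous) hs hC₀ hL (by linarith) i j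
  · exact setIntegral_cube_sub_mavg_le (fun i j => (hΨ i j).continuous) hs hC₀ hL (by linarith) i j

/-! ### Annulus estimates -/

theorem norm_pow_three_le (v : E3) : ‖v‖ ^ 3 ≤ 9 * ∑ j, |v j| ^ 3 := by
  have h1 : ‖v‖ ≤ |v 0| + |v 1| + |v 2| := by
    rw [EuclideanSpace.norm_eq, Real.sqrt_le_left (by positivity), Fin.sum_univ_three]
    simp only [Real.norm_eq_abs]
    nlinarith [mul_nonneg (abs_nonneg (v 0)) (abs_nonneg (v 1)),
      mul_nonneg (abs_nonneg (v 0)) (abs_nonneg (v 2)),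
      mul_nonneg (abs_nonneg (v 1)) (abs_nonneg (v 2))]
  have h2 : (|v 0| + |v 1| + |v 2|) ^ 3 ≤ 9 * ∑ j, |v j| ^ 3 := by
    have := Real.pow_arith_mean_le_arith_mean_pow Finset.univ (fun _ => (1 / 3 : ℝ))
      (fun j => |v j|) (fun _ _ => by norm_num) (by norm_num) (fun j _ => abs_nonneg (v j)) 3
    simp only [Fin.sum_univ_three] at this ⊢
    nlinarith
  exact (pow_le_pow_left₀ (norm_nonneg v) h1 3).trans h2

theorem sq_le_sq_add_cube {T a : ℝ} (hT : 0 < T) (ha : 0 ≤ a) : a ^ 2 ≤ T ^ 2 + T⁻¹ * a ^ 3 := by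
  rcases le_total a T with h | h
  · have : 0 ≤ T⁻¹ * a ^ 3 := by positivity
    nlinarith
  · have : a ^ 2 ≤ T⁻¹ * a ^ 3 := by
      rw [inv_mul_eq_div, le_div_iff₀ hT]
      nlinarith [sq_nonneg a]
    nlinarith [sq_nonneg T]

theorem quadratic_annulus_le {u w b : E3 → E3} (hu : Continuous u) (hw : Continuous w)
    (hb : Continuous b) {M ρ : ℝ} (hρ : 0 < ρ)
    (hM : ∫ x in ball3 (2 * ρ) \ ball3 ρ, (‖u x‖ ^ 3 + ‖b x‖ ^ 3 + ‖w x‖ ^ 3) ≤ M * ρ) :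
    (ρ ^ 2)⁻¹ * ∫ x in ball3 (2 * ρ) \ ball3 ρ, (‖u x‖ ^ 2 + ‖b x‖ ^ 2 + ‖w x‖ ^ 2) ≤
      (24 * (volume (ball3 1)).toReal + M) * ρ ^ (-(1 / 3) : ℝ) := by
  set S := ball3 (2 * ρ) \ ball3 ρ with hS
  set T := ρ ^ (-(2 / 3) : ℝ) with hT
  have T0 : 0 < T := by positivity
  have c2 : Continuous fun x => ‖u x‖ ^ 2 + ‖b x‖ ^ 2 + ‖w x‖ ^ 2 := by fun_prop
  have c3 : Continuous fun x => ‖u x‖ ^ 3 + ‖b x‖ ^ 3 + ‖w x‖ ^ 3 := by fun_prop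
  have hInt : ∀ {f : E3 → ℝ}, Continuous f → IntegrableOn f S := fun hf =>
    (integrableOn_ball3 hf (2 * ρ)).mono_set Set.sdiff_subset
  have I3 : IntegrableOn (fun x => T⁻¹ * (‖u x‖ ^ 3 + ‖b x‖ ^ 3 + ‖w x‖ ^ 3)) S :=
    hInt (continuous_const.mul c3)
  have I0 : IntegrableOn (fun _ : E3 => 3 * T ^ 2) S := hInt continuous_const
  have hvol : volume.real S ≤ 8 * ρ ^ 3 * (volume (ball3 1)).toReal := by
    have : volume.real S ≤ (volume (ball3 (2 * ρ))).toReal :=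
      measureReal_mono Set.sdiff_subset measure_ball_lt_top.ne
    rw [volume_ball3 (by linarith)] at this
    linarith
  have key : ∫ x in S, (‖u x‖ ^ 2 + ‖b x‖ ^ 2 + ‖w x‖ ^ 2) ≤
      3 * T ^ 2 * (8 * ρ ^ 3 * (volume (ball3 1)).toReal) + T⁻¹ * (M * ρ) := by
    calc _ ≤ ∫ x in S, (3 * T ^ 2 + T⁻¹ * (‖u x‖ ^ 3 + ‖b x‖ ^ 3 + ‖w x‖ ^ 3)) := by
          refine integral_mono (hInt c2) (I0.add I3) fun x => ?_
          have h1 := sq_le_sq_add_cube T0 (norm_nonneg (u x))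
          have h2 := sq_le_sq_add_cube T0 (norm_nonneg (b x))
          have h3 := sq_le_sq_add_cube T0 (norm_nonneg (w x))
          dsimp only
          linarith
      _ = 3 * T ^ 2 * volume.real S +
            T⁻¹ * ∫ x in S, (‖u x‖ ^ 3 + ‖b x‖ ^ 3 + ‖w x‖ ^ 3) := by
          rw [integral_add I0 I3, setIntegral_const, smul_eq_mul, integral_const_mul]
          ring
      _ ≤ _ := by gcongr
  have e1 : (ρ ^ 2)⁻¹ * (T ^ 2 * ρ ^ 3) = ρ ^ (-(1 / 3) : ℝ) := by
    rw [hT, ← Real.rpow_natCast ρ, ← Real.rpow_natCast ρ, ← Real.rpow_natCast (_ ^ (_ : ℝ)),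
      ← Real.rpow_neg hρ.le, ← Real.rpow_mul hρ.le, ← Real.rpow_add hρ, ← Real.rpow_add hρ]
    norm_num
  have e2 : (ρ ^ 2)⁻¹ * (T⁻¹ * ρ) = ρ ^ (-(1 / 3) : ℝ) := by
    rw [hT, ← Real.rpow_natCast ρ, ← Real.rpow_neg hρ.le, ← Real.rpow_neg hρ.le]
    nth_rewrite 3 [← Real.rpow_one ρ]
    rw [← Real.rpow_add hρ, ← Real.rpow_add hρ]
    norm_num
  calc _ ≤ (ρ ^ 2)⁻¹ * (3 * T ^ 2 * (8 * ρ ^ 3 * (volume (ball3 1)).toReal) + T⁻¹ * (M * ρ)) := by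
        gcongr
    _ = 24 * (volume (ball3 1)).toReal * ((ρ ^ 2)⁻¹ * (T ^ 2 * ρ ^ 3)) +
          M * ((ρ ^ 2)⁻¹ * (T⁻¹ * ρ)) := by ring
    _ = _ := by rw [e1, e2]; ring

theorem cubic_annulus_le {s A L C : ℝ} {u w b : E3 → E3} {P : E3 → ℝ}
    {F : Fin 3 → Fin 3 → Fin 3 → E3 → ℝ}
    (h : SystemData s A L L ![fun j x => u x j, fun j x => w x j, fun j x => b x j] P F)
    (hC : ∀ k j, ∫ x in cube (L / 4), |(![fun j x => u x j, fun j x => w x j, fun j x => b x j] :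
      Fin 3 → Fin 3 → E3 → ℝ) k j x| ^ 3 ≤ C * L)
    (hu : Continuous u) (hw : Continuous w) (hb : Continuous b) (r : ℝ) :
    ∫ x in ball3 (L / 4) \ ball3 r, (‖u x‖ ^ 3 + ‖b x‖ ^ 3 + ‖w x‖ ^ 3) ≤
      9 * (3 * (3 * (C * L))) := by
  set X : Fin 3 → Fin 3 → E3 → ℝ := ![fun j x => u x j, fun j x => w x j, fun j x => b x j] with hX
  have D := (IntLE.sum fun k => IntLE.sum fun j =>
    (⟨(h.flow.sm k j).continuous.abs.pow 3, hC k j⟩ :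
      IntLE (L / 4) (fun x => |X k j x| ^ 3) (C * L))).const_mul (c := 9) (by norm_num)
  have c3 : Continuous fun x => ‖u x‖ ^ 3 + ‖b x‖ ^ 3 + ‖w x‖ ^ 3 := by fun_prop
  refine le_trans ?_ D.le
  refine (setIntegral_mono_set (integrableOn_cube c3 (L / 4)) (Eventually.of_forall fun x => by
    positivity) (Set.sdiff_subset.trans (ball_subset_cube _)).eventuallyLE).trans ?_
  refine integral_mono (integrableOn_cube c3 _) (integrableOn_cube D.cont _) fun x => ?_
  have h1 := norm_pow_three_le (u x)
  have h2 := norm_pow_three_le (b x)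
  have h3 := norm_pow_three_le (w x)
  dsimp only
  rw [Fin.sum_univ_three (fun k => ∑ j, |X k j x| ^ 3)]
  simp only [hX, Matrix.cons_val_zero, Matrix.cons_val_one, Matrix.cons_val]
  linarith

/-- Uniform bound on the scaled cubic annulus integrals and decay of the scaled
quadratic annulus integrals under the potential growth hypothesis. -/
theorem annulus_quadratic_decay
    (u w b : E3 → E3) (P : E3 → ℝ) (hsol : IsMMPSolution u w b P)
    (Φ Ψ Υ : E3 → Fin 3 → Fin 3 → ℝ)
    (hΦ : ∀ i j, ContDiff ℝ (⊤ : ℕ∞) (fun x => Φ x i j))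
    (hΨ : ∀ i j, ContDiff ℝ (⊤ : ℕ∞) (fun x => Ψ x i j))
    (hΥ : ∀ i j, ContDiff ℝ (⊤ : ℕ∞) (fun x => Υ x i j))
    (hΦu : ∀ (x : E3) (j : Fin 3), mdiv Φ x j = u x j)
    (hΨb : ∀ (x : E3) (j : Fin 3), mdiv Ψ x j = b x j)
    (hΥw : ∀ (x : E3) (j : Fin 3), mdiv Υ x j = w x j)
    (s : ℝ) (hs1 : 3 < s) (hs2 : s ≤ 6)
    (C₀ : ℝ) (hC₀ : 0 < C₀)
    (hosc : ∀ r : ℝ, 1 < r →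
      meanOsc Φ s r + meanOsc Ψ s r + meanOsc Υ s r ≤ C₀ * r ^ ((1:ℝ)/3 - 1/s))
    : (∃ M : ℝ, ∀ ρ : ℝ, 1 / 2 ≤ ρ →
        ρ⁻¹ * (∫ x in ball3 (2 * ρ) \ ball3 ρ, (‖u x‖ ^ 3 + ‖b x‖ ^ 3 + ‖w x‖ ^ 3)) ≤ M) ∧
      Tendsto
        (fun ρ : ℝ =>
          (ρ ^ 2)⁻¹ * ∫ x in ball3 (2 * ρ) \ ball3 ρ, (‖u x‖ ^ 2 + ‖b x‖ ^ 2 + ‖w x‖ ^ 2))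
        atTop (nhds 0) := by
  have hu := hsol.smooth_u.continuous
  have hw := hsol.smooth_w.continuous
  have hb := hsol.smooth_b.continuous
  obtain ⟨C, hC⟩ := exists_cubic_linear_bound hs1 hs2
    (A := (volume (ball3 1)).toReal * (C₀ ^ s * 3 ^ (s / 3 + 2))) (by positivity)
  have main : ∀ ρ : ℝ, 1 / 2 ≤ ρ →
      ∫ x in ball3 (2 * ρ) \ ball3 ρ, (‖u x‖ ^ 3 + ‖b x‖ ^ 3 + ‖w x‖ ^ 3) ≤ 648 * C * ρ := by
    intro ρ hρ
    have S := systemData_of_meanOsc (L := 8 * ρ) hsol hΦ hΨ hΥ hΦu hΨb hΥw hs1 hC₀ (by linarith)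
      (hosc _ (by linarith))
    have := cubic_annulus_le S (hC S) hu hw hb ρ
    rw [show 8 * ρ / 4 = 2 * ρ by ring] at this
    linarith
  refine ⟨⟨648 * C, fun ρ hρ => ?_⟩, ?_⟩
  · rw [inv_mul_le_iff₀ (by linarith), mul_comm ρ]
    exact main ρ hρ
  · have lim : Tendsto (fun ρ : ℝ => (24 * (volume (ball3 1)).toReal + 648 * C) *
        ρ ^ (-(1 / 3) : ℝ)) atTop (𝓝 0) := by
      simpa using (tendsto_rpow_neg_atTop (show (0 : ℝ) < 1 / 3 by norm_num)).const_mul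
        (24 * (volume (ball3 1)).toReal + 648 * C)
    refine squeeze_zero' ?_ ?_ lim
    · exact Eventually.of_forall fun ρ => mul_nonneg (by positivity)
        (integral_nonneg fun x => by positivity)
    · filter_upwards [eventually_ge_atTop (1 / 2 : ℝ)] with ρ hρ
      exact quadratic_annulus_le hu hw hb (by linarith) (main ρ hρ)
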